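/- arXiv:2109.12708 — 8 statements merged into one kernel-verified Lean document; each statement's English description precedes it below -/
import Mathlib

section
/- Let C be a (locally small) category with pullbacks. Let p, q : G ⇉ X and s, t : H ⇉ Y be reflexive graphs in C, let U be a coequalizer of (yoneda.map p, yoneda.map q) and V a coequalizer of (yoneda.map s, yoneda.map t) in the presheaf category [Cᵒᵖ, Set], and let f, g : U ⇉ V be a parallel pair admitting a common section h : V → U (f∘h = 1_V and g∘h = 1_V). Then there exists a reflexive graph s′, t′ : L ⇉ Y in C such that the coequalizer of (f, g) in [Cᵒᵖ, Set] is isomorphic to the coequalizer of (yoneda.map s′, yoneda.map t′). In particular, the full subcategory of [Cᵒᵖ, Set] on coequalizers of reflexive graphs in C is closed under reflexive coequalizers. -/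
open CategoryTheory CategoryTheory.Limits

/-- Two elements of a presheaf which become equal in the coequalizer of `α` and `β` are connected by
a zigzag. -/
lemma coequalizer_π_app_eqvGen {C : Type u} [Category.{v} C] {F G : Cᵒᵖ ⥤ Type w} (α β : F ⟶ G)
    (c : Cᵒᵖ) (x y : G.obj c)
    (hxy : (coequalizer.π α β).app c x = (coequalizer.π α β).app c y) :
    Relation.EqvGen (Function.Coequalizer.Rel (α.app c) (β.app c)) x y := by
  let E := (evaluation Cᵒᵖ (Type w)).obj c
  have key : E.map (coequalizer.π α β) ≫ (PreservesCoequalizer.iso E α β).inv ≫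
      (Types.coequalizerIso (E.map α) (E.map β)).hom =
        ↾(Function.Coequalizer.mk (E.map α) (E.map β)) := by
    rw [map_π_preserves_coequalizer_inv_assoc, Types.coequalizerIso_π_comp_hom]
  refine Quot.eqvGen_exact ?_
  have hx := ConcreteCategory.congr_hom key x
  have hy := ConcreteCategory.congr_hom key y
  refine hx.symm.trans (Eq.trans ?_ hy)
  exact congrArg
    ((PreservesCoequalizer.iso E α β).inv ≫ (Types.coequalizerIso (E.map α) (E.map β)).hom) hxy

lemma yoneda_map_comp_coequalizer_π_eqvGen {C : Type u} [Category.{v} C] {H Y : C} (s t : H ⟶ Y)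
    {c : C} (a b : c ⟶ Y)
    (hab : yoneda.map a ≫ coequalizer.π (yoneda.map s) (yoneda.map t) =
      yoneda.map b ≫ coequalizer.π (yoneda.map s) (yoneda.map t)) :
    Relation.EqvGen (fun a b : c ⟶ Y => ∃ k : c ⟶ H, k ≫ s = a ∧ k ≫ t = b) a b := by
  refine (coequalizer_π_app_eqvGen (yoneda.map s) (yoneda.map t) (.op c) a b ?_).mono ?_
  · rw [← Category.id_comp a, ← Category.id_comp b]
    exact ConcreteCategory.congr_hom (NatTrans.congr_app hab (.op c)) (𝟙 c)
  · rintro _ _ ⟨k⟩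
    exact ⟨k, rfl, rfl⟩

/-- Spans on `Y` compose: the edges of the composite include all composites of edges, and it is
coequalized by every morphism that coequalizes both spans. -/
lemma exists_span_comp {C : Type u} [Category.{v} C] [HasPullbacks C] {A B Y : C}
    (s₁ t₁ : A ⟶ Y) (s₂ t₂ : B ⟶ Y) :
    ∃ (L : C) (s t : L ⟶ Y),
      (∀ {c : C} (x : c ⟶ A) (y : c ⟶ B), x ≫ t₁ = y ≫ s₂ →
        ∃ l : c ⟶ L, l ≫ s = x ≫ s₁ ∧ l ≫ t = y ≫ t₂) ∧
      ∀ {Q : Cᵒᵖ ⥤ Type v} (e : yoneda.obj Y ⟶ Q), yoneda.map s₁ ≫ e = yoneda.map t₁ ≫ e →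
        yoneda.map s₂ ≫ e = yoneda.map t₂ ≫ e → yoneda.map s ≫ e = yoneda.map t ≫ e := by
  refine ⟨pullback t₁ s₂, pullback.fst _ _ ≫ s₁, pullback.snd _ _ ≫ t₂,
    fun x y h => ⟨pullback.lift x y h, pullback.lift_fst_assoc _ _ h _,
      pullback.lift_snd_assoc _ _ h _⟩, fun e h₁ h₂ => ?_⟩
  rw [Functor.map_comp, Functor.map_comp, Category.assoc, Category.assoc, h₁, ← h₂,
    ← Functor.map_comp_assoc, pullback.condition, Functor.map_comp_assoc]

/-- A zigzag between two morphisms `a, b : c ⟶ Y` along a reflexive graph on `Y` is an edge of a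
single reflexive graph on `Y`, which is coequalized by every morphism that coequalizes the
original one. -/
lemma exists_reflexive_graph_of_eqvGen {C : Type u} [Category.{v} C] [HasPullbacks C] {H Y : C}
    (s t : H ⟶ Y) (r : Y ⟶ H) (hrs : r ≫ s = 𝟙 Y) (hrt : r ≫ t = 𝟙 Y)
    {Q : Cᵒᵖ ⥤ Type v} (e : yoneda.obj Y ⟶ Q)
    (he : yoneda.map s ≫ e = yoneda.map t ≫ e) {c : C} {a b : c ⟶ Y}
    (hab : Relation.EqvGen (fun a b : c ⟶ Y => ∃ k : c ⟶ H, k ≫ s = a ∧ k ≫ t = b) a b) :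
    ∃ (K : C) (s₁ t₁ : K ⟶ Y) (ρ : Y ⟶ K) (k : c ⟶ K), ρ ≫ s₁ = 𝟙 Y ∧ ρ ≫ t₁ = 𝟙 Y ∧
      k ≫ s₁ = a ∧ k ≫ t₁ = b ∧ yoneda.map s₁ ≫ e = yoneda.map t₁ ≫ e := by
  induction hab with
  | rel a b hk =>
    obtain ⟨k, hs, ht⟩ := hk
    exact ⟨H, s, t, r, k, hrs, hrt, hs, ht, he⟩
  | refl a => exact ⟨Y, 𝟙 Y, 𝟙 Y, 𝟙 Y, a, by simp, by simp, by simp, by simp, rfl⟩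
  | symm a b _ ih =>
    obtain ⟨K, s₁, t₁, ρ, k, hρs, hρt, hs, ht, hK⟩ := ih
    exact ⟨K, t₁, s₁, ρ, k, hρt, hρs, ht, hs, hK.symm⟩
  | trans a b d _ _ ih₁ ih₂ =>
    obtain ⟨K₁, s₁, t₁, ρ₁, k₁, hρs₁, hρt₁, hs₁, ht₁, hK₁⟩ := ih₁
    obtain ⟨K₂, s₂, t₂, ρ₂, k₂, hρs₂, hρt₂, hs₂, ht₂, hK₂⟩ := ih₂
    obtain ⟨L, s', t', lift, hL⟩ := exists_span_comp s₁ t₁ s₂ t₂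
    obtain ⟨ρ, hρs, hρt⟩ := lift ρ₁ ρ₂ (hρt₁.trans hρs₂.symm)
    obtain ⟨k, hs, ht⟩ := lift k₁ k₂ (ht₁.trans hs₂.symm)
    exact ⟨L, s', t', ρ, k, hρs.trans hρs₁, hρt.trans hρt₂, hs.trans hs₁, ht.trans ht₂,
      hL e hK₁ hK₂⟩

/-- A morphism out of a representable presheaf lifts along an epimorphism onto a morphism between
representables. -/
lemma exists_yoneda_map_comp_eq {C : Type u} [Category.{v} C] {X Y : C} {Q : Cᵒᵖ ⥤ Type v}
    (π : yoneda.obj Y ⟶ Q) [Epi π] (φ : yoneda.obj X ⟶ Q) :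
    ∃ a : X ⟶ Y, yoneda.map a ≫ π = φ := by
  obtain ⟨a, ha⟩ := (epi_iff_surjective (π.app (.op X))).mp inferInstance (yonedaEquiv φ)
  refine ⟨a, yonedaEquiv.injective ?_⟩
  rw [yonedaEquiv_comp, yonedaEquiv_yoneda_map, ha]

/-- In a category with pullbacks `C`, given reflexive graphs `p, q : G ⇉ X` and
`s, t : H ⇉ Y`, with `U` the coequalizer of `(yoneda.map p, yoneda.map q)` and
`V` the coequalizer of `(yoneda.map s, yoneda.map t)` in `[Cᵒᵖ, Set]`, any
reflexive pair `f, g : U ⇉ V` (with common section `h`) has its coequalizer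
isomorphic to the coequalizer of the Yoneda image of some reflexive graph
`s′, t′ : L ⇉ Y` in `C`. -/
theorem reflexive_coequalizer_of_coequalizers_of_reflexive_graphs
    {C : Type u} [Category.{v} C] [HasPullbacks C]
    {X Y G H : C} (p q : G ⟶ X) (r : X ⟶ G)
    (hrp : r ≫ p = 𝟙 X) (hrq : r ≫ q = 𝟙 X)
    (s t : H ⟶ Y) (r' : Y ⟶ H)
    (hrs : r' ≫ s = 𝟙 Y) (hrt : r' ≫ t = 𝟙 Y)
    (f g : coequalizer (yoneda.map p) (yoneda.map q) ⟶
      coequalizer (yoneda.map s) (yoneda.map t))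
    (h : coequalizer (yoneda.map s) (yoneda.map t) ⟶
      coequalizer (yoneda.map p) (yoneda.map q))
    (hf : h ≫ f = 𝟙 _) (hg : h ≫ g = 𝟙 _) :
    ∃ (L : C) (s' t' : L ⟶ Y) (r'' : Y ⟶ L),
      r'' ≫ s' = 𝟙 Y ∧ r'' ≫ t' = 𝟙 Y ∧
      Nonempty (coequalizer f g ≅ coequalizer (yoneda.map s') (yoneda.map t')) := by
  set πU := coequalizer.π (yoneda.map p) (yoneda.map q)
  set πV := coequalizer.π (yoneda.map s) (yoneda.map t)
  obtain ⟨f₀, hf₀⟩ := exists_yoneda_map_comp_eq πV (πU ≫ f)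
  obtain ⟨g₀, hg₀⟩ := exists_yoneda_map_comp_eq πV (πU ≫ g)
  obtain ⟨h₀, hh₀⟩ := exists_yoneda_map_comp_eq πU (πV ≫ h)
  have hst : yoneda.map s ≫ πV = yoneda.map t ≫ πV := coequalizer.condition _ _
  obtain ⟨K₁, s₁, t₁, ρ₁, k₁, hρs₁, hρt₁, hs₁, ht₁, hK₁⟩ :=
    exists_reflexive_graph_of_eqvGen s t r' hrs hrt πV hst
      (yoneda_map_comp_coequalizer_π_eqvGen s t (𝟙 Y) (h₀ ≫ f₀) (by
        change _ ≫ πV = _ ≫ πV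
        simp [hf₀, reassoc_of% hh₀, hf]))
  obtain ⟨K₂, s₂, t₂, ρ₂, k₂, hρs₂, hρt₂, hs₂, ht₂, hK₂⟩ :=
    exists_reflexive_graph_of_eqvGen s t r' hrs hrt πV hst
      (yoneda_map_comp_coequalizer_π_eqvGen s t (h₀ ≫ g₀) (𝟙 Y) (by
        change _ ≫ πV = _ ≫ πV
        simp [hg₀, reassoc_of% hh₀, hg]))
  -- `L` is the composite of the spans `(s, t)`, `(s₁, t₁)`, `(f₀, g₀)` and `(s₂, t₂)`.
  obtain ⟨P, sP, tP, liftP, hP⟩ := exists_span_comp s t s₁ t₁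
  obtain ⟨P', sP', tP', liftP', hP'⟩ := exists_span_comp f₀ g₀ s₂ t₂
  obtain ⟨L, s', t', liftL, hL⟩ := exists_span_comp sP tP sP' tP'
  have lift {c : C} (a : c ⟶ H) (b : c ⟶ K₁) (x : c ⟶ X) (d : c ⟶ K₂) (hab : a ≫ t = b ≫ s₁)
      (hbx : b ≫ t₁ = x ≫ f₀) (hxd : x ≫ g₀ = d ≫ s₂) :
      ∃ l : c ⟶ L, l ≫ s' = a ≫ s ∧ l ≫ t' = d ≫ t₂ := by
    obtain ⟨y, hys, hyt⟩ := liftP a b hab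
    obtain ⟨z, hzs, hzt⟩ := liftP' x d hxd
    obtain ⟨l, hls, hlt⟩ := liftL y z (by rw [hyt, hzs, hbx])
    exact ⟨l, hls.trans hys, hlt.trans hzt⟩
  obtain ⟨r'', hrs', hrt'⟩ := lift r' k₁ h₀ k₂ (by rw [hrt, hs₁]) ht₁ hs₂.symm
  obtain ⟨lH, hlHs, hlHt⟩ := lift (𝟙 H) (t ≫ k₁) (t ≫ h₀) (t ≫ k₂)
    (by simp [hs₁]) (by simp [ht₁]) (by simp [hs₂])
  obtain ⟨lX, hlXs, hlXt⟩ := lift (f₀ ≫ r') (f₀ ≫ ρ₁) (𝟙 X) (g₀ ≫ ρ₂)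
    (by simp [hρs₁, hrt]) (by simp [hρt₁]) (by simp [hρs₂])
  simp only [Category.assoc, Category.id_comp, hrs, ht₂, hρt₂, Category.comp_id]
    at hlHs hlHt hlXs hlXt
  refine ⟨L, s', t', r'', hrs'.trans hrs, hrt'.trans ht₂, ⟨?_⟩⟩
  let π' := coequalizer.π (yoneda.map s') (yoneda.map t')
  have hπ' : yoneda.map s' ≫ π' = yoneda.map t' ≫ π' := coequalizer.condition _ _
  have hstπ' : yoneda.map s ≫ π' = yoneda.map t ≫ π' := by
    rw [← hlHs, ← hlHt, Functor.map_comp_assoc, Functor.map_comp_assoc, hπ']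
  have hfgπ' : yoneda.map f₀ ≫ π' = yoneda.map g₀ ≫ π' := by
    rw [← hlXs, ← hlXt, Functor.map_comp_assoc, Functor.map_comp_assoc, hπ']
  let e := πV ≫ coequalizer.π f g
  have hfge : yoneda.map f₀ ≫ e = yoneda.map g₀ ≫ e := by
    rw [reassoc_of% hf₀, reassoc_of% hg₀, coequalizer.condition]
  have he : yoneda.map s' ≫ e = yoneda.map t' ≫ e :=
    hL e (hP e (by simp only [e, reassoc_of% hst]) (by simp only [e, reassoc_of% hK₁]))
      (hP' e hfge (by simp only [e, reassoc_of% hK₂]))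
  let d := coequalizer.desc π' hstπ'
  have hd : πV ≫ d = π' := coequalizer.π_desc _ _
  have hfgd : f ≫ d = g ≫ d := by
    rw [← cancel_epi πU, ← reassoc_of% hf₀, ← reassoc_of% hg₀, hd, hfgπ']
  refine ⟨coequalizer.desc d hfgd, coequalizer.desc e he, ?_, ?_⟩
  · rw [← cancel_epi (coequalizer.π f g), ← cancel_epi πV, coequalizer.π_desc_assoc,
      reassoc_of% hd, coequalizer.π_desc, Category.comp_id]
  · rw [← cancel_epi π', coequalizer.π_desc_assoc, Category.assoc, coequalizer.π_desc, hd,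
      Category.comp_id]
end

section
/- Let C be a sifted category with pullbacks. Then every graph p, q : G ⇉ X in C is contained in some reflexive graph: there exist an object H, a reflexive graph s, t : H ⇉ X (with common section r : X → H), and a morphism f : G → H with s∘f = p and t∘f = q. -/
open CategoryTheory CategoryTheory.Limits

/-- If `J` is connected and the feet of every cospan in `J` are the feet of a
span, then so are any two objects of `J`. -/
theorem exists_span_of_isPreconnected {J : Type u} [Category.{v} J] [IsPreconnected J]
    (h : ∀ {a b c : J} (_ : a ⟶ c) (_ : b ⟶ c), ∃ d : J, Nonempty (d ⟶ a) ∧ Nonempty (d ⟶ b))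
    (a b : J) : ∃ d : J, Nonempty (d ⟶ a) ∧ Nonempty (d ⟶ b) := by
  refine equiv_relation (fun a b : J => ∃ d : J, Nonempty (d ⟶ a) ∧ Nonempty (d ⟶ b))
    ⟨fun a => ⟨a, ⟨𝟙 a⟩, ⟨𝟙 a⟩⟩, fun ⟨d, ha, hb⟩ => ⟨d, hb, ha⟩, ?_⟩
    (fun {a _} f => ⟨a, ⟨𝟙 a⟩, ⟨f⟩⟩) a b
  rintro a b c ⟨d, ⟨f⟩, ⟨g⟩⟩ ⟨e, ⟨k⟩, ⟨l⟩⟩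
  obtain ⟨x, ⟨m⟩, ⟨n⟩⟩ := h g k
  exact ⟨x, ⟨m ≫ f⟩, ⟨n ≫ l⟩⟩

/-- If `C` has pullbacks, the feet of a cospan in `StructuredArrow P (Functor.diag C)` are also
the feet of a span. -/
theorem exists_span_structuredArrow_diag {C : Type u} [Category.{v} C] [HasPullbacks C]
    {P : C × C} {a b c : StructuredArrow P (Functor.diag C)} (f : a ⟶ c) (g : b ⟶ c) :
    ∃ d : StructuredArrow P (Functor.diag C), Nonempty (d ⟶ a) ∧ Nonempty (d ⟶ b) := by
  have hfg := (StructuredArrow.w f).trans (StructuredArrow.w g).symm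
  have h₁ : a.hom.1 ≫ f.right = b.hom.1 ≫ g.right := congrArg (fun k => k.1) hfg
  have h₂ : a.hom.2 ≫ f.right = b.hom.2 ≫ g.right := congrArg (fun k => k.2) hfg
  let u : P ⟶ (Functor.diag C).obj (pullback f.right g.right) :=
    (pullback.lift a.hom.1 b.hom.1 h₁, pullback.lift a.hom.2 b.hom.2 h₂)
  exact ⟨StructuredArrow.mk u,
    ⟨StructuredArrow.homMk (pullback.fst _ _) (Prod.ext (pullback.lift_fst _ _ h₁)
      (pullback.lift_fst _ _ h₂))⟩,
    ⟨StructuredArrow.homMk (pullback.snd _ _) (Prod.ext (pullback.lift_snd _ _ h₁)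
      (pullback.lift_snd _ _ h₂))⟩⟩

/-- In a sifted category with pullbacks, every graph `p, q : G ⇉ X` is contained
in a reflexive graph `s, t : H ⇉ X`. -/
theorem graph_contained_in_reflexive_graph
    {C : Type u} [Category.{v} C] [IsSifted C] [HasPullbacks C]
    {X G : C} (p q : G ⟶ X) :
    ∃ (H : C) (s t : H ⟶ X) (r : X ⟶ H) (f : G ⟶ H),
      r ≫ s = 𝟙 X ∧ r ≫ t = 𝟙 X ∧ f ≫ s = p ∧ f ≫ t = q := by
  have : IsConnected (StructuredArrow (X, G) (Functor.diag C)) := Functor.Final.out (X, G)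
  let a (k : G ⟶ X) : StructuredArrow (X, G) (Functor.diag C) :=
    StructuredArrow.mk (Y := X) ((𝟙 X, k) : (X, G) ⟶ (Functor.diag C).obj X)
  obtain ⟨d, ⟨s⟩, ⟨t⟩⟩ := exists_span_of_isPreconnected exists_span_structuredArrow_diag (a p) (a q)
  have hs := StructuredArrow.w s
  have ht := StructuredArrow.w t
  exact ⟨d.right, s.right, t.right, d.hom.1, d.hom.2, congrArg (fun k => k.1) hs,
    congrArg (fun k => k.1) ht, congrArg (fun k => k.2) hs, congrArg (fun k => k.2) ht⟩
end

section
/- Let C be a category with pullbacks which has reflexive coequalizers (coequalizers of all parallel pairs admitting a common section) and all small filtered colimits. Then C has all small sifted colimits: for every small sifted category J, C has colimits of shape J. -/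
open CategoryTheory CategoryTheory.Limits

section

universe v u u₁

namespace CategoryTheory

open Opposite

variable {E : Type u} [Category.{v} E]

/-- A parallel pair of morphisms `R ⇉ A` together with a common section. -/
structure ReflexivePairOn (A : E) where
  /-- The source of the pair. -/
  R : E
  /-- The first morphism. -/
  f : R ⟶ A
  /-- The second morphism. -/
  g : R ⟶ A
  /-- The common section. -/
  s : A ⟶ R
  s_f : s ≫ f = 𝟙 A
  s_g : s ≫ g = 𝟙 A

namespace ReflexivePairOn

attribute [simp] s_f s_g

/-- Two morphisms to the target of a reflexive pair are related if they factor jointly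
through the pair. -/
def Rel {A : E} (p : ReflexivePairOn A) {X : E} (x y : X ⟶ A) : Prop :=
  ∃ z : X ⟶ p.R, z ≫ p.f = x ∧ z ≫ p.g = y

/-- The trivial reflexive pair on an object. -/
def refl (A : E) : ReflexivePairOn A where
  R := A
  f := 𝟙 A
  g := 𝟙 A
  s := 𝟙 A
  s_f := by simp
  s_g := by simp

lemma rel_f_g {A : E} (p : ReflexivePairOn A) : p.Rel p.f p.g := ⟨𝟙 _, by simp⟩

lemma Rel.trans_le {A X : E} {p q : ReflexivePairOn A} {x y : X ⟶ A} (h : p.Rel x y)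
    (hq : q.Rel p.f p.g) : q.Rel x y := by
  obtain ⟨z, rfl, rfl⟩ := h
  obtain ⟨w, h₁, h₂⟩ := hq
  exact ⟨z ≫ w, by simp [h₁, h₂]⟩

section HasPullbacks

variable [HasPullbacks E]

/-- The relational composite of two reflexive pairs. -/
noncomputable def comp {A : E} (p q : ReflexivePairOn A) : ReflexivePairOn A where
  R := pullback p.g q.f
  f := pullback.fst _ _ ≫ p.f
  g := pullback.snd _ _ ≫ q.g
  s := pullback.lift p.s q.s
  s_f := by simp [pullback.lift_fst_assoc]
  s_g := by simp [pullback.lift_snd_assoc]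

lemma comp_rel_left {A : E} (p q : ReflexivePairOn A) : (p.comp q).Rel p.f p.g :=
  ⟨pullback.lift (𝟙 _) (p.g ≫ q.s) (by simp),
    (pullback.lift_fst_assoc _ _ _ _).trans (by simp),
    (pullback.lift_snd_assoc _ _ _ _).trans (by simp)⟩

lemma comp_rel_right {A : E} (p q : ReflexivePairOn A) : (p.comp q).Rel q.f q.g :=
  ⟨pullback.lift (q.f ≫ p.s) (𝟙 _) (by simp),
    (pullback.lift_fst_assoc _ _ _ _).trans (by simp),
    (pullback.lift_snd_assoc _ _ _ _).trans (by simp)⟩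

/-- Two morphisms `X ⟶ A` are connected by a zigzag of cospans under `X` and `A`. The limit
of this zigzag, which is built from pullbacks, is a reflexive pair on `A`. -/
lemma exists_rel [IsSiftedOrEmpty E] {X A : E} (x y : X ⟶ A) :
    ∃ p : ReflexivePairOn A, p.Rel x y := by
  have : IsConnected (StructuredArrow (X, A) (Functor.diag E)) := Functor.Final.out _
  let S : Set (StructuredArrow (X, A) (Functor.diag E)) := fun c ↦
    ∃ (R : E) (f : R ⟶ A) (g : R ⟶ c.right) (s : A ⟶ R) (z : X ⟶ R),
      s ≫ f = 𝟙 A ∧ s ≫ g = c.hom.2 ∧ z ≫ f = x ∧ z ≫ g = c.hom.1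
  let c₀ : StructuredArrow (X, A) (Functor.diag E) := .mk (Y := A) (x, 𝟙 A)
  let c₁ : StructuredArrow (X, A) (Functor.diag E) := .mk (Y := A) (y, 𝟙 A)
  have h₀ : c₀ ∈ S := ⟨A, 𝟙 A, 𝟙 A, 𝟙 A, x, by simp [c₀]⟩
  obtain ⟨R, f, g, s, z, hsf, hsg, hzf, hzg⟩ : c₁ ∈ S := by
    refine induct_on_objects S h₀ (fun {c d} φ ↦ ?_) c₁
    have w₁ : c.hom.1 ≫ φ.right = d.hom.1 :=
      congrArg (fun t : (X, A) ⟶ (d.right, d.right) ↦ t.1) (StructuredArrow.w φ)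
    have w₂ : c.hom.2 ≫ φ.right = d.hom.2 :=
      congrArg (fun t : (X, A) ⟶ (d.right, d.right) ↦ t.2) (StructuredArrow.w φ)
    constructor
    · rintro ⟨R, f, g, s, z, hsf, hsg, hzf, hzg⟩
      exact ⟨R, f, g ≫ φ.right, s, z, hsf, by rw [reassoc_of% hsg, w₂], hzf,
        by rw [reassoc_of% hzg, w₁]⟩
    · rintro ⟨R, f, g, s, z, hsf, hsg, hzf, hzg⟩
      exact ⟨pullback g φ.right, pullback.fst _ _ ≫ f, pullback.snd _ _,
        pullback.lift s c.hom.2 (by rw [hsg, w₂]), pullback.lift z c.hom.1 (by rw [hzg, w₁]),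
        by simp [pullback.lift_fst_assoc, hsf], pullback.lift_snd _ _ _,
        by simp [pullback.lift_fst_assoc, hzf], pullback.lift_snd _ _ _⟩
  exact ⟨⟨R, f, g, s, hsf, hsg⟩, z, hzf, hzg⟩

lemma exists_rel_and_rel [IsSiftedOrEmpty E] {X X' A : E} (x y : X ⟶ A) (x' y' : X' ⟶ A) :
    ∃ p : ReflexivePairOn A, p.Rel x y ∧ p.Rel x' y' := by
  obtain ⟨p, hp⟩ := exists_rel x y
  obtain ⟨q, hq⟩ := exists_rel x' y'
  exact ⟨p.comp q, hp.trans_le (comp_rel_left p q), hq.trans_le (comp_rel_right p q)⟩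

end HasPullbacks

section Quotient

/-- The coequalizer in presheaves of a reflexive pair. -/
noncomputable def quotient {A : E} (p : ReflexivePairOn A) : Eᵒᵖ ⥤ Type v :=
  coequalizer (yoneda.map p.f) (yoneda.map p.g)

/-- The projection to the coequalizer in presheaves of a reflexive pair. -/
noncomputable def π {A : E} (p : ReflexivePairOn A) : yoneda.obj A ⟶ p.quotient :=
  coequalizer.π _ _

instance {A : E} (p : ReflexivePairOn A) : Epi p.π :=
  inferInstanceAs (Epi (coequalizer.π _ _))

lemma Rel.map_π_eq {A X : E} {p : ReflexivePairOn A} {x y : X ⟶ A} (h : p.Rel x y) :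
    yoneda.map x ≫ p.π = yoneda.map y ≫ p.π := by
  obtain ⟨z, rfl, rfl⟩ := h
  have : yoneda.map p.f ≫ p.π = yoneda.map p.g ≫ p.π := coequalizer.condition _ _
  simp [this]

lemma exists_desc {A : E} (p : ReflexivePairOn A) {W : Eᵒᵖ ⥤ Type v} (k : yoneda.obj A ⟶ W)
    (hk : yoneda.map p.f ≫ k = yoneda.map p.g ≫ k) :
    ∃ l : p.quotient ⟶ W, p.π ≫ l = k :=
  ⟨coequalizer.desc k hk, coequalizer.π_desc _ _⟩

lemma exists_lift {A X : E} (p : ReflexivePairOn A) (k : yoneda.obj X ⟶ p.quotient) :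
    ∃ x : X ⟶ A, yoneda.map x ≫ p.π = k := by
  have h : Function.Surjective (p.π.app (op X)) := by
    rw [← epi_iff_surjective]
    infer_instance
  obtain ⟨x, hx⟩ := h (yonedaEquiv k)
  refine ⟨x, yonedaEquiv.injective ?_⟩
  rw [← hx, yonedaEquiv_comp]
  simp [yonedaEquiv]

variable (E) in
/-- The objects of this category are all reflexive pairs in `E`, and its morphisms are those
between their coequalizers in presheaves. -/
abbrev QuotientCategory :=
  InducedCategory (Eᵒᵖ ⥤ Type v) (fun p : Σ A : E, ReflexivePairOn A ↦ p.2.quotient)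

variable (E) in
/-- The inclusion of the coequalizers of reflexive pairs into presheaves. -/
noncomputable abbrev quotientFunctor : QuotientCategory E ⥤ Eᵒᵖ ⥤ Type v :=
  inducedFunctor _

instance [HasPullbacks E] [IsSifted E] : IsFiltered (QuotientCategory E) where
  nonempty :=
    have : Nonempty E := IsSifted.nonempty
    ⟨⟨Classical.arbitrary E, refl _⟩⟩
  cocone_objs := by
    rintro ⟨A, p⟩ ⟨B, q⟩
    have : IsConnected (StructuredArrow (A, B) (Functor.diag E)) := Functor.Final.out _
    let c : StructuredArrow (A, B) (Functor.diag E) := Classical.arbitrary _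
    let a : A ⟶ c.right := c.hom.1
    let b : B ⟶ c.right := c.hom.2
    obtain ⟨r, hp, hq⟩ := exists_rel_and_rel (p.f ≫ a) (p.g ≫ a) (q.f ≫ b) (q.g ≫ b)
    obtain ⟨l, -⟩ := p.exists_desc (yoneda.map a ≫ r.π) (by simpa using hp.map_π_eq)
    obtain ⟨m, -⟩ := q.exists_desc (yoneda.map b ≫ r.π) (by simpa using hq.map_π_eq)
    exact ⟨⟨c.right, r⟩, ⟨l⟩, ⟨m⟩, trivial⟩
  cocone_maps := by
    rintro ⟨A, p⟩ ⟨B, q⟩ ⟨(h : p.quotient ⟶ q.quotient)⟩ ⟨(k : p.quotient ⟶ q.quotient)⟩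
    obtain ⟨x, hx⟩ := q.exists_lift (p.π ≫ h)
    obtain ⟨y, hy⟩ := q.exists_lift (p.π ≫ k)
    obtain ⟨r, hr, hr'⟩ := exists_rel_and_rel x y q.f q.g
    obtain ⟨l, hl⟩ := q.exists_desc r.π hr'.map_π_eq
    refine ⟨⟨B, r⟩, ⟨l⟩, InducedCategory.hom_ext ?_⟩
    change h ≫ l = k ≫ l
    rw [← cancel_epi p.π, ← reassoc_of% hx, ← reassoc_of% hy, hl, hr.map_π_eq]

end Quotient

/-- Every element of a colimit of all coequalizers of reflexive pairs is the class of the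
identity of an object. -/
lemma eq_of_isColimit {c : Cocone (quotientFunctor E)} (hc : IsColimit c) {X : E}
    (x : yoneda.obj X ⟶ c.pt) :
    x = (refl X).π ≫ c.ι.app ⟨X, refl X⟩ := by
  obtain ⟨⟨A, p⟩, (z : p.quotient.obj (op X)), hz⟩ := Types.jointly_surjective_of_isColimit
    (isColimitOfPreserves ((evaluation _ _).obj (op X)) hc) (yonedaEquiv x)
  obtain ⟨l, hl⟩ := (refl X).exists_desc (yonedaEquiv.symm z) rfl
  have hx : yonedaEquiv.symm z ≫ c.ι.app ⟨A, p⟩ = x := by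
    apply yonedaEquiv.injective
    rw [yonedaEquiv_comp, Equiv.apply_symm_apply]
    exact hz
  let φ : @Quiver.Hom (QuotientCategory E) _ ⟨X, refl X⟩ ⟨A, p⟩ := ⟨l⟩
  rw [← hx, ← hl, Category.assoc]
  exact congrArg ((refl X).π ≫ ·) (c.w φ)

end ReflexivePairOn

section RestrictedYoneda

variable {C : Type u₁} [Category.{v} C] (G : E ⥤ C)

/-- The functor sending `X : C` to the presheaf `C(G -, X)` on `E`. -/
abbrev restrictedYonedaAlong : C ⥤ Eᵒᵖ ⥤ Type v :=
  yoneda ⋙ (Functor.whiskeringLeft _ _ _).obj G.op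

lemma leftAdjointObjIsDefined_yoneda_obj (A : E) :
    (restrictedYonedaAlong G).leftAdjointObjIsDefined (yoneda.obj A) :=
  Functor.CorepresentableBy.isCorepresentable (X := G.obj A)
    { homEquiv := fun {X} ↦
        (yonedaEquiv (F := (restrictedYonedaAlong G).obj X)).symm
      homEquiv_comp := fun g f ↦ by
        apply yonedaEquiv.injective
        simp [yonedaEquiv] }

lemma ReflexivePairOn.leftAdjointObjIsDefined_quotient [HasReflexiveCoequalizers C] {A : E}
    (p : ReflexivePairOn A) :
    (restrictedYonedaAlong G).leftAdjointObjIsDefined p.quotient := by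
  have : HasColimitsOfShape WalkingReflexivePair C := hasReflexiveCoequalizers_iff.2 inferInstance
  let F : WalkingReflexivePair ⥤ Eᵒᵖ ⥤ Type v :=
    reflexivePair (yoneda.map p.f) (yoneda.map p.g) (yoneda.map p.s)
      (by simp [← Functor.map_comp]) (by simp [← Functor.map_comp])
  let c : ReflexiveCofork F := ReflexiveCofork.mk p.π p.rel_f_g.map_π_eq
  have hc : IsColimit c :=
    ReflexiveCofork.isColimitEquiv F c (coequalizerIsCoequalizer (yoneda.map p.f) (yoneda.map p.g))
  refine Functor.leftAdjointObjIsDefined_of_isColimit (c := c) hc ?_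
  rintro (_ | _)
  all_goals exact leftAdjointObjIsDefined_yoneda_obj G _

/-- If `K` is a terminal presheaf at which the left adjoint to `X ↦ C(G -, X)` is defined, then
its value is a colimit of `G`. -/
lemma hasColimit_of_leftAdjointObjIsDefined {K : Eᵒᵖ ⥤ Type v}
    (hK : (restrictedYonedaAlong G).leftAdjointObjIsDefined K)
    (u : ∀ X, K.obj X) (hu : ∀ X (x : K.obj X), x = u X) : HasColimit G := by
  let R := restrictedYonedaAlong G
  have : (R ⋙ coyoneda.obj (op K)).IsCorepresentable := hK
  let r := (R ⋙ coyoneda.obj (op K)).corepresentableBy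
  let η : K ⟶ R.obj (R ⋙ coyoneda.obj (op K)).coreprX := r.homEquiv (𝟙 _)
  have hη {X : C} (f : (R ⋙ coyoneda.obj (op K)).coreprX ⟶ X) :
      r.homEquiv f = η ≫ R.map f := r.homEquiv_eq f
  let c : Cocone G :=
    { pt := (R ⋙ coyoneda.obj (op K)).coreprX
      ι :=
        { app := fun A ↦ η.app (op A) (u (op A))
          naturality := fun A B f ↦ by
            have h := ConcreteCategory.congr_hom (η.naturality f.op) (u (op B))
            change η.app (op A) (K.map f.op (u (op B))) = G.map f ≫ η.app (op B) (u (op B)) at h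
            rw [← h, hu _ (K.map f.op (u (op B)))]
            exact (Category.comp_id _).symm } }
  let τ (s : Cocone G) : K ⟶ R.obj s.pt :=
    { app := fun A ↦ ↾fun _ ↦ s.ι.app A.unop
      naturality := fun A B f ↦ by
        ext
        exact (s.w f.unop).symm }
  exact ⟨⟨c,
    { desc := fun s ↦ r.homEquiv.symm (τ s)
      fac := fun s A ↦ by
        have : η ≫ R.map (r.homEquiv.symm (τ s)) = τ s := by
          rw [← hη, Equiv.apply_symm_apply]
        exact ConcreteCategory.congr_hom (congr_app this (op A)) (u (op A))
      uniq := fun s m hm ↦ by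
        apply r.homEquiv.injective
        rw [Equiv.apply_symm_apply, hη]
        refine NatTrans.ext (funext fun A ↦ ?_)
        ext x
        rw [hu A x]
        exact hm A.unop }⟩⟩

end RestrictedYoneda

/-- Over a small sifted category with pullbacks, the terminal presheaf is a filtered colimit of
reflexive coequalizers of representables, so that every functor `G` has a colimit. -/
lemma hasColimit_of_isSifted_of_hasPullbacks {E : Type v} [SmallCategory E] [IsSifted E]
    [HasPullbacks E] {C : Type u} [Category.{v} C] [HasReflexiveCoequalizers C]
    [HasFilteredColimitsOfSize.{v, v} C] (G : E ⥤ C) : HasColimit G := by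
  have : HasColimitsOfShape (ReflexivePairOn.QuotientCategory E) C :=
    HasFilteredColimitsOfSize.HasColimitsOfShape _
  have hc := colimit.isColimit (ReflexivePairOn.quotientFunctor E)
  refine hasColimit_of_leftAdjointObjIsDefined G
    (Functor.leftAdjointObjIsDefined_of_isColimit hc
      fun p ↦ p.2.leftAdjointObjIsDefined_quotient G) (fun X ↦ yonedaEquiv (F := colimit _) _)
    fun X x ↦ yonedaEquiv.symm.injective
      (((ReflexivePairOn.eq_of_isColimit hc _).trans (Equiv.symm_apply_apply _ _).symm))

/-- A diagram in a category with pullbacks extends along a final functor to a diagram indexed by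
a small category with pullbacks. -/
lemma exists_final_hasPullbacks {J : Type v} [SmallCategory J] {C : Type u} [Category.{v} C]
    [HasPullbacks C] (F : J ⥤ C) :
    ∃ (E : Type v) (_ : SmallCategory E) (_ : HasPullbacks E) (L : J ⥤ E) (G : E ⥤ C),
      L.Final ∧ Nonempty (L ⋙ G ≅ F) := by
  let c : Cocone (F ⋙ yoneda) := colimit.cocone (F ⋙ yoneda)
  let T : J ⥤ CostructuredArrow yoneda c.pt :=
    c.toCostructuredArrow ⋙ CostructuredArrow.pre F yoneda c.pt
  have : T.Final := Presheaf.final_toCostructuredArrow_comp_pre F (colimit.isColimit _)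
  let P : ObjectProperty (CostructuredArrow yoneda c.pt) :=
    (ObjectProperty.ofObj T.obj).limitClosure WalkingCospan
  have hT (j : J) : P (T.obj j) := ObjectProperty.le_limitsClosure _ _ _ ⟨j⟩
  let T' : J ⥤ P.FullSubcategory := P.lift T hT
  have : (T' ⋙ P.ι).Final := ‹T.Final›
  have : T'.Final := Functor.final_of_comp_full_faithful T' P.ι
  have : HasPullbacks P.FullSubcategory :=
    hasLimitsOfShape_of_closedUnderLimits WalkingCospan P
  let e := equivSmallModel.{v} P.FullSubcategory
  have : HasPullbacks (SmallModel.{v} P.FullSubcategory) :=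
    Adjunction.hasLimitsOfShape_of_equivalence e.inverse
  exact ⟨SmallModel.{v} P.FullSubcategory, inferInstance, inferInstance, T' ⋙ e.functor,
    e.inverse ⋙ P.ι ⋙ CostructuredArrow.proj yoneda c.pt, inferInstance,
    ⟨Functor.isoWhiskerLeft T'
      (Functor.isoWhiskerRight e.unitIso.symm (P.ι ⋙ CostructuredArrow.proj yoneda c.pt))⟩⟩

end CategoryTheory

end

/-- A category with pullbacks, reflexive coequalizers and all small filtered
colimits has all small sifted colimits. -/
theorem hasSiftedColimits_of_hasPullbacks_hasReflexiveCoequalizers_hasFilteredColimits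
    {C : Type u} [Category.{v} C] [HasPullbacks C] [HasReflexiveCoequalizers C]
    [HasFilteredColimitsOfSize.{v, v} C]
    (J : Type v) [SmallCategory J] [IsSifted J] :
    HasColimitsOfShape J C := by
  refine ⟨fun F ↦ ?_⟩
  obtain ⟨E, _, _, L, G, _, ⟨e⟩⟩ := exists_final_hasPullbacks F
  have : IsSifted E := IsSifted.of_final_functor_from_sifted L
  have : HasColimit G := hasColimit_of_isSifted_of_hasPullbacks G
  exact hasColimit_of_iso e.symm
end

section
/- Let C be a category with pullbacks which has reflexive coequalizers and all small filtered colimits, and let F : C → D be a functor that preserves reflexive coequalizers and all small filtered colimits. Then F preserves all small sifted colimits: F preserves colimits of shape J for every small sifted category J. -/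
open CategoryTheory CategoryTheory.Limits

namespace SiftedColimit

section

variable {C : Type u} [Category.{v} C] {J : Type v} [SmallCategory J]

/-- A zigzag in the category of objects under `k`, starting at `𝟙 k` and ending at `s`. -/
inductive Walk (k : J) : {m : J} → (k ⟶ m) → Type v
  | nil : Walk k (𝟙 k)
  | fwd {m m' : J} {s : k ⟶ m} (c : Walk k s) (f : m ⟶ m') : Walk k (s ≫ f)
  | bwd {m m' : J} (s : k ⟶ m') (f : m' ⟶ m) (c : Walk k (s ≫ f)) : Walk k s

/-- Concatenation of a closed walk with a walk. -/
def Walk.append {k : J} (c : Walk k (𝟙 k)) : ∀ {m : J} {s : k ⟶ m}, Walk k s → Walk k s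
  | _, _, .nil => c
  | _, _, .fwd d f => .fwd (c.append d) f
  | _, _, .bwd s f d => .bwd s f (c.append d)

/-- A span from `X.obj k` to `X.obj m` with a section of its left leg lying over `s`. -/
structure SectionedSpan (X : J ⥤ C) {k m : J} (s : k ⟶ m) where
  /-- The apex of the span. -/
  pt : C
  /-- The left leg. -/
  left : pt ⟶ X.obj k
  /-- The right leg. -/
  right : pt ⟶ X.obj m
  /-- The section. -/
  sec : X.obj k ⟶ pt
  sec_left : sec ≫ left = 𝟙 _
  sec_right : sec ≫ right = X.map s

variable [HasPullbacks C] (X : J ⥤ C)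

/-- The limit of `X` along a walk. -/
noncomputable def Walk.span {k : J} : ∀ {m : J} {s : k ⟶ m}, Walk k s → SectionedSpan X s
  | _, _, .nil => ⟨X.obj k, 𝟙 _, 𝟙 _, 𝟙 _, by simp, by simp⟩
  | _, _, .fwd c f =>
      { pt := c.span.pt
        left := c.span.left
        right := c.span.right ≫ X.map f
        sec := c.span.sec
        sec_left := c.span.sec_left
        sec_right := by rw [← Category.assoc, c.span.sec_right, X.map_comp] }
  | _, _, .bwd s f c =>
      { pt := pullback c.span.right (X.map f)
        left := pullback.fst _ _ ≫ c.span.left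
        right := pullback.snd _ _
        sec := pullback.lift c.span.sec (X.map s) (by rw [c.span.sec_right, X.map_comp])
        sec_left := by rw [pullback.lift_fst_assoc, c.span.sec_left]
        sec_right := pullback.lift_snd _ _ _ }

variable {X}

/-- The pair `(a, b)` factors through the span of the walk `c`. -/
def Walk.Links {k m : J} {s : k ⟶ m} (c : Walk k s) {E : C} (a : E ⟶ X.obj k)
    (b : E ⟶ X.obj m) : Prop :=
  ∃ e : E ⟶ (c.span X).pt, e ≫ (c.span X).left = a ∧ e ≫ (c.span X).right = b

lemma Walk.links_nil {k : J} {E : C} (a : E ⟶ X.obj k) : (Walk.nil : Walk k (𝟙 k)).Links a a :=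
  ⟨a, Category.comp_id _, Category.comp_id _⟩

lemma Walk.links_span {k m : J} {s : k ⟶ m} (c : Walk k s) :
    c.Links (c.span X).left (c.span X).right :=
  ⟨𝟙 _, Category.id_comp _, Category.id_comp _⟩

lemma Walk.Links.fwd {k m m' : J} {s : k ⟶ m} {c : Walk k s} {E : C} {a : E ⟶ X.obj k}
    {b : E ⟶ X.obj m} (h : c.Links a b) (f : m ⟶ m') : (c.fwd f).Links a (b ≫ X.map f) := by
  obtain ⟨e, rfl, rfl⟩ := h
  exact ⟨e, rfl, (Category.assoc _ _ _).symm⟩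

lemma Walk.Links.bwd {k m m' : J} {s : k ⟶ m'} {f : m' ⟶ m} {c : Walk k (s ≫ f)} {E : C}
    {a : E ⟶ X.obj k} {b : E ⟶ X.obj m'} (h : c.Links a (b ≫ X.map f)) :
    (Walk.bwd s f c).Links a b := by
  obtain ⟨e, rfl, he⟩ := h
  exact ⟨pullback.lift e b he, pullback.lift_fst_assoc _ _ _ _, pullback.lift_snd _ _ _⟩

lemma Walk.Links.of_fwd {k m m' : J} {s : k ⟶ m} {c : Walk k s} {f : m ⟶ m'} {E : C}
    {a : E ⟶ X.obj k} {b : E ⟶ X.obj m'} (h : (c.fwd f).Links a b) :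
    ∃ b', c.Links a b' ∧ b' ≫ X.map f = b := by
  obtain ⟨e, rfl, rfl⟩ := h
  exact ⟨_, ⟨e, rfl, rfl⟩, Category.assoc _ _ _⟩

lemma Walk.Links.of_bwd {k m m' : J} {s : k ⟶ m'} {f : m' ⟶ m} {c : Walk k (s ≫ f)} {E : C}
    {a : E ⟶ X.obj k} {b : E ⟶ X.obj m'} (h : (Walk.bwd s f c).Links a b) :
    c.Links a (b ≫ X.map f) := by
  obtain ⟨e, rfl, rfl⟩ := h
  exact ⟨e ≫ pullback.fst _ _, Category.assoc _ _ _,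
    ((Category.assoc _ _ _).trans (congrArg (e ≫ ·) pullback.condition)).trans
      (Category.assoc _ _ _).symm⟩

lemma Walk.Links.eq_of_nil {k : J} {E : C} {a b : E ⟶ X.obj k}
    (h : (Walk.nil : Walk k (𝟙 k)).Links a b) : a = b := by
  obtain ⟨e, rfl, rfl⟩ := h
  rfl

lemma Walk.Links.append_right {k m : J} {s : k ⟶ m} (c : Walk k (𝟙 k)) {d : Walk k s} {E : C}
    {a : E ⟶ X.obj k} {b : E ⟶ X.obj m} (h : d.Links a b) : (c.append d).Links a b := by
  induction d with
  | nil =>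
    obtain rfl := h.eq_of_nil
    change c.Links a a
    exact ⟨a ≫ (c.span X).sec, by rw [Category.assoc, (c.span X).sec_left, Category.comp_id],
      by rw [Category.assoc, (c.span X).sec_right, X.map_id, Category.comp_id]⟩
  | fwd d f ih =>
    obtain ⟨b', h', rfl⟩ := h.of_fwd
    exact (ih h').fwd f
  | bwd s f d ih => exact (ih h.of_bwd).bwd

lemma Walk.Links.append_left_map {k m : J} {s : k ⟶ m} {c : Walk k (𝟙 k)} (d : Walk k s) {E : C}
    {a b : E ⟶ X.obj k} (h : c.Links a b) : (c.append d).Links a (b ≫ X.map s) := by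
  induction d with
  | nil => rwa [X.map_id, Category.comp_id]
  | fwd d f ih =>
    rw [X.map_comp, ← Category.assoc]
    exact ih.fwd f
  | bwd s f d ih =>
    rw [X.map_comp, ← Category.assoc] at ih
    exact ih.bwd

lemma Walk.Links.append_left {k : J} {c : Walk k (𝟙 k)} (d : Walk k (𝟙 k)) {E : C}
    {a b : E ⟶ X.obj k} (h : c.Links a b) : (c.append d).Links a b := by
  simpa using h.append_left_map d

/-- Cocones under `X ⋙ G` identify linked pairs. -/
lemma Walk.Links.map_comp_ι_app {D : Type u'} [Category.{v'} D] (G : C ⥤ D) (t : Cocone (X ⋙ G))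
    {k m : J} {s : k ⟶ m} {c : Walk k s} {E : C} {a : E ⟶ X.obj k} {b : E ⟶ X.obj m}
    (h : c.Links a b) : G.map a ≫ t.ι.app k = G.map b ≫ t.ι.app m := by
  induction c with
  | nil => rw [h.eq_of_nil]
  | fwd c f ih =>
    obtain ⟨b', h', rfl⟩ := h.of_fwd
    rw [ih h', G.map_comp, Category.assoc]
    exact congrArg _ (t.w f).symm
  | bwd s f c ih =>
    rw [ih h.of_bwd, G.map_comp, Category.assoc]
    exact congrArg _ (t.w f)

/-- After mapping to a common target with `k`, the element `x` is linked to `a` by some walk. -/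
def Reaches {k : J} {E : C} (a : E ⟶ X.obj k) {j : J} (x : E ⟶ X.obj j) : Prop :=
  ∃ (p : J) (s : k ⟶ p) (g : j ⟶ p) (c : Walk k s), c.Links a (x ≫ X.map g)

lemma reaches_self {k : J} {E : C} (a : E ⟶ X.obj k) : Reaches a a :=
  ⟨k, 𝟙 k, 𝟙 k, .nil, by simpa using Walk.links_nil a⟩

variable [IsSifted J]

lemma exists_cospan (j k : J) : ∃ (m : J) (_ : j ⟶ m) (_ : k ⟶ m), True := by
  obtain ⟨y⟩ := (Functor.Final.out (F := Functor.diag J) (j, k)).is_nonempty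
  exact ⟨y.right, y.hom.1, y.hom.2, trivial⟩

lemma Reaches.links {k : J} {E : C} {a : E ⟶ X.obj k} {j : J} {x : E ⟶ X.obj j}
    (h : Reaches a x) {p : J} (s : k ⟶ p) (g : j ⟶ p) :
    ∃ c : Walk k s, c.Links a (x ≫ X.map g) := by
  obtain ⟨p₀, s₀, g₀, h₀⟩ := h
  have : IsConnected (StructuredArrow (k, j) (Functor.diag J)) := Functor.Final.out _
  refine induct_on_objects
    {y : StructuredArrow (k, j) (Functor.diag J) |
      ∃ c : Walk k y.hom.1, c.Links a (x ≫ X.map y.hom.2)}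
    (j₀ := StructuredArrow.mk (Y := p₀) (T := Functor.diag J) (⟨s₀, g₀⟩ : (k, j) ⟶ (p₀, p₀)))
    h₀ ?_ (StructuredArrow.mk (Y := p) (T := Functor.diag J) (⟨s, g⟩ : (k, j) ⟶ (p, p)))
  intro y z f
  have h₁ : z.hom.1 = y.hom.1 ≫ f.right := congrArg Prod.fst (StructuredArrow.w f).symm
  have h₂ : z.hom.2 = y.hom.2 ≫ f.right := congrArg Prod.snd (StructuredArrow.w f).symm
  simp only [Set.mem_ofPred_eq]
  rw [h₁, h₂, X.map_comp, ← Category.assoc]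
  exact ⟨fun ⟨c, hc⟩ ↦ ⟨_, hc.fwd _⟩, fun ⟨c, hc⟩ ↦ ⟨_, hc.bwd⟩⟩

lemma reaches_comp_map_iff {k : J} {E : C} {a : E ⟶ X.obj k} {j j' : J} {x : E ⟶ X.obj j}
    (f : j ⟶ j') : Reaches a (x ≫ X.map f) ↔ Reaches a x := by
  constructor
  · rintro ⟨p, s, g, c, hc⟩
    exact ⟨p, s, f ≫ g, c, by simpa using hc⟩
  · intro h
    obtain ⟨p, s, g, -⟩ := exists_cospan k j'
    obtain ⟨c, hc⟩ := h.links s (f ≫ g)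
    exact ⟨p, s, g, c, by simpa using hc⟩

lemma Walk.Links.reaches_iff {k : J} {E : C} {a : E ⟶ X.obj k} {j m : J} {s : j ⟶ m}
    {c : Walk j s} {x : E ⟶ X.obj j} {y : E ⟶ X.obj m} (h : c.Links x y) :
    Reaches a x ↔ Reaches a y := by
  induction c with
  | nil => rw [h.eq_of_nil]
  | fwd c f ih =>
    obtain ⟨b', h', rfl⟩ := h.of_fwd
    rw [ih h', reaches_comp_map_iff]
  | bwd s f c ih => rw [ih h.of_bwd, reaches_comp_map_iff]

lemma exists_links_of_reaches {k : J} {E : C} {a b : E ⟶ X.obj k} (h : Reaches a b) :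
    ∃ c : Walk k (𝟙 k), c.Links a b := by
  simpa using h.links (𝟙 k) (𝟙 k)

/-- Linked pairs remain linked after applying a morphism of `J`. -/
lemma Walk.Links.exists_map {j k : J} (u : j ⟶ k) {c : Walk j (𝟙 j)} {E : C}
    {x y : E ⟶ X.obj j} (h : c.Links x y) :
    ∃ d : Walk k (𝟙 k), d.Links (x ≫ X.map u) (y ≫ X.map u) :=
  exists_links_of_reaches <| by
    rw [reaches_comp_map_iff, ← h.reaches_iff, ← reaches_comp_map_iff u]
    exact reaches_self _

variable (X) in
/-- Parallel morphisms of `J` are linked. -/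
lemma exists_links_map {j k : J} (u u' : j ⟶ k) :
    ∃ d : Walk k (𝟙 k), d.Links (X.map u) (X.map u') := by
  have h : Reaches (X.map u) (𝟙 (X.obj j) ≫ X.map u') := by
    rw [reaches_comp_map_iff, ← reaches_comp_map_iff u, Category.id_comp]
    exact reaches_self _
  exact exists_links_of_reaches (by simpa using h)

end

section

variable {C : Type u} [Category.{v} C] [HasPullbacks C] [HasReflexiveCoequalizers C]
  {J : Type v} [SmallCategory J] (X : J ⥤ C)

instance isReflexivePair_span {k : J} (c : Walk k (𝟙 k)) :
    IsReflexivePair (c.span X).left (c.span X).right :=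
  IsReflexivePair.mk' (c.span X).sec (c.span X).sec_left
    ((c.span X).sec_right.trans (X.map_id k))

/-- The quotient of `X.obj k` by the reflexive pair attached to a closed walk based at `k`. -/
noncomputable abbrev Walk.quot {k : J} (c : Walk k (𝟙 k)) : C :=
  coequalizer (c.span X).left (c.span X).right

/-- The quotient map. -/
noncomputable abbrev Walk.quotMap {k : J} (c : Walk k (𝟙 k)) : X.obj k ⟶ c.quot X :=
  coequalizer.π (c.span X).left (c.span X).right

variable {X}

lemma Walk.Links.comp_quotMap {k : J} {c : Walk k (𝟙 k)} {E : C} {a b : E ⟶ X.obj k}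
    (h : c.Links a b) : a ≫ c.quotMap X = b ≫ c.quotMap X := by
  obtain ⟨e, rfl, rfl⟩ := h
  rw [Category.assoc, Category.assoc, coequalizer.condition]

/-- An object of `J` together with a closed walk based at it. -/
structure Stage (_X : J ⥤ C) where
  /-- The base point. -/
  base : J
  /-- The closed walk. -/
  walk : Walk base (𝟙 base)

/-- Morphisms of stages are morphisms of the quotients which are induced by some morphism
of the base points. -/
@[ext]
structure Stage.Hom (p q : Stage X) where
  /-- The underlying morphism. -/
  map : p.walk.quot X ⟶ q.walk.quot X
  exists_base : ∃ u : p.base ⟶ q.base,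
    p.walk.quotMap X ≫ map = X.map u ≫ q.walk.quotMap X

noncomputable instance : SmallCategory (Stage X) where
  Hom := Stage.Hom
  id p := ⟨𝟙 _, 𝟙 _, by simp⟩
  comp {p q r} f g := ⟨f.map ≫ g.map, by
    obtain ⟨u, hu⟩ := f.exists_base
    obtain ⟨w, hw⟩ := g.exists_base
    exact ⟨u ≫ w, by rw [reassoc_of% hu, hw, X.map_comp, Category.assoc]⟩⟩
  id_comp _ := Stage.Hom.ext (Category.id_comp _)
  comp_id _ := Stage.Hom.ext (Category.comp_id _)
  assoc _ _ _ := Stage.Hom.ext (Category.assoc _ _ _)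

variable (X) in
/-- The diagram of quotients. -/
noncomputable def quotients : Stage X ⥤ C where
  obj p := p.walk.quot X
  map f := f.map
  map_id _ := rfl
  map_comp _ _ := rfl

/-- The morphism of stages induced by a morphism of the base points. -/
noncomputable def Stage.homMk {p q : Stage X} (u : p.base ⟶ q.base)
    (h : q.walk.Links ((p.walk.span X).left ≫ X.map u) ((p.walk.span X).right ≫ X.map u)) :
    p ⟶ q :=
  Stage.Hom.mk (coequalizer.desc (X.map u ≫ q.walk.quotMap X)
    (by simpa only [Category.assoc] using h.comp_quotMap)) ⟨u, coequalizer.π_desc _ _⟩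

lemma Stage.quotMap_homMk {p q : Stage X} (u : p.base ⟶ q.base)
    (h : q.walk.Links ((p.walk.span X).left ≫ X.map u) ((p.walk.span X).right ≫ X.map u)) :
    p.walk.quotMap X ≫ Stage.Hom.map (Stage.homMk u h) = X.map u ≫ q.walk.quotMap X :=
  coequalizer.π_desc _ _

/-- Enlarging the walk at a stage. -/
noncomputable def Stage.homOfLinks {k : J} {c d : Walk k (𝟙 k)}
    (h : d.Links (c.span X).left (c.span X).right) : (⟨k, c⟩ : Stage X) ⟶ ⟨k, d⟩ :=
  Stage.homMk (𝟙 k) (by simpa using h)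

lemma Stage.quotMap_homOfLinks {k : J} {c d : Walk k (𝟙 k)}
    (h : d.Links (c.span X).left (c.span X).right) :
    c.quotMap X ≫ Stage.Hom.map (Stage.homOfLinks h) = d.quotMap X :=
  (Stage.quotMap_homMk (p := ⟨k, c⟩) (q := ⟨k, d⟩) _ _).trans (by simp)

instance [IsSifted J] : IsFiltered (Stage X) where
  nonempty := ⟨⟨(IsSifted.nonempty (C := J)).some, .nil⟩⟩
  cocone_objs p q := by
    obtain ⟨m, u, w, -⟩ := exists_cospan p.base q.base
    obtain ⟨c, hc⟩ := (p.walk.links_span (X := X)).exists_map u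
    obtain ⟨d, hd⟩ := (q.walk.links_span (X := X)).exists_map w
    exact ⟨⟨m, c.append d⟩, Stage.homMk u (hc.append_left d), Stage.homMk w (hd.append_right c),
      trivial⟩
  cocone_maps p q f g := by
    obtain ⟨u, hu⟩ := f.exists_base
    obtain ⟨w, hw⟩ := g.exists_base
    obtain ⟨d, hd⟩ := exists_links_map X u w
    let χ : q ⟶ ⟨q.base, q.walk.append d⟩ :=
      Stage.homOfLinks (q.walk.links_span.append_left d)
    have hχ : q.walk.quotMap X ≫ χ.map = (q.walk.append d).quotMap X :=
      Stage.quotMap_homOfLinks (q.walk.links_span.append_left d)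
    refine ⟨_, χ, Stage.Hom.ext ?_⟩
    change f.map ≫ χ.map = g.map ≫ χ.map
    rw [← cancel_epi (p.walk.quotMap X), reassoc_of% hu, reassoc_of% hw, hχ]
    exact (hd.append_right q.walk).comp_quotMap

/-- A leg of a cocone under the diagram of quotients. -/
noncomputable def leg (s : Cocone (quotients X)) (p : Stage X) : p.walk.quot X ⟶ s.pt :=
  s.ι.app p

lemma map_leg (s : Cocone (quotients X)) {p q : Stage X} (f : p ⟶ q) :
    f.map ≫ leg s q = leg s p :=
  s.w f

/-- The cocone under `X` induced by a cocone under the diagram of quotients. -/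
noncomputable abbrev coconeOfQuotients (s : Cocone (quotients X)) : Cocone X where
  pt := s.pt
  ι :=
    { app := fun k ↦ (Walk.nil : Walk k (𝟙 k)).quotMap X ≫ leg s ⟨k, .nil⟩
      naturality := fun j k u ↦ by
        let φ : (⟨j, .nil⟩ : Stage X) ⟶ ⟨k, .nil⟩ := Stage.homMk u (Walk.links_nil _)
        have hφ : (Walk.nil : Walk j (𝟙 j)).quotMap X ≫ φ.map =
          X.map u ≫ (Walk.nil : Walk k (𝟙 k)).quotMap X :=
          Stage.quotMap_homMk (p := ⟨j, .nil⟩) (q := ⟨k, .nil⟩) u (Walk.links_nil _)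
        rw [← map_leg s φ, reassoc_of% hφ]
        simp }

lemma quotMap_leg (s : Cocone (quotients X)) {k : J} (c : Walk k (𝟙 k)) :
    c.quotMap X ≫ leg s ⟨k, c⟩ = (coconeOfQuotients s).ι.app k := by
  let φ : (⟨k, .nil⟩ : Stage X) ⟶ ⟨k, c⟩ := Stage.homOfLinks ⟨(c.span X).sec,
    (c.span X).sec_left, (c.span X).sec_right.trans (X.map_id k)⟩
  have hφ : (Walk.nil : Walk k (𝟙 k)).quotMap X ≫ φ.map = c.quotMap X :=
    Stage.quotMap_homOfLinks _
  change _ = (Walk.nil : Walk k (𝟙 k)).quotMap X ≫ leg s ⟨k, .nil⟩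
  rw [← map_leg s φ, reassoc_of% hφ]

/-- A functor preserving the relevant reflexive coequalizers sends `coconeOfQuotients s` to a
colimit cocone as soon as it sends `s` to one. -/
lemma nonempty_isColimit_mapCocone {D : Type u'} [Category.{v'} D] (G : C ⥤ D)
    (hG : ∀ {A B : C} (f g : A ⟶ B), IsReflexivePair f g → PreservesColimit (parallelPair f g) G)
    {s : Cocone (quotients X)} (hs : IsColimit (G.mapCocone s)) :
    Nonempty (IsColimit (G.mapCocone (coconeOfQuotients s))) := by
  have hQ {k : J} (c : Walk k (𝟙 k)) :=
    have := hG (c.span X).left (c.span X).right inferInstance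
    isColimitOfHasCoequalizerOfPreservesColimit G (c.span X).left (c.span X).right
  have hom_ext {k : J} (c : Walk k (𝟙 k)) {T : D} {a b : G.obj (c.quot X) ⟶ T}
      (h : G.map (c.quotMap X) ≫ a = G.map (c.quotMap X) ≫ b) : a = b :=
    Cofork.IsColimit.hom_ext (hQ c) h
  have exists_desc (t : Cocone (X ⋙ G)) (p : Stage X) :
      ∃ l : G.obj (p.walk.quot X) ⟶ t.pt, G.map (p.walk.quotMap X) ≫ l = t.ι.app p.base :=
    ⟨_, (Cofork.IsColimit.desc' (hQ p.walk) (t.ι.app p.base)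
      (p.walk.links_span.map_comp_ι_app G t)).2⟩
  refine ⟨IsColimit.ofExistsUnique fun t ↦ ?_⟩
  choose l hl using exists_desc t
  let t' : Cocone (quotients X ⋙ G) :=
    { pt := t.pt
      ι :=
        { app := l
          naturality := fun p q f ↦ by
            obtain ⟨u, hu⟩ := f.exists_base
            apply hom_ext p.walk
            change G.map _ ≫ G.map f.map ≫ l q = G.map _ ≫ l p ≫ 𝟙 _
            rw [Category.comp_id, hl, ← G.map_comp_assoc, hu, G.map_comp_assoc, hl]
            exact t.w u } }
  have map_quotMap_leg (p : Stage X) (m : G.obj s.pt ⟶ t.pt) :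
      G.map (p.walk.quotMap X) ≫ G.map (leg s p) ≫ m =
        (G.mapCocone (coconeOfQuotients s)).ι.app p.base ≫ m := by
    rw [← G.map_comp_assoc]
    exact congrArg (fun x ↦ G.map x ≫ m) (quotMap_leg s p.walk)
  have fac (k : J) : (G.mapCocone (coconeOfQuotients s)).ι.app k ≫ hs.desc t' = t.ι.app k :=
    (map_quotMap_leg ⟨k, .nil⟩ _).symm.trans
      ((congrArg _ (hs.fac t' ⟨k, .nil⟩)).trans (hl ⟨k, .nil⟩))
  exact ⟨hs.desc t', fac, fun m hm ↦ hs.hom_ext fun p ↦ hom_ext p.walk <|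
    (map_quotMap_leg p m).trans <| (hm _).trans <| (fac _).symm.trans (map_quotMap_leg p _).symm⟩

end

end SiftedColimit

open SiftedColimit

/-- If `C` has pullbacks, reflexive coequalizers and all small filtered colimits,
then any functor `F : C ⥤ D` preserving reflexive coequalizers and small filtered
colimits preserves all small sifted colimits. -/
theorem preservesSiftedColimits_of_preservesReflexiveCoequalizers_preservesFilteredColimits
    {C : Type u} [Category.{v} C] {D : Type u'} [Category.{v'} D]
    [HasPullbacks C] [HasReflexiveCoequalizers C] [HasFilteredColimitsOfSize.{v, v} C]
    (F : C ⥤ D)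
    (hrefl : ∀ {A B : C} (f g : A ⟶ B), IsReflexivePair f g →
      PreservesColimit (parallelPair f g) F)
    (hfilt : ∀ (K : Type v) [SmallCategory K], IsFiltered K → PreservesColimitsOfShape K F)
    (J : Type v) [SmallCategory J] [IsSifted J] :
    PreservesColimitsOfShape J F := by
  have := HasFilteredColimitsOfSize.HasColimitsOfShape (C := C)
  refine ⟨fun {X} ↦ ?_⟩
  have : HasColimitsOfShape (Stage X) C := this _
  have := hfilt (Stage X) inferInstance
  obtain ⟨h⟩ := nonempty_isColimit_mapCocone (𝟭 C) (fun _ _ _ ↦ inferInstance)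
    (isColimitOfPreserves (𝟭 C) (colimit.isColimit (quotients X)))
  obtain ⟨h'⟩ := nonempty_isColimit_mapCocone F hrefl
    (isColimitOfPreserves F (colimit.isColimit (quotients X)))
  exact preservesColimit_of_preserves_colimit_cocone (isColimitOfReflects (𝟭 C) h) h'
end

section
/- Let κ be an uncountable regular cardinal and let C be a category with pullbacks which has reflexive coequalizers and colimits of all diagrams indexed by κ-small filtered categories. Then C has colimits of all diagrams indexed by κ-small sifted categories. -/
open CategoryTheory CategoryTheory.Limits

/-- A category `J` is `κ`-small if it has fewer than `κ` objects and fewer than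
`κ` morphisms. -/
def IsCardinalSmallCat (J : Type v) [SmallCategory J] (κ : Cardinal.{v}) : Prop :=
  Cardinal.mk J < κ ∧ Cardinal.mk (Arrow J) < κ


namespace CategoryTheory

section External

variable {J : Type v} [SmallCategory J]

/-- The functor `(j, k) ↦ G j × H k`. -/
@[simps]
def externalProd (G H : J ⥤ Type v) : J × J ⥤ Type v where
  obj x := G.obj x.1 × H.obj x.2
  map f := ↾fun x ↦ (G.map f.1 x.1, H.map f.2 x.2)

/-- Over a sifted category, pairs of elements whose components are identified in the respective
colimits are identified in the colimit of the pointwise product. -/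
lemma ιColimitType_diag_externalProd_eq [IsSifted J] (G H : J ⥤ Type v) {a b : J}
    {x : G.obj a} {y : G.obj b} {x' : H.obj a} {y' : H.obj b}
    (h : G.ιColimitType a x = G.ιColimitType b y)
    (h' : H.ιColimitType a x' = H.ιColimitType b y') :
    (Functor.diag J ⋙ externalProd G H).ιColimitType a (x, x') =
      (Functor.diag J ⋙ externalProd G H).ιColimitType b (y, y') := by
  let P := Functor.diag J ⋙ externalProd G H
  let c : Cocone P :=
    { pt := P.ColimitType
      ι := { app j := ↾(P.ιColimitType j)
             naturality j k f := by
               ext z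
               exact P.ιColimitType_map f z } }
  let e := Functor.Final.extendCocone.obj c
  have he (j : J) (z : P.obj j) : e.ι.app (j, j) z = P.ιColimitType j z := by
    have h := Functor.Final.extendCocone_obj_ι_app' c (𝟙 (j, j))
    rw [CategoryTheory.Functor.map_id] at h
    exact ConcreteCategory.congr_hom h z
  let l (k : J) (w : H.obj k) : G.CoconeTypes :=
    { pt := P.ColimitType
      ι j z := e.ι.app (j, k) (z, w)
      ι_naturality {i j} f := by
        funext z
        have hw := e.w (show ((i, k) : J × J) ⟶ (j, k) from Prod.mkHom f (𝟙 k))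
        simpa using!
          ConcreteCategory.congr_hom hw (show G.obj i × H.obj k from (z, w)) }
  let r (k : J) (w : G.obj k) : H.CoconeTypes :=
    { pt := P.ColimitType
      ι j z := e.ι.app (k, j) (w, z)
      ι_naturality {i j} f := by
        funext z
        have hw := e.w (show ((k, i) : J × J) ⟶ (k, j) from Prod.mkHom (𝟙 k) f)
        simpa using!
          ConcreteCategory.congr_hom hw (show G.obj k × H.obj i from (w, z)) }
  have h1 := congrArg (G.descColimitType (l a x')) h
  have h2 := congrArg (H.descColimitType (r b y)) h'
  exact (he a (x, x')).symm.trans ((h1.trans h2).trans (he b (y, y')))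

end External

variable {J : Type v} [SmallCategory J] {C : Type u} [Category.{v} C] (F : J ⥤ C)

/-- Generalized elements `p : R ⟶ F.obj a` and `q : R ⟶ F.obj b` are linked if they become equal
in the colimit of the presheaves represented by the objects `F.obj j`. -/
def Linked {R : C} {a b : J} (p : R ⟶ F.obj a) (q : R ⟶ F.obj b) : Prop :=
  (F ⋙ coyoneda.obj (Opposite.op R)).ιColimitType a p =
    (F ⋙ coyoneda.obj (Opposite.op R)).ιColimitType b q

variable {F}

namespace Linked

variable {R S : C} {a b c : J}

lemma symm {p : R ⟶ F.obj a} {q : R ⟶ F.obj b} (h : Linked F p q) : Linked F q p := Eq.symm h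

lemma trans {p : R ⟶ F.obj a} {q : R ⟶ F.obj b} {r : R ⟶ F.obj c} (h : Linked F p q)
    (h' : Linked F q r) : Linked F p r := Eq.trans h h'

lemma of_map (p : R ⟶ F.obj a) (f : a ⟶ b) : Linked F p (p ≫ F.map f) :=
  ((F ⋙ coyoneda.obj (Opposite.op R)).ιColimitType_map f p).symm

lemma map_map {p : R ⟶ F.obj a} {q : R ⟶ F.obj b} (h : Linked F p q) {a' b' : J} (f : a ⟶ a')
    (g : b ⟶ b') : Linked F (p ≫ F.map f) (q ≫ F.map g) :=
  ((of_map p f).symm.trans h).trans (of_map q g)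

lemma precomp {p : R ⟶ F.obj a} {q : R ⟶ F.obj b} (h : Linked F p q) (u : S ⟶ R) :
    Linked F (u ≫ p) (u ≫ q) :=
  congrArg (Functor.descColimitType (F ⋙ coyoneda.obj (Opposite.op R))
    { pt := (F ⋙ coyoneda.obj (Opposite.op S)).ColimitType
      ι j z := (F ⋙ coyoneda.obj (Opposite.op S)).ιColimitType j (u ≫ z)
      ι_naturality f := by
        funext z
        simpa [Linked] using (of_map (u ≫ z) f).symm }) h

lemma comp_ι_eq {p : R ⟶ F.obj a} {q : R ⟶ F.obj b} (h : Linked F p q) (s : Cocone F) :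
    p ≫ s.ι.app a = q ≫ s.ι.app b :=
  congrArg (Functor.descColimitType (F ⋙ coyoneda.obj (Opposite.op R))
    { pt := R ⟶ s.pt
      ι j z := z ≫ s.ι.app j
      ι_naturality f := by
        funext z
        simp }) h

/-- Two linked pairs factor through a common linked pair. -/
lemma exists_common_factorization [HasPullbacks C] [IsSifted J]
    {p : R ⟶ F.obj a} {q : R ⟶ F.obj b} {p' : S ⟶ F.obj a} {q' : S ⟶ F.obj b}
    (h : Linked F p q) (h' : Linked F p' q') :
    ∃ (T : C) (s : T ⟶ F.obj a) (t : T ⟶ F.obj b) (u : R ⟶ T) (u' : S ⟶ T), Linked F s t ∧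
      u ≫ s = p ∧ u ≫ t = q ∧ u' ≫ s = p' ∧ u' ≫ t = q' := by
  have key := (Functor.ιColimitType_eq_iff _ _ _).1 (ιColimitType_diag_externalProd_eq _ _ h h')
  suffices H : ∀ x y : Σ j, (Functor.diag J ⋙ externalProd (F ⋙ coyoneda.obj (Opposite.op R))
      (F ⋙ coyoneda.obj (Opposite.op S))).obj j, Relation.EqvGen (Functor.ColimitTypeRel _) x y →
      ∃ (T : C) (s : T ⟶ F.obj x.1) (t : T ⟶ F.obj y.1) (u : R ⟶ T) (u' : S ⟶ T), Linked F s t ∧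
        u ≫ s = x.2.1 ∧ u ≫ t = y.2.1 ∧ u' ≫ s = x.2.2 ∧ u' ≫ t = y.2.2 from H _ _ key
  intro x y hxy
  induction hxy with
  | rel x y hxy =>
    obtain ⟨j, x⟩ := x
    obtain ⟨k, y⟩ := y
    obtain ⟨f, hf⟩ := hxy
    change j ⟶ k at f
    obtain rfl : y = (x.1 ≫ F.map f, x.2 ≫ F.map f) := hf
    exact ⟨F.obj j, 𝟙 _, F.map f, x.1, x.2, by simpa using of_map (𝟙 (F.obj j)) f,
      Category.comp_id _, rfl, Category.comp_id _, rfl⟩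
  | refl x =>
    exact ⟨F.obj x.1, 𝟙 _, 𝟙 _, x.2.1, x.2.2, rfl,
      Category.comp_id _, Category.comp_id _, Category.comp_id _, Category.comp_id _⟩
  | symm x y _ ih =>
    obtain ⟨T, s, t, u, u', h, h₁, h₂, h₃, h₄⟩ := ih
    exact ⟨T, t, s, u, u', h.symm, h₂, h₁, h₄, h₃⟩
  | trans x y z _ _ ih ih' =>
    obtain ⟨T, s, t, u, u', h, h₁, h₂, h₃, h₄⟩ := ih
    obtain ⟨T', s', t', v, v', h', h₁', h₂', h₃', h₄'⟩ := ih'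
    refine ⟨pullback t s', pullback.fst _ _ ≫ s, pullback.snd _ _ ≫ t',
      pullback.lift u v (h₂.trans h₁'.symm), pullback.lift u' v' (h₄.trans h₃'.symm), ?_, ?_⟩
    · refine (h.precomp _).trans ?_
      rw [pullback.condition]
      exact h'.precomp _
    · simp only [pullback.lift_fst_assoc, pullback.lift_snd_assoc]
      exact ⟨h₁, h₂', h₃, h₄'⟩

end Linked

variable (F)

/-- A reflexive pair on a value of `F` that is coequalized by every cocone under `F`. -/
structure LinkedPair where
  /-- The index of the target. -/
  idx : J
  /-- The source of the pair. -/
  src : C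
  /-- The first map. -/
  fst : src ⟶ F.obj idx
  /-- The second map. -/
  snd : src ⟶ F.obj idx
  reflexive : IsReflexivePair fst snd
  linked : Linked F fst snd

attribute [instance] LinkedPair.reflexive

namespace LinkedPair

variable {F}

/-- The identity pair on `F.obj a`. -/
@[simps]
def id (a : J) : LinkedPair F where
  idx := a
  src := F.obj a
  fst := 𝟙 _
  snd := 𝟙 _
  reflexive := ⟨𝟙 _, by simp, by simp⟩
  linked := rfl

variable [HasReflexiveCoequalizers C]

/-- The coequalizer of a linked pair. -/
noncomputable abbrev quotient (x : LinkedPair F) : C := coequalizer x.fst x.snd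

/-- The projection to the coequalizer of a linked pair. -/
noncomputable abbrev π (x : LinkedPair F) : F.obj x.idx ⟶ x.quotient := coequalizer.π x.fst x.snd

/-- The pair `z` receives compatible maps from `x` and `y` and identifies the composites of
`f` and `g` with the map from `y`. -/
def Absorbs (x y : LinkedPair F) (f g : x.idx ⟶ y.idx) (z : LinkedPair F) : Prop :=
  ∃ k : y.idx ⟶ z.idx,
    y.fst ≫ F.map k ≫ z.π = y.snd ≫ F.map k ≫ z.π ∧
    x.fst ≫ F.map f ≫ F.map k ≫ z.π = x.snd ≫ F.map f ≫ F.map k ≫ z.π ∧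
    F.map f ≫ F.map k ≫ z.π = F.map g ≫ F.map k ≫ z.π

lemma exists_absorbs [HasPullbacks C] [IsSifted J] (x y : LinkedPair F) (f g : x.idx ⟶ y.idx) :
    ∃ z, Absorbs x y f g z := by
  have hf : Linked F (F.map f) (F.map g) := by
    have := (Linked.of_map (𝟙 (F.obj x.idx)) f).symm.trans (Linked.of_map (𝟙 (F.obj x.idx)) g)
    simpa using this
  obtain ⟨T, s, t, u, u', h, h₁, h₂, h₃, h₄⟩ :=
    (x.linked.map_map f f).exists_common_factorization hf
  obtain ⟨T', s', t', w, w', h', h₁', h₂', h₃', h₄'⟩ :=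
    y.linked.exists_common_factorization h
  obtain ⟨r, hr, hr'⟩ := IsReflexivePair.common_section y.fst y.snd
  have hs : IsReflexivePair s' t' :=
    ⟨r ≫ w, by rw [Category.assoc, h₁', hr], by rw [Category.assoc, h₂', hr']⟩
  suffices H : ∀ (W : C) (m : F.obj y.idx ⟶ W), s' ≫ m = t' ≫ m →
      y.fst ≫ m = y.snd ≫ m ∧ x.fst ≫ F.map f ≫ m = x.snd ≫ F.map f ≫ m ∧
        F.map f ≫ m = F.map g ≫ m from
    ⟨⟨y.idx, T', s', t', hs, h'⟩, 𝟙 _,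
      H _ _ (by simpa using coequalizer.condition s' t')⟩
  intro W m hm
  have hm' : s ≫ m = t ≫ m := by simp only [← h₃', ← h₄', Category.assoc, hm]
  refine ⟨?_, ?_, ?_⟩
  · simp only [← h₁', ← h₂', Category.assoc, hm]
  · rw [← reassoc_of% h₁, ← reassoc_of% h₂, hm']
  · rw [← h₃, ← h₄, Category.assoc, Category.assoc, hm']

end LinkedPair

section Index

variable [HasReflexiveCoequalizers C] {F} {T : Type v}

/-- The category indexed by a family of linked pairs whose morphisms are the maps between
quotients that are induced by morphisms of `J`. -/
structure LinkedPairIndex (g : T → LinkedPair F) where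
  /-- The underlying index. -/
  val : T

namespace LinkedPairIndex

variable {g : T → LinkedPair F}

/-- The linked pair attached to an index. -/
abbrev pair (x : LinkedPairIndex g) : LinkedPair F := g x.val

noncomputable instance : SmallCategory (LinkedPairIndex g) where
  Hom x y := {h : x.pair.quotient ⟶ y.pair.quotient //
    ∃ t : x.pair.idx ⟶ y.pair.idx, F.map t ≫ y.pair.π = x.pair.π ≫ h}
  id x := ⟨𝟙 _, 𝟙 _, by simp⟩
  comp h k := ⟨h.1 ≫ k.1, by
    obtain ⟨h, s, hs⟩ := h
    obtain ⟨k, t, ht⟩ := k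
    exact ⟨s ≫ t, by rw [F.map_comp, Category.assoc, ht, reassoc_of% hs]⟩⟩

variable (g) in
/-- The diagram of quotients. -/
noncomputable def quotients : LinkedPairIndex g ⥤ C where
  obj x := x.pair.quotient
  map h := h.1

/-- The projection onto an object of the diagram of quotients. -/
noncomputable def π (x : LinkedPairIndex g) : F.obj x.pair.idx ⟶ (quotients g).obj x := x.pair.π

instance (x : LinkedPairIndex g) : Epi x.π := inferInstanceAs (Epi x.pair.π)

/-- The map out of a quotient induced by a map coequalizing the linked pair. -/
noncomputable def desc (x : LinkedPairIndex g) {W : C} (m : F.obj x.pair.idx ⟶ W)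
    (hm : x.pair.fst ≫ m = x.pair.snd ≫ m) : (quotients g).obj x ⟶ W :=
  coequalizer.desc m hm

@[simp]
lemma π_desc (x : LinkedPairIndex g) {W : C} (m : F.obj x.pair.idx ⟶ W)
    (hm : x.pair.fst ≫ m = x.pair.snd ≫ m) : x.π ≫ x.desc m hm = m :=
  coequalizer.π_desc m hm

@[simp]
lemma π_desc_assoc (x : LinkedPairIndex g) {W W' : C} (m : F.obj x.pair.idx ⟶ W)
    (hm : x.pair.fst ≫ m = x.pair.snd ≫ m) (k : W ⟶ W') :
    x.π ≫ x.desc m hm ≫ k = m ≫ k := by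
  rw [← Category.assoc, π_desc]

/-- The morphism induced by a morphism of `J` compatible with the linked pairs. -/
noncomputable def homMk {x y : LinkedPairIndex g} (t : x.pair.idx ⟶ y.pair.idx)
    (ht : x.pair.fst ≫ F.map t ≫ y.π = x.pair.snd ≫ F.map t ≫ y.π) : x ⟶ y :=
  ⟨x.desc (F.map t ≫ y.π) ht, t, (x.π_desc _ ht).symm⟩

@[simp]
lemma π_map_homMk {x y : LinkedPairIndex g} (t : x.pair.idx ⟶ y.pair.idx)
    (ht : x.pair.fst ≫ F.map t ≫ y.π = x.pair.snd ≫ F.map t ≫ y.π) :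
    x.π ≫ (quotients g).map (homMk t ht) = F.map t ≫ y.π :=
  x.π_desc _ ht

lemma exists_map_π {x y : LinkedPairIndex g} (h : x ⟶ y) :
    ∃ t : x.pair.idx ⟶ y.pair.idx, F.map t ≫ y.π = x.π ≫ (quotients g).map h :=
  h.2

lemma hom_ext_of_π {x y : LinkedPairIndex g} {h k : x ⟶ y}
    (e : x.π ≫ (quotients g).map h = x.π ≫ (quotients g).map k) : h = k :=
  Subtype.ext ((cancel_epi x.π).1 e)

lemma isCardinalSmallCat {κ : Cardinal.{v}} (hκ : Cardinal.aleph0 < κ) (hT : Cardinal.mk T < κ)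
    (hJ : Cardinal.mk (Arrow J) < κ) : IsCardinalSmallCat (LinkedPairIndex g) κ := by
  have hI : Cardinal.mk (LinkedPairIndex g) < κ :=
    (Cardinal.mk_le_of_injective (f := fun x : LinkedPairIndex g ↦ x.val)
      (fun ⟨_⟩ ⟨_⟩ h ↦ congrArg LinkedPairIndex.mk h)).trans_lt hT
  refine ⟨hI, ?_⟩
  let φ (a : Arrow (LinkedPairIndex g)) :
      LinkedPairIndex g × LinkedPairIndex g × Arrow J :=
    (a.left, a.right, Arrow.mk (exists_map_π a.hom).choose)
  have hφ : Function.Injective φ := by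
    rintro ⟨x, y, h⟩ ⟨x', y', h'⟩ e
    obtain ⟨rfl, e⟩ := Prod.ext_iff.1 e
    obtain ⟨rfl, e⟩ := Prod.ext_iff.1 e
    have e' : (exists_map_π h).choose = (exists_map_π h').choose := Arrow.mk_injective _ _ e
    congr 1
    refine hom_ext_of_π ?_
    exact (exists_map_π h).choose_spec.symm.trans
      ((congrArg (fun t ↦ F.map t ≫ y.π) e').trans (exists_map_π h').choose_spec)
  refine (Cardinal.mk_le_of_injective hφ).trans_lt ?_
  rw [Cardinal.mk_prod, Cardinal.mk_prod]
  simp only [Cardinal.lift_id]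
  exact Cardinal.mul_lt_of_lt hκ.le hI (Cardinal.mul_lt_of_lt hκ.le hI hJ)

lemma exists_hom_hom
    (habs : ∀ s t (f f' : (g s).idx ⟶ (g t).idx), ∃ w, (g s).Absorbs (g t) f f' (g w))
    (x y : LinkedPairIndex g) (f : x.pair.idx ⟶ y.pair.idx) :
    ∃ (z : LinkedPairIndex g) (h : x ⟶ z) (h' : y ⟶ z),
      x.π ≫ (quotients g).map h = F.map f ≫ y.π ≫ (quotients g).map h' := by
  obtain ⟨w, k, h₁, h₂, -⟩ := habs x.val y.val f f
  refine ⟨⟨w⟩, homMk (f ≫ k) (by simpa using! h₂), homMk k h₁, ?_⟩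
  have hk := π_map_homMk (x := y) (y := ⟨w⟩) k h₁
  rw [hk, π_map_homMk, F.map_comp, Category.assoc]

lemma exists_hom_eq
    (habs : ∀ s t (f f' : (g s).idx ⟶ (g t).idx), ∃ w, (g s).Absorbs (g t) f f' (g w))
    (x y : LinkedPairIndex g) (f f' : x.pair.idx ⟶ y.pair.idx) :
    ∃ (z : LinkedPairIndex g) (h : y ⟶ z),
      F.map f ≫ y.π ≫ (quotients g).map h = F.map f' ≫ y.π ≫ (quotients g).map h := by
  obtain ⟨w, k, h₁, -, h₃⟩ := habs x.val y.val f f'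
  have hk := π_map_homMk (x := y) (y := ⟨w⟩) k h₁
  exact ⟨⟨w⟩, homMk k h₁, by rw [hk]; exact h₃⟩

lemma isFiltered [IsSifted J] (hidx : ∀ b, ∃ t, (g t).idx = b)
    (habs : ∀ s t (f f' : (g s).idx ⟶ (g t).idx), ∃ w, (g s).Absorbs (g t) f f' (g w)) :
    IsFiltered (LinkedPairIndex g) where
  nonempty := ⟨⟨(hidx (Classical.arbitrary J)).choose⟩⟩
  cocone_objs x y := by
    obtain ⟨s⟩ := (Functor.Final.out (F := Functor.diag J) (x.pair.idx, y.pair.idx)).is_nonempty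
    obtain ⟨t, ht⟩ := hidx s.right
    obtain ⟨z, h, k, -⟩ := exists_hom_hom habs x ⟨t⟩ (s.hom.1 ≫ eqToHom ht.symm)
    obtain ⟨z', h', k', -⟩ :=
      exists_hom_hom habs y z (s.hom.2 ≫ eqToHom ht.symm ≫ (exists_map_π k).choose)
    exact ⟨z', h ≫ k', h', trivial⟩
  cocone_maps x y h k := by
    obtain ⟨f, hf⟩ := exists_map_π h
    obtain ⟨f', hf'⟩ := exists_map_π k
    obtain ⟨z, l, hl⟩ := exists_hom_eq habs x y f f'
    refine ⟨z, l, hom_ext_of_π ?_⟩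
    rw [reassoc_of% hf, reassoc_of% hf'] at hl
    simpa using hl

lemma hasColimit [HasColimit (quotients g)] (hidx : ∀ b, ∃ t, (g t).idx = b)
    (habs : ∀ s t (f f' : (g s).idx ⟶ (g t).idx), ∃ w, (g s).Absorbs (g t) f f' (g w)) :
    HasColimit F := by
  let ι (x : LinkedPairIndex g) : F.obj x.pair.idx ⟶ colimit (quotients g) :=
    x.π ≫ colimit.ι (quotients g) x
  have hι {x y : LinkedPairIndex g} (f : x.pair.idx ⟶ y.pair.idx) : F.map f ≫ ι y = ι x := by
    obtain ⟨z, h, h', e⟩ := exists_hom_hom habs x y f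
    simp only [ι, ← colimit.w (quotients g) h, ← colimit.w (quotients g) h']
    rw [reassoc_of% e]
  have hι' {b : J} {x y : LinkedPairIndex g} (f : b ⟶ x.pair.idx) (f' : b ⟶ y.pair.idx) :
      F.map f ≫ ι x = F.map f' ≫ ι y := by
    obtain ⟨t, rfl⟩ := hidx b
    exact (hι (x := ⟨t⟩) f).trans (hι (x := ⟨t⟩) f').symm
  choose t ht using hidx
  let i (b : J) : b ⟶ (LinkedPairIndex.mk (g := g) (t b)).pair.idx := eqToHom (ht b).symm
  let c : Cocone F :=
    { pt := colimit (quotients g)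
      ι :=
        { app b := F.map (i b) ≫ ι ⟨t b⟩
          naturality b b' f := by
            simpa using hι' (f ≫ i b') (i b) } }
  let d (s : Cocone F) : Cocone (quotients g) :=
    { pt := s.pt
      ι :=
        { app x := x.desc (s.ι.app x.pair.idx) (x.pair.linked.comp_ι_eq s)
          naturality x y h := by
            obtain ⟨f, hf⟩ := exists_map_π h
            refine (cancel_epi x.π).1 ?_
            simp [← reassoc_of% hf] } }
  refine ⟨⟨c, { desc s := colimit.desc _ (d s), fac s b := ?_, uniq s m hm := ?_ }⟩⟩
  · simp [c, d, ι]
  · refine colimit.hom_ext fun x ↦ (cancel_epi x.π).1 ?_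
    have hx : x.π ≫ colimit.ι (quotients g) x = c.ι.app x.pair.idx := by
      simpa using hι' (𝟙 x.pair.idx) (i x.pair.idx)
    rw [reassoc_of% hx, hm]
    simp [d]

end LinkedPairIndex

end Index

end CategoryTheory


/-- For uncountable `κ`, a family of fewer than `κ` points is contained in a family of fewer than
`κ` points that has witnesses for fewer than `κ` binary existence conditions. -/
lemma Cardinal.exists_closure_lt {κ : Cardinal.{v}} (hκ : Cardinal.aleph0 < κ) {A B : Type v}
    (hA : Cardinal.mk A < κ) (hB : Cardinal.mk B < κ) {P : Type w} (p : B → P)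
    (r : A → P → P → P → Prop) (hr : ∀ a x y, ∃ z, r a x y z) :
    ∃ (T : Type v) (g : T → P), Cardinal.mk T < κ ∧ (∀ b, ∃ t, g t = p b) ∧
      ∀ a s t, ∃ w, r a (g s) (g t) (g w) := by
  choose op hop using hr
  let β : B ⊕ A → Type v := Sum.elim (fun _ ↦ PEmpty) (fun _ ↦ ULift Bool)
  have : ∀ i, Finite (β i) := by
    rintro (b | a)
    · exact inferInstanceAs (Finite PEmpty)
    · exact inferInstanceAs (Finite (ULift Bool))
  let alg : (Σ i, β i → P) → P
    | ⟨.inl b, _⟩ => p b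
    | ⟨.inr a, f⟩ => op a (f ⟨false⟩) (f ⟨true⟩)
  refine ⟨WType β, WType.elim P alg, ?_, fun b ↦ ⟨⟨.inl b, PEmpty.elim⟩, rfl⟩, fun a s t ↦
    ⟨⟨.inr a, fun i ↦ cond i.down t s⟩, hop a _ _⟩⟩
  refine WType.cardinalMk_le_max_aleph0_of_finite.trans_lt (max_lt ?_ hκ)
  rw [Cardinal.mk_sum, Cardinal.lift_id, Cardinal.lift_id]
  exact Cardinal.add_lt_of_lt hκ.le hB hA

/-- For an uncountable regular cardinal `κ`, a category with pullbacks, reflexive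
coequalizers and colimits of all `κ`-small filtered diagrams has colimits of all
`κ`-small sifted diagrams. -/
theorem hasCardinalSmallSiftedColimits_of_pullbacks
    (κ : Cardinal.{v}) (hreg : κ.IsRegular) (huncount : Cardinal.aleph0 < κ)
    {C : Type u} [Category.{v} C] [HasPullbacks C] [HasReflexiveCoequalizers C]
    (hfilt : ∀ (K : Type v) [SmallCategory K], IsFiltered K → IsCardinalSmallCat K κ →
      HasColimitsOfShape K C)
    (J : Type v) [SmallCategory J] (hsift : IsSifted J) (hsmall : IsCardinalSmallCat J κ) :
    HasColimitsOfShape J C := by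
  refine ⟨fun F ↦ ?_⟩
  obtain ⟨T, g, hT, hidx, hg⟩ := Cardinal.exists_closure_lt huncount
    (A := Arrow J × Arrow J) (by simpa using Cardinal.mul_lt_of_lt hreg.aleph0_le hsmall.2 hsmall.2)
    hsmall.1 (LinkedPair.id (F := F))
    (fun a x y z ↦ ∀ f f' : x.idx ⟶ y.idx, a = (Arrow.mk f, Arrow.mk f') → x.Absorbs y f f' z)
    (fun a x y ↦ by
      by_cases h : ∃ f f' : x.idx ⟶ y.idx, a = (Arrow.mk f, Arrow.mk f')
      · obtain ⟨f, f', rfl⟩ := h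
        obtain ⟨z, hz⟩ := x.exists_absorbs y f f'
        refine ⟨z, fun k k' e ↦ ?_⟩
        obtain ⟨e, e'⟩ := Prod.ext_iff.1 e
        obtain rfl := Arrow.mk_injective _ _ e
        obtain rfl := Arrow.mk_injective _ _ e'
        exact hz
      · exact ⟨x, fun f f' e ↦ (h ⟨f, f', e⟩).elim⟩)
  replace hidx (b : J) : ∃ t, (g t).idx = b :=
    (hidx b).imp fun t ht ↦ congrArg LinkedPair.idx ht
  have habs (s t : T) (f f' : (g s).idx ⟶ (g t).idx) : ∃ w, (g s).Absorbs (g t) f f' (g w) :=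
    (hg (Arrow.mk f, Arrow.mk f') s t).imp fun w hw ↦ hw f f' rfl
  have := hfilt (LinkedPairIndex g) (LinkedPairIndex.isFiltered hidx habs)
    (LinkedPairIndex.isCardinalSmallCat huncount hT hsmall.2)
  exact LinkedPairIndex.hasColimit hidx habs
end

section
/- Let κ be an uncountable regular cardinal, let C be a category with pullbacks which has reflexive coequalizers and colimits of all diagrams indexed by κ-small filtered categories, and let F : C → D be a functor preserving reflexive coequalizers and colimits of shape J for every κ-small filtered category J. Then F preserves colimits of shape J for every κ-small sifted category J. -/
open CategoryTheory CategoryTheory.Limits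

section

universe v v₁ v₂ u₁ u₂

namespace CategoryTheory

open Opposite

section SpanConnected

variable {A : Type u₁} [Category.{v₁} A]

/-- If every cospan of a connected category can be completed to a commutative square, then any
two objects are connected by a span. -/
lemma exists_span_of_isConnected [IsConnected A]
    (h : ∀ ⦃x y z : A⦄ (_ : x ⟶ z) (_ : y ⟶ z), ∃ w : A, Nonempty (w ⟶ x) ∧ Nonempty (w ⟶ y))
    (x y : A) : ∃ w : A, Nonempty (w ⟶ x) ∧ Nonempty (w ⟶ y) := by
  induction isPreconnected_zigzag x y with
  | refl => exact ⟨x, ⟨𝟙 x⟩, ⟨𝟙 x⟩⟩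
  | tail _ hzag ih =>
    obtain ⟨w, ⟨f⟩, ⟨g⟩⟩ := ih
    obtain ⟨⟨k⟩⟩ | ⟨⟨k⟩⟩ := hzag
    · exact ⟨w, ⟨f⟩, ⟨g ≫ k⟩⟩
    · obtain ⟨w', ⟨p⟩, ⟨q⟩⟩ := h g k
      exact ⟨w', ⟨p ≫ f⟩, ⟨q⟩⟩

/-- In a sifted category with pullbacks, any two parallel pairs into `c` factor through a single
reflexive pair on `c`. -/
lemma IsSifted.exists_reflexivePair [IsSifted A]
    (hA : ∀ ⦃x y z : A⦄ (f : x ⟶ z) (g : y ⟶ z), HasPullback f g)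
    {a₁ a₂ c : A} (f₁ g₁ : a₁ ⟶ c) (f₂ g₂ : a₂ ⟶ c) :
    ∃ (r : A) (d₀ d₁ : r ⟶ c) (s : c ⟶ r) (w₁ : a₁ ⟶ r) (w₂ : a₂ ⟶ r),
      s ≫ d₀ = 𝟙 c ∧ s ≫ d₁ = 𝟙 c ∧ w₁ ≫ d₀ = f₁ ∧ w₁ ≫ d₁ = g₁ ∧
        w₂ ≫ d₀ = f₂ ∧ w₂ ≫ d₁ = g₂ := by
  let T : A ⥤ (A × A) × A := (Functor.diag A).prod' (𝟭 A)
  have : T.Final := inferInstance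
  let S : (A × A) × A := ((a₁, a₂), c)
  let U : StructuredArrow S T := StructuredArrow.mk (Y := c) (((f₁, f₂), 𝟙 c) : S ⟶ T.obj c)
  let V : StructuredArrow S T := StructuredArrow.mk (Y := c) (((g₁, g₂), 𝟙 c) : S ⟶ T.obj c)
  obtain ⟨W, ⟨p⟩, ⟨q⟩⟩ := exists_span_of_isConnected (fun X Y Z f g ↦ by
    have := hA f.right g.right
    have hf := StructuredArrow.w f
    have hg := StructuredArrow.w g
    have h : X.hom ≫ T.map f.right = Y.hom ≫ T.map g.right := hf.trans hg.symm
    have e₁ : X.hom.1.1 ≫ f.right = Y.hom.1.1 ≫ g.right := congr_arg (fun k ↦ k.1.1) h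
    have e₂ : X.hom.1.2 ≫ f.right = Y.hom.1.2 ≫ g.right := congr_arg (fun k ↦ k.1.2) h
    have e₃ : X.hom.2 ≫ f.right = Y.hom.2 ≫ g.right := congr_arg (fun k ↦ k.2) h
    let w : S ⟶ T.obj (pullback f.right g.right) :=
      ((pullback.lift _ _ e₁, pullback.lift _ _ e₂), pullback.lift _ _ e₃)
    refine ⟨StructuredArrow.mk w, ⟨StructuredArrow.homMk (pullback.fst _ _) ?_⟩,
      ⟨StructuredArrow.homMk (pullback.snd _ _) ?_⟩⟩
    · exact Prod.ext (Prod.ext (pullback.lift_fst _ _ e₁) (pullback.lift_fst _ _ e₂))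
        (pullback.lift_fst _ _ e₃)
    · exact Prod.ext (Prod.ext (pullback.lift_snd _ _ e₁) (pullback.lift_snd _ _ e₂))
        (pullback.lift_snd _ _ e₃)) U V
  have hp := StructuredArrow.w p
  have hq := StructuredArrow.w q
  exact ⟨W.right, p.right, q.right, W.hom.2, W.hom.1.1, W.hom.1.2,
    congr_arg (fun k ↦ k.2) hp, congr_arg (fun k ↦ k.2) hq,
    congr_arg (fun k ↦ k.1.1) hp, congr_arg (fun k ↦ k.1.1) hq,
    congr_arg (fun k ↦ k.1.2) hp, congr_arg (fun k ↦ k.1.2) hq⟩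

end SpanConnected

/-- A reflexive pair in a category, with a chosen common section. -/
structure ReflexivePair (A : Type u₁) [Category.{v₁} A] where
  /-- The target of the pair. -/
  base : A
  /-- The source of the pair. -/
  rel : A
  /-- The first morphism of the pair. -/
  fst : rel ⟶ base
  /-- The second morphism of the pair. -/
  snd : rel ⟶ base
  /-- The common section. -/
  sec : base ⟶ rel
  sec_fst : sec ≫ fst = 𝟙 base
  sec_snd : sec ≫ snd = 𝟙 base

namespace ReflexivePair

variable {A : Type u₁} [Category.{v₁} A]

/-- A morphism of reflexive pairs is a morphism between the targets that is compatible with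
some morphism between the sources. -/
@[ext]
structure Hom (X Y : ReflexivePair A) where
  /-- The underlying morphism. -/
  hom : X.base ⟶ Y.base
  compat : ∃ w : X.rel ⟶ Y.rel, w ≫ Y.fst = X.fst ≫ hom ∧ w ≫ Y.snd = X.snd ≫ hom

@[simps id_hom comp_hom]
instance : Category (ReflexivePair A) where
  Hom := Hom
  id X := ⟨𝟙 _, 𝟙 _, by simp, by simp⟩
  comp {X Y Z} f g := ⟨f.hom ≫ g.hom, by
    obtain ⟨w, h₁, h₂⟩ := f.compat
    obtain ⟨w', h₁', h₂'⟩ := g.compat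
    exact ⟨w ≫ w', by rw [Category.assoc, h₁', reassoc_of% h₁],
      by rw [Category.assoc, h₂', reassoc_of% h₂]⟩⟩

/-- The reflexive pair of identities. -/
abbrev const (a : A) : ReflexivePair A := ⟨a, a, 𝟙 a, 𝟙 a, 𝟙 a, by simp, by simp⟩

/-- The functoriality of `ReflexivePair.const`. -/
def constMap {a b : A} (f : a ⟶ b) : const a ⟶ const b :=
  ⟨f, f, (Category.comp_id f).trans (Category.id_comp f).symm, (Category.comp_id f).trans (Category.id_comp f).symm⟩

/-- The canonical morphism from a trivial reflexive pair. -/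
def fromConst (X : ReflexivePair A) : const X.base ⟶ X :=
  ⟨𝟙 _, X.sec, X.sec_fst.trans (Category.id_comp _).symm,
    X.sec_snd.trans (Category.id_comp _).symm⟩

variable (A) in
/-- Two morphisms of reflexive pairs are related if the target relates them. -/
def homRel : HomRel (ReflexivePair A) :=
  fun X Y f g ↦ ∃ h : X.base ⟶ Y.rel, h ≫ Y.fst = f.hom ∧ h ≫ Y.snd = g.hom

end ReflexivePair

/-- The category of formal coequalizers of reflexive pairs in `A`. -/
abbrev FormalQuotient (A : Type u₁) [Category.{v₁} A] := Quotient (ReflexivePair.homRel A)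

namespace FormalQuotient

section

variable {A : Type u₁} [Category.{v₁} A]

/-- The formal coequalizer of a reflexive pair. -/
abbrev mk (X : ReflexivePair A) : FormalQuotient A := (Quotient.functor _).obj X

/-- The morphism of formal coequalizers induced by a morphism of reflexive pairs. -/
abbrev mkMap {X Y : ReflexivePair A} (f : X ⟶ Y) : mk X ⟶ mk Y := (Quotient.functor _).map f

lemma isFiltered [IsSifted A]
    (hA : ∀ ⦃x y z : A⦄ (f : x ⟶ z) (g : y ⟶ z), HasPullback f g) :
    IsFiltered (FormalQuotient A) where
  nonempty := ⟨mk (.const (IsSifted.nonempty (C := A)).some)⟩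
  cocone_objs := by
    rintro ⟨X⟩ ⟨Y⟩
    obtain ⟨c⟩ : Nonempty (StructuredArrow (X.base, Y.base) (Functor.diag A)) := inferInstance
    let f : X.base ⟶ c.right := c.hom.1
    let g : Y.base ⟶ c.right := c.hom.2
    obtain ⟨r, d₀, d₁, s, w₁, w₂, h₀, h₁, h₂, h₃, h₄, h₅⟩ :=
      IsSifted.exists_reflexivePair hA (X.fst ≫ f) (X.snd ≫ f) (Y.fst ≫ g) (Y.snd ≫ g)
    let Z : ReflexivePair A := ⟨c.right, r, d₀, d₁, s, h₀, h₁⟩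
    exact ⟨mk Z, mkMap (X := X) (Y := Z) ⟨f, w₁, h₂, h₃⟩,
      mkMap (X := Y) (Y := Z) ⟨g, w₂, h₄, h₅⟩, trivial⟩
  cocone_maps := by
    rintro ⟨X⟩ ⟨Y⟩ f g
    obtain ⟨f, rfl⟩ := (Quotient.functor (ReflexivePair.homRel A)).map_surjective
      (X := X) (Y := Y) f
    obtain ⟨g, rfl⟩ := (Quotient.functor (ReflexivePair.homRel A)).map_surjective
      (X := X) (Y := Y) g
    obtain ⟨r, d₀, d₁, s, w₁, w₂, h₀, h₁, h₂, h₃, h₄, h₅⟩ :=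
      IsSifted.exists_reflexivePair hA Y.fst Y.snd f.hom g.hom
    let Z : ReflexivePair A := ⟨Y.base, r, d₀, d₁, s, h₀, h₁⟩
    let k : Y ⟶ Z := ⟨𝟙 _, w₁, by simpa using h₂, by simpa using h₃⟩
    refine ⟨mk Z, mkMap k, ?_⟩
    change (Quotient.functor _).map f ≫ (Quotient.functor _).map k =
      (Quotient.functor _).map g ≫ (Quotient.functor _).map k
    rw [← Functor.map_comp, ← Functor.map_comp]
    apply Quotient.sound
    exact ⟨w₂, by simpa [k] using h₄, by simpa [k] using h₅⟩

end

section Colimit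

variable {A : Type u₁} [Category.{v₁} A] {C : Type u₂} [Category.{v₂} C]
  {D : A ⥤ C} {Q : FormalQuotient A ⥤ C}
  (π : ∀ X : ReflexivePair A, D.obj X.base ⟶ Q.obj (mk X))
  (hπ : ∀ {X Y : ReflexivePair A} (f : X ⟶ Y), π X ≫ Q.map (mkMap f) = D.map f.hom ≫ π Y)

/-- A cocone over a functor `Q` on formal coequalizers restricts to a cocone over `D`, for any
natural transformation `π` from `D` to `Q`. -/
abbrev restrictCocone (c : Cocone Q) : Cocone D where
  pt := c.pt
  ι :=
    { app a := π (.const a) ≫ c.ι.app (mk (.const a))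
      naturality {a b} f := by
        have h : _ = D.map f ≫ π (.const b) := hπ (ReflexivePair.constMap f)
        have h' := c.w (mkMap (ReflexivePair.constMap f))
        refine Eq.trans ?_ (Category.comp_id _).symm
        rw [← h', ← Category.assoc, ← h, Category.assoc] }

lemma π_comp_ι_app (c : Cocone Q) (X : ReflexivePair A) :
    π X ≫ c.ι.app (mk X) = (restrictCocone π hπ c).ι.app X.base := by
  have h : π (.const X.base) ≫ Q.map (mkMap X.fromConst) = π X :=
    (hπ X.fromConst).trans ((congr_arg (· ≫ π X) (D.map_id _)).trans (Category.id_comp _))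
  rw [← h, Category.assoc, c.w (mkMap X.fromConst)]

/-- If `Q` computes the coequalizers of the images of the reflexive pairs under `D`, then the
colimit of `Q` is also a colimit of `D`. -/
lemma isColimit_restrictCocone
    (w : ∀ X : ReflexivePair A, D.map X.fst ≫ π X = D.map X.snd ≫ π X)
    (hcoeq : ∀ X : ReflexivePair A, Nonempty (IsColimit (Cofork.ofπ (π X) (w X))))
    {c : Cocone Q} (hc : IsColimit c) : Nonempty (IsColimit (restrictCocone π hπ c)) := by
  have hepi (X : ReflexivePair A) {Z : C} {f g : Q.obj (mk X) ⟶ Z} (h : π X ≫ f = π X ≫ g) :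
      f = g := Cofork.IsColimit.hom_ext (hcoeq X).some h
  have hdesc (s : Cocone D) (X : ReflexivePair A) :
      ∃ l : Q.obj (mk X) ⟶ s.pt, π X ≫ l = s.ι.app X.base :=
    ⟨Cofork.IsColimit.desc (hcoeq X).some (s.ι.app X.base) (by simp),
      Cofork.IsColimit.π_desc' (hcoeq X).some _ _⟩
  choose l hl using hdesc
  let t (s : Cocone D) : Cocone Q :=
    { pt := s.pt
      ι :=
        { app X := l s X.as
          naturality := by
            rintro ⟨X⟩ ⟨Y⟩ f
            obtain ⟨f, rfl⟩ := (Quotient.functor (ReflexivePair.homRel A)).map_surjective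
              (X := X) (Y := Y) f
            apply hepi X
            have h := hπ f
            dsimp at h ⊢
            rw [reassoc_of% h, hl, Category.comp_id, hl, s.w] } }
  exact ⟨{
    desc s := hc.desc (t s)
    fac s a := by
      have h : (t s).ι.app (mk (.const a)) = l s (.const a) := rfl
      rw [Category.assoc, hc.fac, h, hl]
    uniq s m hm := hc.hom_ext fun X ↦ hepi X.as (by
      have h : (t s).ι.app X = l s X.as := rfl
      rw [hc.fac, h, hl, ← hm, ← π_comp_ι_app π hπ c X.as, Category.assoc]
      rfl) }⟩

end Colimit

section Functor

variable {A : Type u₁} [Category.{v₁} A] {C : Type u₂} [Category.{v₂} C]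

instance (D : A ⥤ C) (X : ReflexivePair A) : IsReflexivePair (D.map X.fst) (D.map X.snd) :=
  .mk' (D.map X.sec) (by rw [← D.map_comp, X.sec_fst, D.map_id])
    (by rw [← D.map_comp, X.sec_snd, D.map_id])

variable [HasReflexiveCoequalizers C] (D : A ⥤ C)

/-- The functor sending a formal coequalizer of a reflexive pair to the coequalizer of its image
under `D`. -/
noncomputable def extend : FormalQuotient A ⥤ C :=
  Quotient.lift _
    { obj X := coequalizer (D.map X.fst) (D.map X.snd)
      map {X Y} f := coequalizer.desc (D.map f.hom ≫ coequalizer.π _ _) (by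
        obtain ⟨w, h₁, h₂⟩ := f.compat
        rw [← D.map_comp_assoc, ← D.map_comp_assoc, ← h₁, ← h₂, D.map_comp_assoc,
          D.map_comp_assoc, coequalizer.condition])
      map_id X := coequalizer.hom_ext (by simp)
      map_comp f g := coequalizer.hom_ext (by simp) }
    (by
      rintro X Y f g ⟨h, hf, hg⟩
      refine coequalizer.hom_ext ?_
      rw [coequalizer.π_desc, coequalizer.π_desc, ← hf, ← hg, D.map_comp_assoc, D.map_comp_assoc,
        coequalizer.condition])

/-- The projection to the coequalizer. -/
noncomputable def extendπ (X : ReflexivePair A) : D.obj X.base ⟶ (extend D).obj (mk X) :=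
  coequalizer.π (D.map X.fst) (D.map X.snd)

lemma extendπ_naturality {X Y : ReflexivePair A} (f : X ⟶ Y) :
    extendπ D X ≫ (extend D).map (mkMap f) = D.map f.hom ≫ extendπ D Y :=
  coequalizer.π_desc _ _

lemma extendπ_condition (X : ReflexivePair A) :
    D.map X.fst ≫ extendπ D X = D.map X.snd ≫ extendπ D X :=
  coequalizer.condition _ _

/-- The projection is a coequalizer. -/
noncomputable def extendπIsColimit (X : ReflexivePair A) :
    IsColimit (Cofork.ofπ (extendπ D X) (extendπ_condition D X)) :=
  coequalizerIsCoequalizer _ _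

/-- A functor preserving reflexive coequalizers preserves the colimit of `D` whenever it preserves
the colimit of the associated diagram of reflexive coequalizers. -/
lemma preservesColimit_of_extend {E : Type*} [Category* E] (F : C ⥤ E)
    (hrefl : ∀ {a b : C} (f g : a ⟶ b), IsReflexivePair f g →
      PreservesColimit (parallelPair f g) F)
    [HasColimit (extend D)] [PreservesColimit (extend D) F] : PreservesColimit D F := by
  obtain ⟨h⟩ := isColimit_restrictCocone (extendπ D) (extendπ_naturality D)
    (extendπ_condition D) (fun X ↦ ⟨extendπIsColimit D X⟩) (colimit.isColimit (extend D))
  have hw (X : ReflexivePair A) : (D ⋙ F).map X.fst ≫ F.map (extendπ D X) =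
      (D ⋙ F).map X.snd ≫ F.map (extendπ D X) := by
    simp only [Functor.comp_map, ← F.map_comp, extendπ_condition]
  obtain ⟨h'⟩ := isColimit_restrictCocone (D := D ⋙ F) (Q := extend D ⋙ F)
    (fun X ↦ F.map (extendπ D X))
    (fun f ↦ by simp only [Functor.comp_map, ← F.map_comp, extendπ_naturality]) hw
    (fun X ↦ by
      have := hrefl (D.map X.fst) (D.map X.snd) inferInstance
      exact ⟨isColimitCoforkMapOfIsColimit F _ (extendπIsColimit D X)⟩)
    (isColimitOfPreserves F (colimit.isColimit (extend D)))
  exact preservesColimit_of_preserves_colimit_cocone h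
    (h'.ofIsoColimit (Cocone.ext (Iso.refl _) fun a ↦
      (Category.comp_id _).trans (F.map_comp _ _).symm))

end Functor

end FormalQuotient

section Cardinality

lemma IsCardinalSmallCat.hasCardinalLT_hom {κ : Cardinal.{v}} {A : Type v} [SmallCategory A]
    (hA : IsCardinalSmallCat A κ) (a b : A) : HasCardinalLT (a ⟶ b) κ :=
  ((hasCardinalLT_iff_cardinal_mk_lt _ _).2 hA.2).of_injective _ (Arrow.mk_injective a b)

variable {κ : Cardinal.{v}} [Fact κ.IsRegular]

lemma isCardinalSmallCat_of_hasCardinalLT_hom {A : Type v} [SmallCategory A]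
    (hA : HasCardinalLT A κ) (hhom : ∀ a b : A, HasCardinalLT (a ⟶ b) κ) :
    IsCardinalSmallCat A κ := by
  refine ⟨(hasCardinalLT_iff_cardinal_mk_lt _ _).1 hA, (hasCardinalLT_iff_cardinal_mk_lt _ _).1 ?_⟩
  have h : HasCardinalLT (Σ (a b : A), a ⟶ b) κ :=
    hasCardinalLT_sigma _ _ hA fun a ↦ hasCardinalLT_sigma _ _ hA (hhom a)
  exact h.of_surjective (fun x ↦ Arrow.mk x.2.2) fun f ↦ ⟨⟨f.left, f.right, f.hom⟩, rfl⟩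

lemma FormalQuotient.isCardinalSmallCat {A : Type v} [SmallCategory A]
    (hA : HasCardinalLT A κ) (hhom : ∀ a b : A, HasCardinalLT (a ⟶ b) κ) :
    IsCardinalSmallCat (FormalQuotient A) κ := by
  have hκ : Cardinal.aleph0 ≤ κ := Cardinal.IsRegular.aleph0_le Fact.out
  refine isCardinalSmallCat_of_hasCardinalLT_hom ?_ fun X Y ↦ ?_
  · have h : HasCardinalLT (Σ (b r : A), (r ⟶ b) × (r ⟶ b) × (b ⟶ r)) κ :=
      hasCardinalLT_sigma _ _ hA fun b ↦ hasCardinalLT_sigma _ _ hA fun r ↦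
        hasCardinalLT_prod hκ (hhom _ _) (hasCardinalLT_prod hκ (hhom _ _) (hhom _ _))
    have h' := h.of_injective (Subtype.val (p := fun x ↦
      x.2.2.2.2 ≫ x.2.2.1 = 𝟙 x.1 ∧ x.2.2.2.2 ≫ x.2.2.2.1 = 𝟙 x.1)) Subtype.val_injective
    exact h'.of_surjective (fun x ↦ mk ⟨_, _, _, _, _, x.2.1, x.2.2⟩) (by
      rintro ⟨X⟩
      exact ⟨⟨⟨X.base, X.rel, X.fst, X.snd, X.sec⟩, X.sec_fst, X.sec_snd⟩, rfl⟩)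
  · have h : HasCardinalLT (X.as ⟶ Y.as) κ :=
      (hhom X.as.base Y.as.base).of_injective (fun f ↦ f.hom) fun f g ↦ ReflexivePair.Hom.ext
    exact h.of_surjective _ ((Quotient.functor (ReflexivePair.homRel A)).map_surjective
      (X := X.as) (Y := Y.as))

end Cardinality

lemma preservesColimit_comp_of_final {J : Type*} [Category* J] {K : Type*} [Category* K]
    {C : Type*} [Category* C] {D : Type*} [Category* D] (F : J ⥤ K) [F.Final] (G : K ⥤ C)
    (H : C ⥤ D) [PreservesColimit G H] : PreservesColimit (F ⋙ G) H where
  preserves {c} hc := by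
    let e := (Functor.Final.isColimitExtendCoconeEquiv F (G := G) c).symm hc
    have := (Functor.Final.isColimitWhiskerEquiv F _).symm (isColimitOfPreserves H e)
    refine ⟨this.ofIsoColimit (Cocone.ext (Iso.refl _) fun j ↦ ?_)⟩
    refine (Category.comp_id _).trans (congr_arg H.map ?_)
    exact (Functor.Final.extendCocone_obj_ι_app' c (𝟙 (F.obj j))).trans
      ((congr_arg (· ≫ c.ι.app j) (G.map_id _)).trans (Category.id_comp _))

section PushoutClosure

variable (J : Type v) [SmallCategory J]

/-- The stages of the closure of the corepresentable functors under pushouts, as families of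
functors `J ⥤ Type v`. -/
noncomputable def pushoutStage : ℕ → Σ T : Type v, T → (J ⥤ Type v)
  | 0 => ⟨J, fun j ↦ coyoneda.obj (op j)⟩
  | n + 1 =>
    ⟨(pushoutStage n).1 ⊕ Σ (a b c : (pushoutStage n).1),
        ((pushoutStage n).2 a ⟶ (pushoutStage n).2 b) ×
          ((pushoutStage n).2 a ⟶ (pushoutStage n).2 c),
      Sum.elim (pushoutStage n).2 fun x ↦ pushout x.2.2.2.1 x.2.2.2.2⟩

/-- The functors obtained from corepresentable functors by iterated pushouts. -/
noncomputable def pushoutFamily (x : Σ n, (pushoutStage J n).1) : J ⥤ Type v :=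
  (pushoutStage J x.1).2 x.2

lemma pushoutStage_mono {n m : ℕ} (h : n ≤ m) (x : (pushoutStage J n).1) :
    ∃ y, (pushoutStage J m).2 y = (pushoutStage J n).2 x := by
  induction m, h using Nat.le_induction with
  | base => exact ⟨x, rfl⟩
  | succ m _ ih =>
    obtain ⟨y, hy⟩ := ih
    exact ⟨Sum.inl y, hy⟩

lemma exists_pushoutFamily_eq_pushout {P Q R : J ⥤ Type v} (hP : P ∈ Set.range (pushoutFamily J))
    (hQ : Q ∈ Set.range (pushoutFamily J)) (hR : R ∈ Set.range (pushoutFamily J))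
    (f : P ⟶ Q) (g : P ⟶ R) : pushout f g ∈ Set.range (pushoutFamily J) := by
  obtain ⟨⟨n, a⟩, hP⟩ := hP
  obtain ⟨⟨m, b⟩, hQ⟩ := hQ
  obtain ⟨⟨k, c⟩, hR⟩ := hR
  obtain ⟨a', ha⟩ := pushoutStage_mono J (le_max_left n (max m k)) a
  obtain ⟨b', hb⟩ := pushoutStage_mono J
    ((le_max_left m k).trans (le_max_right n (max m k))) b
  obtain ⟨c', hc⟩ := pushoutStage_mono J
    ((le_max_right m k).trans (le_max_right n (max m k))) c
  obtain rfl := ha.trans hP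
  obtain rfl := hb.trans hQ
  obtain rfl := hc.trans hR
  exact ⟨⟨_ + 1, Sum.inr ⟨a', b', c', f, g⟩⟩, rfl⟩

variable {J} in
/-- An induction principle for iterated pushouts of corepresentable functors. -/
lemma pushoutFamily_induction {p : (J ⥤ Type v) → Prop}
    (corep : ∀ j : J, p (coyoneda.obj (op j)))
    (push : ∀ {P Q R : J ⥤ Type v} (f : P ⟶ Q) (g : P ⟶ R), p P → p Q → p R → p (pushout f g))
    (x : Σ n, (pushoutStage J n).1) : p (pushoutFamily J x) := by
  obtain ⟨n, x⟩ := x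
  change p ((pushoutStage J n).2 x)
  induction n with
  | zero => exact corep x
  | succ n ih =>
    obtain x | ⟨a, b, c, f, g⟩ := x
    · exact ih x
    · exact push f g (ih a) (ih b) (ih c)

section Cardinality

variable {κ : Cardinal.{v}} [Fact κ.IsRegular]

variable {J} in
lemma hasCardinalLT_pushoutFamily_obj (hJ : ∀ a b : J, HasCardinalLT (a ⟶ b) κ)
    (x : Σ n, (pushoutStage J n).1) (j : J) : HasCardinalLT ((pushoutFamily J x).obj j) κ := by
  have hκ : Cardinal.aleph0 ≤ κ := Cardinal.IsRegular.aleph0_le Fact.out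
  refine pushoutFamily_induction (p := fun P ↦ ∀ j, HasCardinalLT (P.obj j) κ)
    (fun i j ↦ hJ i j) (fun {P Q R} f g _ hQ hR j ↦ ?_) x j
  have h : HasCardinalLT (Q.obj j ⊕ R.obj j) κ :=
    (hasCardinalLT_sum_iff _ _ _ hκ).2 ⟨hQ j, hR j⟩
  refine h.of_surjective (Sum.elim ((pushout.inl f g).app j) ((pushout.inr f g).app j)) fun y ↦ ?_
  have hp := (IsPushout.of_hasPushout f g).map ((evaluation J (Type v)).obj j)
  obtain ⟨z, hz⟩ | ⟨z, hz⟩ := Types.eq_or_eq_of_isPushout hp y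
  · exact ⟨Sum.inl z, hz⟩
  · exact ⟨Sum.inr z, hz⟩

variable {J} in
lemma hasCardinalLT_pushoutFamily_hom (x : Σ n, (pushoutStage J n).1) (Q : J ⥤ Type v)
    (hQ : ∀ j, HasCardinalLT (Q.obj j) κ) : HasCardinalLT (pushoutFamily J x ⟶ Q) κ := by
  have hκ : Cardinal.aleph0 ≤ κ := Cardinal.IsRegular.aleph0_le Fact.out
  refine pushoutFamily_induction (p := fun P ↦ HasCardinalLT (P ⟶ Q) κ)
    (fun j ↦ (hQ j).of_injective _ coyonedaEquiv.injective) (fun {P R S} f g _ hR hS ↦ ?_) x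
  exact (hasCardinalLT_prod hκ hR hS).of_injective
    (fun u ↦ (pushout.inl f g ≫ u, pushout.inr f g ≫ u)) fun _ _ h ↦
      pushout.hom_ext (Prod.ext_iff.1 h).1 (Prod.ext_iff.1 h).2

lemma hasCardinalLT_sigma_pushoutStage (huncount : Cardinal.aleph0 < κ)
    (hJ : HasCardinalLT J κ) (hhom : ∀ a b : J, HasCardinalLT (a ⟶ b) κ) :
    HasCardinalLT (Σ n, (pushoutStage J n).1) κ := by
  have hstage (n : ℕ) : HasCardinalLT (pushoutStage J n).1 κ := by
    induction n with
    | zero => exact hJ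
    | succ n ih =>
      refine (hasCardinalLT_sum_iff _ _ _ huncount.le).2 ⟨ih,
        hasCardinalLT_sigma _ _ ih fun a ↦ hasCardinalLT_sigma _ _ ih fun b ↦
          hasCardinalLT_sigma _ _ ih fun c ↦ hasCardinalLT_prod huncount.le ?_ ?_⟩
      · exact hasCardinalLT_pushoutFamily_hom ⟨n, a⟩ _
          (hasCardinalLT_pushoutFamily_obj hhom ⟨n, b⟩)
      · exact hasCardinalLT_pushoutFamily_hom ⟨n, a⟩ _
          (hasCardinalLT_pushoutFamily_obj hhom ⟨n, c⟩)
  refine hasCardinalLT_sigma _ _ ?_ hstage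
  simpa [HasCardinalLT] using huncount

end Cardinality

/-- The completion of `J` under pullbacks: the opposite of the category of iterated pushouts of
corepresentable functors. -/
abbrev PullbackCompletion := (InducedCategory (J ⥤ Type v) (pushoutFamily J))ᵒᵖ

namespace PullbackCompletion

lemma hasPullback {x y z : PullbackCompletion J} (f : x ⟶ z) (g : y ⟶ z) : HasPullback f g := by
  obtain ⟨w, hw⟩ := exists_pushoutFamily_eq_pushout J ⟨z.unop, rfl⟩ ⟨x.unop, rfl⟩ ⟨y.unop, rfl⟩
    f.unop.hom g.unop.hom
  let e : pushout f.unop.hom g.unop.hom ≅ pushoutFamily J w := eqToIso hw.symm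
  let w' : InducedCategory (J ⥤ Type v) (pushoutFamily J) := w
  let inl : x.unop ⟶ w' := InducedCategory.homMk (pushout.inl _ _ ≫ e.hom)
  let inr : y.unop ⟶ w' := InducedCategory.homMk (pushout.inr _ _ ≫ e.hom)
  have h : IsPushout f.unop.hom g.unop.hom inl.hom inr.hom :=
    (IsPushout.of_hasPushout _ _).of_iso (.refl _) (.refl _) (.refl _) e
      (by simp) (by simp) (by simp [inl]) (by simp [inr])
  have h' : IsPushout f.unop g.unop inl inr :=
    IsPushout.of_map (inducedFunctor (pushoutFamily J)) (InducedCategory.hom_ext h.w) h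
  exact h'.op.flip.hasPullback

/-- The inclusion of a category in its completion under pullbacks. -/
noncomputable def incl : J ⥤ PullbackCompletion J :=
  Functor.rightOp
    { obj j := (⟨0, j.unop⟩ : Σ n, (pushoutStage J n).1)
      map f := InducedCategory.homMk (coyoneda.map f)
      map_id _ := InducedCategory.hom_ext (coyoneda.map_id _)
      map_comp _ _ := InducedCategory.hom_ext (coyoneda.map_comp _ _) }

lemma colimit_pushoutFamily (x : Σ n, (pushoutStage J n).1) :
    Nonempty (colimit (pushoutFamily J x) ≅ PUnit) := by
  refine pushoutFamily_induction (p := fun P ↦ Nonempty (colimit P ≅ PUnit))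
    (fun j ↦ ⟨Coyoneda.colimitCoyonedaIso _⟩) (fun {P Q R} f g hP hQ hR ↦ ?_) x
  obtain ⟨hP⟩ := hP
  obtain ⟨hQ⟩ := hQ
  obtain ⟨hR⟩ := hR
  have h := (IsPushout.of_hasPushout f g).map colim
  have h' : IsPushout (𝟙 (PUnit : Type v)) (𝟙 PUnit) (hQ.inv ≫ colim.map (pushout.inl f g))
      (hR.inv ≫ colim.map (pushout.inr f g)) :=
    h.of_iso hP hQ hR (Iso.refl _) (by ext) (by ext) (by simp) (by simp)
  have := h'.isIso_inl_of_isIso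
  exact ⟨(asIso (hQ.inv ≫ colim.map (pushout.inl f g))).symm⟩

instance : (incl J).Final := by
  refine Functor.final_of_colimit_comp_coyoneda_iso_pUnit _ fun x ↦ ?_
  refine HasColimit.isoOfNatIso (NatIso.ofComponents (fun j ↦ ?_) ?_) ≪≫
    (colimit_pushoutFamily J x.unop).some
  · exact Equiv.toIso ((opEquiv _ _).trans (InducedCategory.homEquiv.trans coyonedaEquiv))
  · intro j j' f
    ext g
    exact (coyonedaEquiv_naturality (F := pushoutFamily J x.unop) (InducedCategory.Hom.hom
      (F := pushoutFamily J) (X := ⟨0, j⟩) (Y := x.unop) (Quiver.Hom.unop g)) f).symm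

variable {J} {C : Type u₁} [Category.{v} C] [HasPullbacks C] (D : J ⥤ C)

/-- The functor sending `c` to the functor of morphisms from `c` to the objects of `D`. -/
abbrev homFunctor : Cᵒᵖ ⥤ J ⥤ Type v := coyoneda ⋙ (Functor.whiskeringLeft _ _ _).obj D

/-- The partial left adjoint of `homFunctor D` extends `D`. -/
def corepresentableBy (j : J) :
    (homFunctor D ⋙ coyoneda.obj (op (coyoneda.obj (op j)))).CorepresentableBy (op (D.obj j)) where
  homEquiv := (opEquiv _ _).trans (coyonedaEquiv (F := (homFunctor D).obj _)).symm
  homEquiv_comp {Y Y'} g f := by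
    refine (Equiv.symm_apply_eq _).2 (Eq.trans ?_ (coyonedaEquiv_comp _ _).symm)
    exact congr_arg (fun k : Y.unop ⟶ D.obj j ↦ g.unop ≫ k)
      (coyonedaEquiv (F := (homFunctor D).obj _).apply_symm_apply f.unop).symm

lemma leftAdjointObjIsDefined (x : Σ n, (pushoutStage J n).1) :
    (homFunctor D).leftAdjointObjIsDefined (pushoutFamily J x) := by
  refine pushoutFamily_induction (p := (homFunctor D).leftAdjointObjIsDefined)
    (fun j ↦ (corepresentableBy D j).isCorepresentable) (fun f g hP hQ hR ↦ ?_) x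
  refine Functor.leftAdjointObjIsDefined_colimit _ ?_
  rintro (_ | _ | _)
  exacts [hP, hQ, hR]

/-- The extension of a functor to the completion under pullbacks. -/
noncomputable def extend : PullbackCompletion J ⥤ C :=
  (ObjectProperty.lift _ (inducedFunctor (pushoutFamily J)) (leftAdjointObjIsDefined D) ⋙
    (homFunctor D).partialLeftAdjoint).leftOp

/-- The corepresentable functors, as objects at which the partial left adjoint of `homFunctor D`
is defined. -/
abbrev source (j : J) : (homFunctor D).PartialLeftAdjointSource :=
  ⟨coyoneda.obj (op j), leftAdjointObjIsDefined D ⟨0, j⟩⟩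

/-- The value of the partial left adjoint of `homFunctor D` at a corepresentable functor. -/
noncomputable def partialLeftAdjointObjIso (j : J) :
    (homFunctor D).partialLeftAdjointObj (source D j) ≅ op (D.obj j) :=
  have : (homFunctor D ⋙ coyoneda.obj (op (coyoneda.obj (op j)))).IsCorepresentable :=
    leftAdjointObjIsDefined D ⟨0, j⟩
  (Functor.corepresentableBy _).uniqueUpToIso (corepresentableBy D j)

lemma partialLeftAdjointHomEquiv_partialLeftAdjointObjIso_hom (j : J) :
    (homFunctor D).partialLeftAdjointHomEquiv (partialLeftAdjointObjIso D j).hom =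
      coyonedaEquiv.symm (𝟙 (D.obj j)) :=
  Equiv.apply_symm_apply _ _

/-- The extension of a functor to the completion under pullbacks is indeed an extension. -/
noncomputable def inclCompExtend : incl J ⋙ extend D ≅ D :=
  NatIso.ofComponents (fun j ↦ (partialLeftAdjointObjIso D j).symm.unop) fun {i j} f ↦ by
    apply Quiver.Hom.op_inj
    let g : source D j ⟶ source D i := ObjectProperty.homMk (coyoneda.map f.op)
    change (partialLeftAdjointObjIso D j).inv ≫ (homFunctor D).partialLeftAdjointMap g =
      (D.map f).op ≫ (partialLeftAdjointObjIso D i).inv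
    rw [Iso.inv_comp_eq, ← Category.assoc, Iso.eq_comp_inv]
    apply (homFunctor D).partialLeftAdjointHomEquiv.injective
    rw [Functor.partialLeftAdjointHomEquiv_map_comp, Functor.partialLeftAdjointHomEquiv_comp]
    refine (congr_arg (g.hom ≫ ·)
      (partialLeftAdjointHomEquiv_partialLeftAdjointObjIso_hom D i)).trans (Eq.trans ?_ (congr_arg
        (· ≫ (homFunctor D).map (D.map f).op)
          (partialLeftAdjointHomEquiv_partialLeftAdjointObjIso_hom D j).symm))
    refine (coyonedaEquiv_symm_map (F := (homFunctor D).obj (op (D.obj i))) f (𝟙 _)).symm.trans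
      ((Equiv.symm_apply_eq _).2 (Eq.trans ?_ (coyonedaEquiv_comp _ _).symm))
    refine Eq.trans ?_ (congr_arg (fun k : D.obj j ⟶ D.obj j ↦ D.map f ≫ k)
      (coyonedaEquiv (F := (homFunctor D).obj _).apply_symm_apply (𝟙 (D.obj j))).symm)
    exact (Category.id_comp _).trans (Category.comp_id _).symm

end PullbackCompletion

end PushoutClosure

end CategoryTheory

end

/-- For an uncountable regular cardinal `κ`, if `C` has pullbacks, reflexive
coequalizers and colimits of all `κ`-small filtered diagrams, then a functor
`F : C ⥤ D` preserving reflexive coequalizers and colimits of `κ`-small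
filtered shapes preserves colimits of all `κ`-small sifted shapes. -/
theorem preservesCardinalSmallSiftedColimits_of_pullbacks
    (κ : Cardinal.{v}) (hreg : κ.IsRegular) (huncount : Cardinal.aleph0 < κ)
    {C : Type u} [Category.{v} C] {D : Type u'} [Category.{v'} D]
    [HasPullbacks C] [HasReflexiveCoequalizers C]
    (hfiltC : ∀ (K : Type v) [SmallCategory K], IsFiltered K → IsCardinalSmallCat K κ →
      HasColimitsOfShape K C)
    (F : C ⥤ D)
    (hrefl : ∀ {A B : C} (f g : A ⟶ B), IsReflexivePair f g →
      PreservesColimit (parallelPair f g) F)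
    (hfilt : ∀ (K : Type v) [SmallCategory K], IsFiltered K → IsCardinalSmallCat K κ →
      PreservesColimitsOfShape K F)
    (J : Type v) [SmallCategory J] (hsift : IsSifted J) (hsmall : IsCardinalSmallCat J κ) :
    PreservesColimitsOfShape J F := by
  have : Fact κ.IsRegular := ⟨hreg⟩
  have hhom := hsmall.hasCardinalLT_hom
  have hsift' : IsSifted (PullbackCompletion J) :=
    IsSifted.of_final_functor_from_sifted (PullbackCompletion.incl J)
  have hK : IsFiltered (FormalQuotient (PullbackCompletion J)) :=
    FormalQuotient.isFiltered fun _ _ _ f g ↦ PullbackCompletion.hasPullback J f g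
  have hKsmall : IsCardinalSmallCat (FormalQuotient (PullbackCompletion J)) κ := by
    refine FormalQuotient.isCardinalSmallCat ?_ fun x y ↦ ?_
    · exact (hasCardinalLT_iff_of_equiv Opposite.equivToOpposite κ).1
        (hasCardinalLT_sigma_pushoutStage J huncount
          ((hasCardinalLT_iff_cardinal_mk_lt _ _).2 hsmall.1) hhom)
    · exact (hasCardinalLT_pushoutFamily_hom y.unop _
        (hasCardinalLT_pushoutFamily_obj hhom x.unop)).of_injective (fun f ↦ f.unop.hom)
          fun f g h ↦ Quiver.Hom.unop_inj (InducedCategory.hom_ext h)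
  have := hfiltC _ hK hKsmall
  have := hfilt _ hK hKsmall
  refine ⟨fun {G} ↦ ?_⟩
  have := FormalQuotient.preservesColimit_of_extend (PullbackCompletion.extend G) F hrefl
  have := preservesColimit_comp_of_final (PullbackCompletion.incl J)
    (PullbackCompletion.extend G) F
  exact preservesColimit_of_iso_diagram F (PullbackCompletion.inclCompExtend G)
end

section
/- Let κ be a regular cardinal and C a κ-small category. Then every presheaf belonging to the smallest replete full subcategory of [Cᵒᵖ, Set] containing all representable presheaves and closed under colimits of diagrams indexed by κ-small categories takes values in sets of cardinality < κ. -/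
open CategoryTheory CategoryTheory.Limits

/-- `X` has cardinality `< κ`. -/
def HasCardLT (X : Type w) (κ : Cardinal.{v}) : Prop :=
  Cardinal.lift.{v} (Cardinal.mk X) < Cardinal.lift.{w} κ

/-- A category `J` is `κ`-small if it has fewer than `κ` objects and fewer than
`κ` morphisms. -/
def IsCardSmallCat (J : Type w) [Category.{w'} J] (κ : Cardinal.{v}) : Prop :=
  HasCardLT J κ ∧ HasCardLT (Arrow J) κ

/-- A class `T` of presheaves on `C` is the class of objects of a replete full
subcategory of `[Cᵒᵖ, Set]` containing the representables and closed under
colimits of diagrams indexed by `κ`-small categories. -/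
def ColimClosed {C : Type u} [Category.{v} C] (κ : Cardinal.{v})
    (T : Set (Cᵒᵖ ⥤ Type v)) : Prop :=
  (∀ X : C, yoneda.obj X ∈ T) ∧
  (∀ φ ψ : Cᵒᵖ ⥤ Type v, φ ∈ T → Nonempty (φ ≅ ψ) → ψ ∈ T) ∧
  (∀ (J : Type v) [SmallCategory J], IsCardSmallCat J κ →
    ∀ (F : J ⥤ (Cᵒᵖ ⥤ Type v)) (c : Cocone F), IsColimit c →
      (∀ j, F.obj j ∈ T) → c.pt ∈ T)

/-- A hom-type of a `κ`-small category has cardinality `< κ`. -/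
theorem IsCardSmallCat.hasCardLT_hom {C : Type u} [Category.{v} C] {κ : Cardinal.{v}}
    (hC : IsCardSmallCat C κ) (X Y : C) : HasCardLT (X ⟶ Y) κ :=
  HasCardinalLT.of_injective (κ := κ) hC.2 (fun f : X ⟶ Y => Arrow.mk f)
    (fun _ _ h => Arrow.mk_injective _ _ h)

/-- A colimit of types of cardinality `< κ`, indexed by a category with fewer than `κ` objects,
has cardinality `< κ` when `κ` is regular. -/
theorem hasCardLT_pt_of_isColimit {J : Type v} [SmallCategory J] {κ : Cardinal.{v}}
    (hreg : κ.IsRegular) (hJ : HasCardLT J κ) {F : J ⥤ Type v} {c : Cocone F} (hc : IsColimit c)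
    (hF : ∀ j, HasCardLT (F.obj j) κ) : HasCardLT c.pt κ := by
  have : Fact κ.IsRegular := ⟨hreg⟩
  refine HasCardinalLT.of_surjective (κ := κ) (hasCardinalLT_sigma (fun j => F.obj j) κ hJ hF)
    (fun x : Σ j, F.obj j => c.ι.app x.1 x.2) fun y => ?_
  obtain ⟨j, x, rfl⟩ := Types.jointly_surjective F hc y
  exact ⟨⟨j, x⟩, rfl⟩

/-- For a regular cardinal `κ` and a `κ`-small category `C`, every presheaf in
the smallest replete full subcategory of `[Cᵒᵖ, Set]` containing the
representables and closed under `κ`-small colimits takes values in sets of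
cardinality `< κ`. -/
theorem values_lt_of_mem_cardSmallColimitClosure
    (κ : Cardinal.{v}) (hreg : κ.IsRegular)
    {C : Type u} [Category.{v} C] (hC : IsCardSmallCat C κ)
    (φ : Cᵒᵖ ⥤ Type v) (hφ : ∀ T : Set (Cᵒᵖ ⥤ Type v), ColimClosed κ T → φ ∈ T) :
    ∀ c : Cᵒᵖ, HasCardLT (φ.obj c) κ := by
  refine hφ {ψ | ∀ c, HasCardLT (ψ.obj c) κ} ⟨fun X c => hC.hasCardLT_hom c.unop X, ?_, ?_⟩
  · rintro ψ χ hψ ⟨e⟩ c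
    exact (hasCardinalLT_iff_of_equiv (e.app c).toEquiv κ).1 (hψ c)
  · intro J _ hJ F s hs hF c
    exact hasCardLT_pt_of_isColimit hreg hJ.1
      (isColimitOfPreserves ((evaluation _ _).obj c) hs) fun j => hF j c
end

section
/- Let λ and κ be regular cardinals with λ ≪ κ (i.e. κ₀^λ₀ < κ for all cardinals λ₀ < λ and κ₀ < κ) and κ uncountable, and let C be a (locally small) category having limits of all λ-small diagrams. Then Sind_κ(C), the smallest replete full subcategory of [Cᵒᵖ, Set] containing all representable presheaves and closed under colimits of diagrams indexed by κ-small sifted categories, is closed in [Cᵒᵖ, Set] under limits of all λ-small diagrams. -/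
open CategoryTheory CategoryTheory.Limits

/-- `λ ≪ κ`: `κ₀ ^ λ₀ < κ` for all `λ₀ < λ` and `κ₀ < κ`. -/
def CardLL (lam κ : Cardinal.{v}) : Prop :=
  ∀ lam₀ < lam, ∀ κ₀ < κ, κ₀ ^ lam₀ < κ

/-- A class `T` of presheaves on `C` is the class of objects of a replete full
subcategory of `[Cᵒᵖ, Set]` containing the representables and closed under
colimits of diagrams indexed by `κ`-small sifted categories. -/
def SindClosed {C : Type u} [Category.{v} C] (κ : Cardinal.{v})
    (T : Set (Cᵒᵖ ⥤ Type v)) : Prop :=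
  (∀ X : C, yoneda.obj X ∈ T) ∧
  (∀ φ ψ : Cᵒᵖ ⥤ Type v, φ ∈ T → Nonempty (φ ≅ ψ) → ψ ∈ T) ∧
  (∀ (J : Type v) [SmallCategory J], IsSifted J → IsCardSmallCat J κ →
    ∀ (F : J ⥤ (Cᵒᵖ ⥤ Type v)) (c : Cocone F), IsColimit c →
      (∀ j, F.obj j ∈ T) → c.pt ∈ T)

section SiftedSubcategory

/-- A subcategory of `E` given by fewer than `κ` objects and morphisms, which meets every object of
`E` and is closed under the formation of (weak) spans, cospans and spans between cospans, is sifted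
and final in `E`. -/
theorem exists_final_of_closed_subcategory {E : Type w} [Category.{v} E] {κ : Cardinal.{v}}
    [Fact κ.IsRegular] {J : Type v} [Nonempty J] (o : J → E) (H : ∀ a b, Set (o a ⟶ o b))
    (hid : ∀ a, 𝟙 (o a) ∈ H a a)
    (hcomp : ∀ a b c, ∀ f ∈ H a b, ∀ g ∈ H b c, f ≫ g ∈ H a c)
    (hJ : HasCardinalLT J κ) (hH : ∀ a b, HasCardinalLT (H a b) κ)
    (hgen : ∀ e, ∃ j, Nonempty (e ⟶ o j))
    (hspan : ∀ a b e (f : e ⟶ o a) (g : e ⟶ o b),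
      ∃ s, ∃ p ∈ H s a, ∃ q ∈ H s b, ∃ r : e ⟶ o s, r ≫ p = f ∧ r ≫ q = g)
    (hcospan : ∀ a b, ∃ k, ∃ p, p ∈ H a k ∧ ∃ q, q ∈ H b k)
    (hlink : ∀ a b k k', ∀ p ∈ H a k, ∀ q ∈ H b k, ∀ p' ∈ H a k', ∀ q' ∈ H b k',
      ∃ s, ∃ α ∈ H a s, ∃ β ∈ H b s, ∃ u ∈ H s k, ∃ u' ∈ H s k',
        α ≫ u = p ∧ β ≫ u = q ∧ α ≫ u' = p' ∧ β ≫ u' = q') :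
    ∃ (_ : SmallCategory J) (Φ : J ⥤ E), IsSifted J ∧ Φ.Final ∧ IsCardSmallCat J κ := by
  let inst : SmallCategory J :=
    { Hom := fun a b => H a b
      id := fun a => ⟨𝟙 _, hid a⟩
      comp := fun f g => ⟨f.1 ≫ g.1, hcomp _ _ _ _ f.2 _ g.2⟩
      id_comp := fun f => Subtype.ext (Category.id_comp f.1)
      comp_id := fun f => Subtype.ext (Category.comp_id f.1)
      assoc := fun f g h => Subtype.ext (Category.assoc f.1 g.1 h.1) }
  let Φ : J ⥤ E :=
    { obj := o
      map := fun f => f.1 }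
  refine ⟨inst, Φ, ?_, ?_, hJ, ?_⟩
  · have : (Functor.diag J).Final := by
      refine ⟨?_⟩
      rintro ⟨a, b⟩
      have : Nonempty (StructuredArrow (a, b) (Functor.diag J)) := by
        obtain ⟨k, p, hp, q, hq⟩ := hcospan a b
        exact ⟨StructuredArrow.mk (Y := k) (Prod.mkHom (⟨p, hp⟩ : a ⟶ k) (⟨q, hq⟩ : b ⟶ k))⟩
      refine zigzag_isConnected fun x y => ?_
      obtain ⟨s, α, hα, β, hβ, u, hu, u', hu', h₁, h₂, h₃, h₄⟩ :=
        hlink a b x.right y.right _ x.hom.1.2 _ x.hom.2.2 _ y.hom.1.2 _ y.hom.2.2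
      let z : StructuredArrow (a, b) (Functor.diag J) :=
        StructuredArrow.mk (Y := s) (Prod.mkHom (⟨α, hα⟩ : a ⟶ s) (⟨β, hβ⟩ : b ⟶ s))
      refine (Zigzag.of_inv (j₁ := x) (j₂ := z) (StructuredArrow.homMk ⟨u, hu⟩ ?_)).trans
        (Zigzag.of_hom (StructuredArrow.homMk ⟨u', hu'⟩ ?_))
      · exact Prod.ext (Subtype.ext h₁) (Subtype.ext h₂)
      · exact Prod.ext (Subtype.ext h₃) (Subtype.ext h₄)
    exact { }
  · refine ⟨fun e => ?_⟩
    have : Nonempty (StructuredArrow e Φ) := by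
      obtain ⟨j, ⟨f⟩⟩ := hgen e
      exact ⟨StructuredArrow.mk (Y := j) (T := Φ) f⟩
    refine zigzag_isConnected fun x y => ?_
    obtain ⟨s, p, hp, q, hq, r, h₁, h₂⟩ := hspan x.right y.right e x.hom y.hom
    let z : StructuredArrow e Φ := StructuredArrow.mk (Y := s) (T := Φ) r
    exact (Zigzag.of_inv (j₁ := x) (j₂ := z) (StructuredArrow.homMk ⟨p, hp⟩ h₁)).trans
      (Zigzag.of_hom (StructuredArrow.homMk ⟨q, hq⟩ h₂))
  · refine (hasCardinalLT_sigma (fun a => Σ b, (a ⟶ b)) κ hJ fun a =>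
      hasCardinalLT_sigma (fun b => (a ⟶ b)) κ hJ fun b => hH a b).of_surjective
      (fun t => Arrow.mk t.2.2) fun f => ⟨⟨f.left, f.right, f.hom⟩, rfl⟩

theorem exists_cardinalLT_closure {X : Type w} {κ : Cardinal.{v}} (hκ : κ.IsRegular)
    (huncount : Cardinal.aleph0 < κ) (Φ : Set X → Set X)
    (hΦ : ∀ U : Set X, HasCardinalLT U κ → HasCardinalLT (Φ U) κ)
    (U : Set X) (hU : HasCardinalLT U κ) :
    ∃ M : ℕ → Set X, U ⊆ M 0 ∧ Monotone M ∧ (∀ n, Φ (M n) ⊆ M (n + 1)) ∧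
      HasCardinalLT (⋃ n, M n) κ := by
  have : Fact κ.IsRegular := ⟨hκ⟩
  let M : ℕ → Set X := fun n => Nat.rec U (fun _ V => V ∪ Φ V) n
  have hM : ∀ n, HasCardinalLT ↥(M n) κ := by
    intro n
    induction n with
    | zero => exact hU
    | succ n ih => exact hasCardinalLT_union hκ.aleph0_le ih (hΦ _ ih)
  refine ⟨M, subset_rfl, monotone_nat_of_le_succ fun n => Set.subset_union_left,
    fun n => Set.subset_union_right, hasCardinalLT_iUnion _ ?_ hM⟩
  simpa [HasCardinalLT] using huncount

theorem hasCardinalLT_range {X : Type w} {ι : Type w'} {κ : Cardinal.{v}}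
    (hι : HasCardinalLT ι κ) (f : ι → X) : HasCardinalLT (Set.range f) κ :=
  hι.of_surjective _ Set.rangeFactorization_surjective

/-- A category `E` with a weakly terminal family of size `< κ`, in which spans between two given
objects have such a family as well, and which satisfies a strong form of siftedness, admits a final
functor from a `κ`-small sifted category. -/
theorem exists_final_functor_of_cardSmall_sifted {E : Type w} [Category.{v} E] {κ : Cardinal.{v}}
    (hκ : κ.IsRegular) (huncount : Cardinal.aleph0 < κ) [Nonempty E]
    (hgen : ∃ (ι : Type v) (_ : HasCardinalLT ι κ) (G : ι → E), ∀ e, ∃ i, Nonempty (e ⟶ G i))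
    (hspan : ∀ a b : E, ∃ (ι : Type v) (_ : HasCardinalLT ι κ) (S : ι → E)
      (p : ∀ i, S i ⟶ a) (q : ∀ i, S i ⟶ b), ∀ (e : E) (f : e ⟶ a) (g : e ⟶ b),
        ∃ (i : ι) (r : e ⟶ S i), r ≫ p i = f ∧ r ≫ q i = g)
    (hcospan : ∀ a b : E, ∃ k, Nonempty (a ⟶ k) ∧ Nonempty (b ⟶ k))
    (hlink : ∀ (a b k k' : E) (p : a ⟶ k) (q : b ⟶ k) (p' : a ⟶ k') (q' : b ⟶ k'),
      ∃ (s : E) (α : a ⟶ s) (β : b ⟶ s) (u : s ⟶ k) (u' : s ⟶ k'),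
        α ≫ u = p ∧ β ≫ u = q ∧ α ≫ u' = p' ∧ β ≫ u' = q') :
    ∃ (J : Type v) (_ : SmallCategory J) (Φ : J ⥤ E),
      IsSifted J ∧ Φ.Final ∧ IsCardSmallCat J κ := by
  have : Fact κ.IsRegular := ⟨hκ⟩
  obtain ⟨ι₀, hι₀, G, hG⟩ := hgen
  choose ι hι S p q hS using hspan
  choose K hK₁ hK₂ using hcospan
  choose s α β u u' h₁ h₂ h₃ h₄ using hlink
  let Ob (U : Set (Arrow E)) : Type w := { a : E // Arrow.mk (𝟙 a) ∈ U }
  let Hm (U : Set (Arrow E)) (a b : E) : Type v := { f : a ⟶ b // Arrow.mk f ∈ U }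
  have hOb (U : Set (Arrow E)) (hU : HasCardinalLT U κ) : HasCardinalLT (Ob U) κ :=
    hU.of_injective (fun a => ⟨_, a.2⟩) fun a b h =>
      Subtype.ext (congrArg Comma.left (congrArg Subtype.val h))
  have hHm (U : Set (Arrow E)) (hU : HasCardinalLT U κ) (a b : E) : HasCardinalLT (Hm U a b) κ :=
    hU.of_injective (fun f => ⟨_, f.2⟩) fun f g h =>
      Subtype.ext (Arrow.mk_injective _ _ (congrArg Subtype.val h))
  let I₁ (U : Set (Arrow E)) := Σ (a b c : Ob U), Hm U a.1 b.1 × Hm U b.1 c.1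
  let I₂ (U : Set (Arrow E)) := Σ (a b : Ob U), ι a.1 b.1
  let I₃ (U : Set (Arrow E)) := Σ (_ : Ob U), Ob U
  let I₄ (U : Set (Arrow E)) := Σ (a b k k' : Ob U),
    (Hm U a.1 k.1 × Hm U b.1 k.1) × (Hm U a.1 k'.1 × Hm U b.1 k'.1)
  have hI₁ (U : Set (Arrow E)) (hU : HasCardinalLT U κ) : HasCardinalLT (I₁ U) κ :=
    hasCardinalLT_sigma _ _ (hOb U hU) fun _ => hasCardinalLT_sigma _ _ (hOb U hU) fun _ =>
      hasCardinalLT_sigma _ _ (hOb U hU) fun _ =>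
        hasCardinalLT_prod hκ.aleph0_le (hHm U hU _ _) (hHm U hU _ _)
  have hI₂ (U : Set (Arrow E)) (hU : HasCardinalLT U κ) : HasCardinalLT (I₂ U) κ :=
    hasCardinalLT_sigma _ _ (hOb U hU) fun _ => hasCardinalLT_sigma _ _ (hOb U hU) fun _ => hι _ _
  have hI₃ (U : Set (Arrow E)) (hU : HasCardinalLT U κ) : HasCardinalLT (I₃ U) κ :=
    hasCardinalLT_sigma _ _ (hOb U hU) fun _ => hOb U hU
  have hI₄ (U : Set (Arrow E)) (hU : HasCardinalLT U κ) : HasCardinalLT (I₄ U) κ :=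
    hasCardinalLT_sigma _ _ (hOb U hU) fun _ => hasCardinalLT_sigma _ _ (hOb U hU) fun _ =>
      hasCardinalLT_sigma _ _ (hOb U hU) fun _ => hasCardinalLT_sigma _ _ (hOb U hU) fun _ =>
        hasCardinalLT_prod hκ.aleph0_le
          (hasCardinalLT_prod hκ.aleph0_le (hHm U hU _ _) (hHm U hU _ _))
          (hasCardinalLT_prod hκ.aleph0_le (hHm U hU _ _) (hHm U hU _ _))
  let φ₁ (U : Set (Arrow E)) (t : I₁ U) : Arrow E := Arrow.mk (t.2.2.2.1.1 ≫ t.2.2.2.2.1)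
  let φ₂ (U : Set (Arrow E)) (t : I₂ U × Fin 3) : Arrow E :=
    ![Arrow.mk (𝟙 (S _ _ t.1.2.2)), Arrow.mk (p _ _ t.1.2.2), Arrow.mk (q _ _ t.1.2.2)] t.2
  let φ₃ (U : Set (Arrow E)) (t : I₃ U × Fin 3) : Arrow E :=
    ![Arrow.mk (𝟙 (K t.1.1.1 t.1.2.1)), Arrow.mk (hK₁ t.1.1.1 t.1.2.1).some,
      Arrow.mk (hK₂ t.1.1.1 t.1.2.1).some] t.2
  let φ₄ (U : Set (Arrow E)) (t : I₄ U × Fin 5) : Arrow E :=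
    let x := t.1.2.2.2.2
    ![Arrow.mk (𝟙 (s _ _ _ _ x.1.1.1 x.1.2.1 x.2.1.1 x.2.2.1)),
      Arrow.mk (α _ _ _ _ x.1.1.1 x.1.2.1 x.2.1.1 x.2.2.1),
      Arrow.mk (β _ _ _ _ x.1.1.1 x.1.2.1 x.2.1.1 x.2.2.1),
      Arrow.mk (u _ _ _ _ x.1.1.1 x.1.2.1 x.2.1.1 x.2.2.1),
      Arrow.mk (u' _ _ _ _ x.1.1.1 x.1.2.1 x.2.1.1 x.2.2.1)] t.2
  let Θ (U : Set (Arrow E)) : Set (Arrow E) :=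
    (Set.range (φ₁ U) ∪ Set.range (φ₂ U)) ∪ (Set.range (φ₃ U) ∪ Set.range (φ₄ U))
  have hfin (n : ℕ) : HasCardinalLT (Fin n) κ := hasCardinalLT_of_finite _ _ hκ.aleph0_le
  obtain ⟨M, hM₀, hmono, hM, hcard⟩ := exists_cardinalLT_closure hκ huncount Θ (fun U hU =>
    hasCardinalLT_union hκ.aleph0_le
      (hasCardinalLT_union hκ.aleph0_le (hasCardinalLT_range (hI₁ U hU) _)
        (hasCardinalLT_range (hasCardinalLT_prod hκ.aleph0_le (hI₂ U hU) (hfin _)) _))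
      (hasCardinalLT_union hκ.aleph0_le
        (hasCardinalLT_range (hasCardinalLT_prod hκ.aleph0_le (hI₃ U hU) (hfin _)) _)
        (hasCardinalLT_range (hasCardinalLT_prod hκ.aleph0_le (hI₄ U hU) (hfin _)) _)))
    (Set.range fun i => Arrow.mk (𝟙 (G i))) (hasCardinalLT_range hι₀ _)
  have mem_of_mem {n : ℕ} {x : Arrow E} (hx : x ∈ M n) : x ∈ ⋃ n, M n :=
    Set.mem_iUnion.2 ⟨n, hx⟩
  have hM₁ {n : ℕ} (t : I₁ (M n)) : φ₁ _ t ∈ ⋃ n, M n :=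
    mem_of_mem (hM n (Or.inl (Or.inl ⟨t, rfl⟩)))
  have hM₂ {n : ℕ} (t : I₂ (M n)) (i) : φ₂ _ (t, i) ∈ ⋃ n, M n :=
    mem_of_mem (hM n (Or.inl (Or.inr ⟨(t, i), rfl⟩)))
  have hM₃ {n : ℕ} (t : I₃ (M n)) (i) : φ₃ _ (t, i) ∈ ⋃ n, M n :=
    mem_of_mem (hM n (Or.inr (Or.inl ⟨(t, i), rfl⟩)))
  have hM₄ {n : ℕ} (t : I₄ (M n)) (i) : φ₄ _ (t, i) ∈ ⋃ n, M n :=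
    mem_of_mem (hM n (Or.inr (Or.inr ⟨(t, i), rfl⟩)))
  have : Small.{v} (Ob (⋃ n, M n)) := (hOb _ hcard).small
  let o : Shrink.{v} (Ob (⋃ n, M n)) → E := fun a => ((equivShrink _).symm a).1
  let c (a : E) (ha : Arrow.mk (𝟙 a) ∈ ⋃ n, M n) : Shrink.{v} (Ob (⋃ n, M n)) :=
    equivShrink _ ⟨a, ha⟩
  have hc (a : E) (ha : Arrow.mk (𝟙 a) ∈ ⋃ n, M n) : o (c a ha) = a := by simp [o, c]
  have exists_c (X : E) (ha : Arrow.mk (𝟙 X) ∈ ⋃ n, M n)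
      (Q : ∀ X : E, Prop) (hQ : Q X) : ∃ a, Q (o a) := ⟨c X ha, by rwa [hc]⟩
  have ho (a) : Arrow.mk (𝟙 (o a)) ∈ ⋃ n, M n := ((equivShrink _).symm a).2
  have hin (i : ι₀) : Arrow.mk (𝟙 (G i)) ∈ ⋃ n, M n := mem_of_mem (hM₀ ⟨i, rfl⟩)
  have : Nonempty (Shrink.{v} (Ob (⋃ n, M n))) := by
    obtain ⟨i, -⟩ := hG (Classical.arbitrary E)
    exact ⟨c _ (hin i)⟩
  refine ⟨_, exists_final_of_closed_subcategory o
    (fun a b => { f | Arrow.mk f ∈ ⋃ n, M n }) ho ?_ ?_ ?_ ?_ ?_ ?_ ?_⟩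
  · intro a b d f hf g hg
    obtain ⟨n₁, h₁⟩ := Set.mem_iUnion.1 (ho a)
    obtain ⟨n₂, h₂⟩ := Set.mem_iUnion.1 (ho b)
    obtain ⟨n₃, h₃⟩ := Set.mem_iUnion.1 (ho d)
    obtain ⟨n₄, h₄⟩ := Set.mem_iUnion.1 hf
    obtain ⟨n₅, h₅⟩ := Set.mem_iUnion.1 hg
    have le (m) (hm : m ≤ n₁ + n₂ + n₃ + n₄ + n₅) := hmono hm
    exact hM₁ (n := n₁ + n₂ + n₃ + n₄ + n₅) ⟨⟨o a, le _ (by lia) h₁⟩, ⟨o b, le _ (by lia) h₂⟩,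
      ⟨o d, le _ (by lia) h₃⟩, ⟨f, le _ (by lia) h₄⟩, ⟨g, le _ (by lia) h₅⟩⟩
  · exact (hOb _ hcard).of_surjective _ (equivShrink _).surjective
  · exact fun a b => hHm _ hcard _ _
  · intro e
    obtain ⟨i, hi⟩ := hG e
    exact exists_c _ (hin i) (fun X => Nonempty (e ⟶ X)) hi
  · intro a b e f g
    obtain ⟨n₁, h₁⟩ := Set.mem_iUnion.1 (ho a)
    obtain ⟨n₂, h₂⟩ := Set.mem_iUnion.1 (ho b)
    obtain ⟨i, r, hr⟩ := hS _ _ e f g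
    let t : I₂ (M (n₁ + n₂)) :=
      ⟨⟨o a, hmono (by lia) h₁⟩, ⟨o b, hmono (by lia) h₂⟩, i⟩
    exact exists_c _ (hM₂ t 0) (fun X => ∃ p : X ⟶ o a, Arrow.mk p ∈ ⋃ n, M n ∧
      ∃ q : X ⟶ o b, Arrow.mk q ∈ ⋃ n, M n ∧ ∃ r : e ⟶ X, r ≫ p = f ∧ r ≫ q = g)
      ⟨_, hM₂ t 1, _, hM₂ t 2, r, hr⟩
  · intro a b
    obtain ⟨n₁, h₁⟩ := Set.mem_iUnion.1 (ho a)
    obtain ⟨n₂, h₂⟩ := Set.mem_iUnion.1 (ho b)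
    let t : I₃ (M (n₁ + n₂)) := ⟨⟨o a, hmono (by lia) h₁⟩, ⟨o b, hmono (by lia) h₂⟩⟩
    exact exists_c _ (hM₃ t 0) (fun X => ∃ p : o a ⟶ X, Arrow.mk p ∈ ⋃ n, M n ∧
      ∃ q : o b ⟶ X, Arrow.mk q ∈ ⋃ n, M n) ⟨_, hM₃ t 1, _, hM₃ t 2⟩
  · intro a b k k' p hp q hq p' hp' q' hq'
    obtain ⟨n₁, m₁⟩ := Set.mem_iUnion.1 (ho a)
    obtain ⟨n₂, m₂⟩ := Set.mem_iUnion.1 (ho b)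
    obtain ⟨n₃, m₃⟩ := Set.mem_iUnion.1 (ho k)
    obtain ⟨n₄, m₄⟩ := Set.mem_iUnion.1 (ho k')
    obtain ⟨n₅, m₅⟩ := Set.mem_iUnion.1 hp
    obtain ⟨n₆, m₆⟩ := Set.mem_iUnion.1 hq
    obtain ⟨n₇, m₇⟩ := Set.mem_iUnion.1 hp'
    obtain ⟨n₈, m₈⟩ := Set.mem_iUnion.1 hq'
    have le (m) (hm : m ≤ n₁ + n₂ + n₃ + n₄ + n₅ + n₆ + n₇ + n₈) := hmono hm
    let t : I₄ (M (n₁ + n₂ + n₃ + n₄ + n₅ + n₆ + n₇ + n₈)) :=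
      ⟨⟨o a, le _ (by lia) m₁⟩, ⟨o b, le _ (by lia) m₂⟩, ⟨o k, le _ (by lia) m₃⟩,
        ⟨o k', le _ (by lia) m₄⟩, (⟨p, le _ (by lia) m₅⟩, ⟨q, le _ (by lia) m₆⟩),
        (⟨p', le _ (by lia) m₇⟩, ⟨q', le _ (by lia) m₈⟩)⟩
    exact exists_c _ (hM₄ t 0) (fun X => ∃ α : o a ⟶ X, Arrow.mk α ∈ ⋃ n, M n ∧
      ∃ β : o b ⟶ X, Arrow.mk β ∈ ⋃ n, M n ∧ ∃ u : X ⟶ o k, Arrow.mk u ∈ ⋃ n, M n ∧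
      ∃ u' : X ⟶ o k', Arrow.mk u' ∈ ⋃ n, M n ∧
        α ≫ u = p ∧ β ≫ u = q ∧ α ≫ u' = p' ∧ β ≫ u' = q')
      ⟨_, hM₄ t 1, _, hM₄ t 2, _, hM₄ t 3, _, hM₄ t 4, h₁ _ _ _ _ _ _ _ _, h₂ _ _ _ _ _ _ _ _,
        h₃ _ _ _ _ _ _ _ _, h₄ _ _ _ _ _ _ _ _⟩

end SiftedSubcategory

section Restriction

variable {C : Type u} [Category.{v} C]

/-- The restriction of a section of a presheaf along a morphism. -/
def presheafRes (P : Cᵒᵖ ⥤ Type v) {A B : C} (f : A ⟶ B) (x : P.obj (Opposite.op B)) :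
    P.obj (Opposite.op A) :=
  P.map f.op x

theorem presheafRes_comp (P : Cᵒᵖ ⥤ Type v) {A B D : C} (f : A ⟶ B) (g : B ⟶ D)
    (x : P.obj (Opposite.op D)) :
    presheafRes P (f ≫ g) x = presheafRes P f (presheafRes P g x) := by
  simp [presheafRes]

theorem app_presheafRes {P Q : Cᵒᵖ ⥤ Type v} (φ : P ⟶ Q) {A B : C} (f : A ⟶ B)
    (x : P.obj (Opposite.op B)) :
    φ.app _ (presheafRes P f x) = presheafRes Q f (φ.app _ x) :=
  NatTrans.naturality_apply φ f.op x

theorem presheafRes_yoneda {X A B : C} (f : A ⟶ B)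
    (x : (yoneda.obj X).obj (Opposite.op B)) :
    presheafRes (yoneda.obj X) f x = f ≫ (show B ⟶ X from x) := rfl

end Restriction

section PresheafConditions

variable {C : Type u} [Category.{v} C]

/-- A relation between generalized elements of `A` and of `B` is `κ`-generated if it is the
relation of factoring through one of fewer than `κ` spans between `A` and `B`. -/
def CardGenerated (κ : Cardinal.{v}) {A B : C} (ρ : ∀ D : C, (D ⟶ A) → (D ⟶ B) → Prop) : Prop :=
  ∃ (ι : Type v) (_ : HasCardinalLT ι κ) (S : ι → C) (p : ∀ i, S i ⟶ A) (q : ∀ i, S i ⟶ B),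
    ∀ (D : C) (f : D ⟶ A) (g : D ⟶ B), ρ D f g ↔ ∃ (i : ι) (r : D ⟶ S i), r ≫ p i = f ∧ r ≫ q i = g

/-- The presheaf `P` is covered by fewer than `κ` representables. -/
def CardCovered (κ : Cardinal.{v}) (P : Cᵒᵖ ⥤ Type v) : Prop :=
  ∃ (ι : Type v) (_ : HasCardinalLT ι κ) (G : ι → C) (g : ∀ i, P.obj (Opposite.op (G i))),
    ∀ (D : C) (x : P.obj (Opposite.op D)), ∃ (i : ι) (r : D ⟶ G i), presheafRes P r (g i) = x

/-- Fiber products of representables over the presheaf `P` are covered by fewer than `κ`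
representables. -/
def CardSeparated (κ : Cardinal.{v}) (P : Cᵒᵖ ⥤ Type v) : Prop :=
  ∀ (A B : C) (a : P.obj (Opposite.op A)) (b : P.obj (Opposite.op B)),
    CardGenerated κ fun _ f g => presheafRes P f a = presheafRes P g b

/-- In the category of elements of `P`, every `I`-indexed family has a cocone, and any two such
cocones with the same sections are joined by a span. -/
def SiftedAt (I : Type) (P : Cᵒᵖ ⥤ Type v) : Prop :=
  (∀ (A : I → C) (x : ∀ i, P.obj (Opposite.op (A i))),
    ∃ (K : C) (z : P.obj (Opposite.op K)) (f : ∀ i, A i ⟶ K), ∀ i, presheafRes P (f i) z = x i) ∧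
  ∀ (A : I → C) (K K' : C) (z : P.obj (Opposite.op K)) (z' : P.obj (Opposite.op K'))
    (f : ∀ i, A i ⟶ K) (f' : ∀ i, A i ⟶ K'),
    (∀ i, presheafRes P (f i) z = presheafRes P (f' i) z') →
    ∃ (S : C) (s : S ⟶ K) (s' : S ⟶ K') (t : ∀ i, A i ⟶ S),
      presheafRes P s z = presheafRes P s' z' ∧ ∀ i, t i ≫ s = f i ∧ t i ≫ s' = f' i

/-- The conditions characterizing `κ`-small sifted colimits of representables. -/
structure CardSifted (κ : Cardinal.{v}) (P : Cᵒᵖ ⥤ Type v) : Prop where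
  covered : CardCovered κ P
  separated : CardSeparated κ P
  nonempty : ∃ A : C, Nonempty (P.obj (Opposite.op A))
  sifted : SiftedAt Bool P

theorem SiftedAt.pempty [HasPullbacks C] {P : Cᵒᵖ ⥤ Type v} (h : SiftedAt Bool P)
    (hne : ∃ A : C, Nonempty (P.obj (Opposite.op A))) : SiftedAt PEmpty P := by
  constructor
  · intro A x
    obtain ⟨K, ⟨z⟩⟩ := hne
    exact ⟨K, z, fun i => i.elim, fun i => i.elim⟩
  · intro A K K' z z' f f' _
    obtain ⟨L, w, g, hg⟩ := h.1 (fun b => Bool.rec K K' b) (fun b => Bool.rec z z' b)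
    have h₁ := hg false
    have h₂ := hg true
    dsimp only at h₁ h₂
    refine ⟨pullback (g false) (g true), pullback.fst _ _, pullback.snd _ _, fun i => i.elim, ?_,
      fun i => i.elim⟩
    rw [← h₁, ← h₂, ← presheafRes_comp, ← presheafRes_comp, pullback.condition]

theorem CardSeparated.of_iso {κ : Cardinal.{v}} {P Q : Cᵒᵖ ⥤ Type v} (e : P ≅ Q)
    (h : CardSeparated κ P) : CardSeparated κ Q := by
  intro A B a b
  convert h A B (e.inv.app _ a) (e.inv.app _ b) using 4 with D f g
  rw [← app_presheafRes, ← app_presheafRes]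
  exact ((e.app _).toEquiv.symm.injective.eq_iff).symm

theorem SiftedAt.of_iso {I : Type} {P Q : Cᵒᵖ ⥤ Type v} (e : P ≅ Q) (h : SiftedAt I P) :
    SiftedAt I Q := by
  have hinv {A : C} (x : Q.obj (Opposite.op A)) : e.hom.app _ (e.inv.app _ x) = x :=
    (e.app _).toEquiv.apply_symm_apply x
  constructor
  · intro A x
    obtain ⟨K, z, f, hf⟩ := h.1 A fun i => e.inv.app _ (x i)
    refine ⟨K, e.hom.app _ z, f, fun i => ?_⟩
    rw [← app_presheafRes, hf, hinv]
  · intro A K K' z z' f f' hff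
    obtain ⟨S, s, s', t, hs, ht⟩ := h.2 A K K' (e.inv.app _ z) (e.inv.app _ z') f f' fun i => by
      rw [← app_presheafRes, ← app_presheafRes, hff]
    refine ⟨S, s, s', t, ?_, ht⟩
    rw [← app_presheafRes, ← app_presheafRes] at hs
    simpa [hinv] using congrArg (e.hom.app _) hs

theorem CardSifted.of_iso {κ : Cardinal.{v}} {P Q : Cᵒᵖ ⥤ Type v} (e : P ≅ Q)
    (h : CardSifted κ P) : CardSifted κ Q where
  covered := by
    obtain ⟨ι, hι, G, g, hg⟩ := h.covered
    refine ⟨ι, hι, G, fun i => e.hom.app _ (g i), fun D x => ?_⟩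
    obtain ⟨i, r, hr⟩ := hg D (e.inv.app _ x)
    refine ⟨i, r, ?_⟩
    rw [← app_presheafRes, hr]
    exact (e.app _).toEquiv.apply_symm_apply x
  separated := h.separated.of_iso e
  nonempty := by
    obtain ⟨A, ⟨a⟩⟩ := h.nonempty
    exact ⟨A, ⟨e.hom.app _ a⟩⟩
  sifted := h.sifted.of_iso e

theorem cardSifted_yoneda [HasPullbacks C] {κ : Cardinal.{v}} (hκ : Cardinal.aleph0 ≤ κ) (X : C) :
    CardSifted κ (yoneda.obj X) where
  covered := ⟨PUnit, hasCardinalLT_of_finite _ _ hκ, fun _ => X, fun _ => 𝟙 X,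
    fun D x => ⟨⟨⟩, x, Category.comp_id _⟩⟩
  separated := by
    intro A B a b
    refine ⟨PUnit, hasCardinalLT_of_finite _ _ hκ, fun _ => pullback (show A ⟶ X from a) b,
      fun _ => pullback.fst _ _, fun _ => pullback.snd _ _, fun D f g => ⟨fun h => ?_, ?_⟩⟩
    · exact ⟨⟨⟩, pullback.lift f g h, pullback.lift_fst _ _ _, pullback.lift_snd _ _ _⟩
    · rintro ⟨-, r, rfl, rfl⟩
      simp only [presheafRes_yoneda, Category.assoc]
      exact congrArg _ pullback.condition
  nonempty := ⟨X, ⟨𝟙 X⟩⟩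
  sifted := by
    constructor
    · exact fun A x => ⟨X, 𝟙 X, fun i => x i, fun i => Category.comp_id _⟩
    · intro A K K' z z' f f' hf
      exact ⟨pullback (show K ⟶ X from z) z', pullback.fst _ _, pullback.snd _ _,
        fun i => pullback.lift (f i) (f' i) (hf i), pullback.condition,
        fun i => ⟨pullback.lift_fst _ _ _, pullback.lift_snd _ _ _⟩⟩

end PresheafConditions

section SiftedPresentation

variable {C : Type u} [Category.{v} C]

theorem exists_costructuredArrow_hom {P : Cᵒᵖ ⥤ Type v} {a b : CostructuredArrow yoneda P}
    (f : a.left ⟶ b.left) (h : presheafRes P f (yonedaEquiv b.hom) = yonedaEquiv a.hom) :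
    ∃ g : a ⟶ b, g.left = f :=
  ⟨CostructuredArrow.homMk f (yonedaEquiv.injective (by
    rw [← h]; exact (yonedaEquiv_naturality _ _).symm)), rfl⟩

theorem presheafRes_costructuredArrow_hom {P : Cᵒᵖ ⥤ Type v} {a b : CostructuredArrow yoneda P}
    (g : a ⟶ b) : presheafRes P g.left (yonedaEquiv b.hom) = yonedaEquiv a.hom := by
  rw [← CostructuredArrow.w g]
  exact yonedaEquiv_naturality _ _

/-- A presheaf satisfying `CardSifted` is a `κ`-small sifted colimit of representables. -/
theorem CardSifted.mem_of_sindClosed {κ : Cardinal.{v}} (hκ : κ.IsRegular)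
    (huncount : Cardinal.aleph0 < κ) {P : Cᵒᵖ ⥤ Type v} (h : CardSifted κ P)
    {T : Set (Cᵒᵖ ⥤ Type v)} (hT : SindClosed κ T) : P ∈ T := by
  let mk {A : C} (x : P.obj (Opposite.op A)) : CostructuredArrow yoneda P :=
    CostructuredArrow.mk (yonedaEquiv.symm x)
  have hmk {A : C} (x : P.obj (Opposite.op A)) : yonedaEquiv (mk x).hom = x :=
    yonedaEquiv.apply_symm_apply x
  have : Nonempty (CostructuredArrow yoneda P) := by
    obtain ⟨A, ⟨a⟩⟩ := h.nonempty
    exact ⟨mk a⟩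
  obtain ⟨J, _, Φ, hJ, hΦ, hcard⟩ := exists_final_functor_of_cardSmall_sifted
    (E := CostructuredArrow yoneda P) hκ huncount
    (by
      obtain ⟨ι, hι, G, g, hg⟩ := h.covered
      refine ⟨ι, hι, fun i => mk (g i), fun e => ?_⟩
      obtain ⟨i, r, hr⟩ := hg e.left (yonedaEquiv e.hom)
      obtain ⟨f, -⟩ := exists_costructuredArrow_hom (a := e) (b := mk (g i)) r (by rw [hmk, hr])
      exact ⟨i, ⟨f⟩⟩)
    (by
      intro a b
      obtain ⟨ι, hι, S, p, q, hS⟩ := h.separated a.left b.left (yonedaEquiv a.hom)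
        (yonedaEquiv b.hom)
      have hpq (i) := (hS (S i) (p i) (q i)).2 ⟨i, 𝟙 _, by simp, by simp⟩
      have hp (i : ι) := exists_costructuredArrow_hom
        (a := mk (presheafRes P (p i) (yonedaEquiv a.hom))) (b := a) (p i) (by rw [hmk])
      have hq (i : ι) := exists_costructuredArrow_hom
        (a := mk (presheafRes P (p i) (yonedaEquiv a.hom))) (b := b) (q i)
        (by rw [hmk, hpq])
      choose p' hp' using hp
      choose q' hq' using hq
      refine ⟨ι, hι, _, p', q', fun e f g => ?_⟩
      obtain ⟨i, r, hr₁, hr₂⟩ := (hS _ f.left g.left).1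
        ((presheafRes_costructuredArrow_hom f).trans (presheafRes_costructuredArrow_hom g).symm)
      obtain ⟨r', hr'⟩ := exists_costructuredArrow_hom (a := e)
        (b := mk (presheafRes P (p i) (yonedaEquiv a.hom))) r (by
          rw [hmk, ← presheafRes_comp, hr₁, presheafRes_costructuredArrow_hom])
      refine ⟨i, r', ?_, ?_⟩
      · ext
        rw [CostructuredArrow.comp_left, hr', hp', hr₁]
      · ext
        rw [CostructuredArrow.comp_left, hr', hq', hr₂])
    (by
      intro a b
      obtain ⟨K, z, f, hf⟩ := h.sifted.1 (fun i => Bool.rec a.left b.left i)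
        (fun i => Bool.rec (yonedaEquiv a.hom) (yonedaEquiv b.hom) i)
      obtain ⟨f₁, -⟩ := exists_costructuredArrow_hom (a := a) (b := mk z) (f false)
        (by rw [hmk]; exact hf false)
      obtain ⟨f₂, -⟩ := exists_costructuredArrow_hom (a := b) (b := mk z) (f true)
        (by rw [hmk]; exact hf true)
      exact ⟨mk z, ⟨f₁⟩, ⟨f₂⟩⟩)
    (by
      intro a b k k' p q p' q'
      obtain ⟨S, s, s', t, hs, ht⟩ := h.sifted.2 (fun i => Bool.rec a.left b.left i)
        k.left k'.left (yonedaEquiv k.hom) (yonedaEquiv k'.hom)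
        (fun i => Bool.rec p.left q.left i) (fun i => Bool.rec p'.left q'.left i) (by
          rintro (_ | _)
          · exact (presheafRes_costructuredArrow_hom p).trans
              (presheafRes_costructuredArrow_hom p').symm
          · exact (presheafRes_costructuredArrow_hom q).trans
              (presheafRes_costructuredArrow_hom q').symm)
      have h₁ := (ht false).1
      have h₂ := (ht true).1
      have h₃ := (ht false).2
      have h₄ := (ht true).2
      dsimp only at h₁ h₂ h₃ h₄
      let σ := mk (presheafRes P s (yonedaEquiv k.hom))
      obtain ⟨α, hα⟩ := exists_costructuredArrow_hom (a := a) (b := σ) (t false) (by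
        rw [hmk, ← presheafRes_comp, h₁, presheafRes_costructuredArrow_hom])
      obtain ⟨β, hβ⟩ := exists_costructuredArrow_hom (a := b) (b := σ) (t true) (by
        rw [hmk, ← presheafRes_comp, h₂, presheafRes_costructuredArrow_hom])
      obtain ⟨u, hu⟩ := exists_costructuredArrow_hom (a := σ) (b := k) s (by rw [hmk])
      obtain ⟨u', hu'⟩ := exists_costructuredArrow_hom (a := σ) (b := k') s' (by rw [hmk, hs])
      refine ⟨σ, α, β, u, u', ?_, ?_, ?_, ?_⟩
      · ext; rw [CostructuredArrow.comp_left, hα, hu, h₁]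
      · ext; rw [CostructuredArrow.comp_left, hβ, hu, h₂]
      · ext; rw [CostructuredArrow.comp_left, hα, hu', h₃]
      · ext; rw [CostructuredArrow.comp_left, hβ, hu', h₄])
  exact hT.2.2 J hJ hcard _ _
    ((Functor.Final.isColimitWhiskerEquiv Φ _).symm (Presheaf.isColimitTautologicalCocone P))
    fun j => hT.1 _

end SiftedPresentation

section CardinalArithmetic

theorem CardLL.hasCardinalLT {lam κ : Cardinal.{v}} (hll : CardLL lam κ)
    (huncount : Cardinal.aleph0 < κ) {X : Type v} (hX : HasCardinalLT X lam) :
    HasCardinalLT X κ := by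
  rw [hasCardinalLT_iff_cardinal_mk_lt] at hX ⊢
  exact (Cardinal.cantor _).trans
    (hll _ hX 2 ((Cardinal.natCast_lt_aleph0 (n := 2)).trans huncount))

theorem CardLL.hasCardinalLT_pi {lam κ : Cardinal.{v}} (hll : CardLL lam κ) (hκ : κ.IsRegular)
    (huncount : Cardinal.aleph0 < κ) {X : Type v} (hX : HasCardinalLT X lam) (ι : X → Type v)
    (hι : ∀ x, HasCardinalLT (ι x) κ) : HasCardinalLT (∀ x, ι x) κ := by
  have : Fact κ.IsRegular := ⟨hκ⟩
  have hσ := hasCardinalLT_sigma ι κ (hll.hasCardinalLT huncount hX) hι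
  have : HasCardinalLT (X → Σ x, ι x) κ := by
    rw [hasCardinalLT_iff_cardinal_mk_lt] at hX hσ ⊢
    simpa using hll _ hX _ hσ
  refine this.of_injective (fun f x => ⟨x, f x⟩) fun f g h => funext fun x => ?_
  simpa using congrFun h x

end CardinalArithmetic

section SmallLimits

variable {C : Type u} [Category.{v} C]

theorem hasFiniteLimits_of_hasCardSmallLimits {lam : Cardinal.{v}} (hlam : Cardinal.aleph0 ≤ lam)
    (hlims : ∀ (J : Type v) [SmallCategory J], IsCardSmallCat J lam → HasLimitsOfShape J C) :
    HasFiniteLimits C := by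
  refine hasFiniteLimits_of_hasFiniteLimits_of_size.{v} C fun J _ _ => hlims J ⟨?_, ?_⟩
  · exact hasCardinalLT_of_finite _ _ hlam
  · have : Finite (Arrow J) := Finite.of_surjective
      (fun t : Σ (a b : J), (a ⟶ b) => Arrow.mk t.2.2) fun f => ⟨⟨f.left, f.right, f.hom⟩, rfl⟩
    exact hasCardinalLT_of_finite _ _ hlam

theorem hasProductsOfShape_of_hasCardSmallLimits {lam : Cardinal.{v}}
    (hlims : ∀ (J : Type v) [SmallCategory J], IsCardSmallCat J lam → HasLimitsOfShape J C)
    {X : Type v} (hX : HasCardinalLT X lam) : HasProductsOfShape X C := by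
  refine hlims (Discrete X) ⟨?_, ?_⟩
  · exact hX.of_surjective Discrete.mk fun x => ⟨x.as, rfl⟩
  · refine hX.of_surjective (fun x => Arrow.mk (𝟙 (Discrete.mk x))) ?_
    rintro ⟨⟨a⟩, ⟨b⟩, ⟨⟨h⟩⟩⟩
    obtain rfl : a = b := h
    exact ⟨a, rfl⟩

theorem exists_widePullback [HasFiniteLimits C] {X : Type v} [HasProductsOfShape X C] (B : C)
    (S : X → C) (s : ∀ x, S x ⟶ B) :
    ∃ (W : C) (w : W ⟶ B) (π : ∀ x, W ⟶ S x), (∀ x, π x ≫ s x = w) ∧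
      ∀ (D : C) (t : D ⟶ B) (t' : ∀ x, D ⟶ S x), (∀ x, t' x ≫ s x = t) →
        ∃ r : D ⟶ W, r ≫ w = t ∧ ∀ x, r ≫ π x = t' x := by
  let a : (∏ᶜ S) ⨯ B ⟶ ∏ᶜ fun _ : X => B := Pi.lift fun x => prod.fst ≫ Pi.π S x ≫ s x
  let b : (∏ᶜ S) ⨯ B ⟶ ∏ᶜ fun _ : X => B := Pi.lift fun _ => prod.snd
  refine ⟨equalizer a b, equalizer.ι a b ≫ prod.snd,
    fun x => equalizer.ι a b ≫ prod.fst ≫ Pi.π S x, fun x => ?_, fun D t t' h => ?_⟩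
  · have := congrArg (· ≫ Pi.π (fun _ : X => B) x) (equalizer.condition a b)
    simpa [a, b] using this
  · refine ⟨equalizer.lift (prod.lift (Pi.lift t') t) ?_, ?_, fun x => ?_⟩
    · refine Pi.hom_ext _ _ fun x => ?_
      simp only [a, b, Category.assoc, Pi.lift_π, prod.lift_fst_assoc, prod.lift_snd]
      rw [Pi.lift_π_assoc, h]
    · rw [equalizer.lift_ι_assoc, prod.lift_snd]
    · rw [equalizer.lift_ι_assoc, prod.lift_fst_assoc, Pi.lift_π]

end SmallLimits

section CardGenerated

variable {C : Type u} [Category.{v} C] {κ : Cardinal.{v}}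

theorem cardGenerated_diagonal (hκ : Cardinal.aleph0 ≤ κ) (A : C) :
    CardGenerated κ (A := A) (B := A) fun _ f g => f = g := by
  refine ⟨PUnit, hasCardinalLT_of_finite _ _ hκ, fun _ => A, fun _ => 𝟙 A, fun _ => 𝟙 A,
    fun D f g => ?_⟩
  simp

theorem CardGenerated.comp [HasPullbacks C] (hκ : Cardinal.aleph0 ≤ κ) {A B E : C}
    {ρ : ∀ D : C, (D ⟶ A) → (D ⟶ B) → Prop} {σ : ∀ D : C, (D ⟶ B) → (D ⟶ E) → Prop}
    (hρ : CardGenerated κ ρ) (hσ : CardGenerated κ σ) :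
    CardGenerated κ fun D f h => ∃ g : D ⟶ B, ρ D f g ∧ σ D g h := by
  obtain ⟨ι, hι, S, p, q, hS⟩ := hρ
  obtain ⟨ι', hι', S', p', q', hS'⟩ := hσ
  refine ⟨ι × ι', hasCardinalLT_prod hκ hι hι', fun i => pullback (q i.1) (p' i.2),
    fun i => pullback.fst _ _ ≫ p i.1, fun i => pullback.snd _ _ ≫ q' i.2, fun D f h => ⟨?_, ?_⟩⟩
  · rintro ⟨g, h₁, h₂⟩
    obtain ⟨i, r, rfl, hr⟩ := (hS _ _ _).1 h₁
    obtain ⟨i', r', hr', rfl⟩ := (hS' _ _ _).1 h₂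
    exact ⟨(i, i'), pullback.lift r r' (hr.trans hr'.symm),
      pullback.lift_fst_assoc _ _ _ _, pullback.lift_snd_assoc _ _ _ _⟩
  · rintro ⟨⟨i, i'⟩, r, rfl, rfl⟩
    refine ⟨r ≫ pullback.fst _ _ ≫ q i, (hS _ _ _).2 ⟨i, r ≫ pullback.fst _ _, by simp, by simp⟩,
      (hS' _ _ _).2 ⟨i', r ≫ pullback.snd _ _, ?_, by simp⟩⟩
    rw [Category.assoc, pullback.condition]

theorem CardGenerated.iUnion (hκ : κ.IsRegular) {A B : C} {X : Type v} (hX : HasCardinalLT X κ)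
    {ρ : X → ∀ D : C, (D ⟶ A) → (D ⟶ B) → Prop} (hρ : ∀ x, CardGenerated κ (ρ x)) :
    CardGenerated κ fun D f g => ∃ x, ρ x D f g := by
  have : Fact κ.IsRegular := ⟨hκ⟩
  choose ι hι S p q hS using hρ
  refine ⟨Σ x, ι x, hasCardinalLT_sigma _ _ hX hι, fun i => S i.1 i.2, fun i => p i.1 i.2,
    fun i => q i.1 i.2, fun D f g => ⟨?_, ?_⟩⟩
  · rintro ⟨x, h⟩
    obtain ⟨i, h⟩ := (hS _ _ _ _).1 h
    exact ⟨⟨x, i⟩, h⟩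
  · rintro ⟨⟨x, i⟩, h⟩
    exact ⟨x, (hS _ _ _ _).2 ⟨i, h⟩⟩

theorem CardGenerated.or (hκ : κ.IsRegular) {A B : C}
    {ρ σ : ∀ D : C, (D ⟶ A) → (D ⟶ B) → Prop} (hρ : CardGenerated κ ρ) (hσ : CardGenerated κ σ) :
    CardGenerated κ fun D f g => ρ D f g ∨ σ D f g := by
  have := CardGenerated.iUnion hκ (X := ULift Bool) (hasCardinalLT_of_finite _ _ hκ.aleph0_le)
    (ρ := fun b => Bool.rec ρ σ b.down) (by rintro ⟨_ | _⟩; exacts [hρ, hσ])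
  convert this using 4
  simp

theorem CardGenerated.iInter [HasFiniteLimits C] {X : Type v} [HasProductsOfShape X C] {A B : C}
    {ρ : X → ∀ D : C, (D ⟶ A) → (D ⟶ B) → Prop} (hρ : ∀ x, CardGenerated κ (ρ x))
    (hpi : ∀ ι : X → Type v, (∀ x, HasCardinalLT (ι x) κ) → HasCardinalLT (∀ x, ι x) κ) :
    CardGenerated κ fun D f g => ∀ x, ρ x D f g := by
  choose ι hι S p q hS using hρ
  have hW (φ : ∀ x, ι x) := exists_widePullback (A ⨯ B) (fun x => S x (φ x))
    (fun x => prod.lift (p x (φ x)) (q x (φ x)))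
  choose W w π hπ hW using hW
  refine ⟨∀ x, ι x, hpi _ hι, W, fun φ => w φ ≫ prod.fst, fun φ => w φ ≫ prod.snd,
    fun D f g => ⟨fun h => ?_, ?_⟩⟩
  · choose φ r h₁ h₂ using fun x => (hS _ _ _ _).1 (h x)
    obtain ⟨s, hs, -⟩ := hW φ D (prod.lift f g) r fun x => by ext <;> simp [h₁, h₂]
    exact ⟨φ, s, by rw [← Category.assoc, hs, prod.lift_fst],
      by rw [← Category.assoc, hs, prod.lift_snd]⟩
  · rintro ⟨φ, r, rfl, rfl⟩ x
    exact (hS _ _ _ _).2 ⟨φ x, r ≫ π φ x,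
      by dsimp only; rw [← hπ φ x, Category.assoc, Category.assoc, prod.lift_fst],
      by dsimp only; rw [← hπ φ x, Category.assoc, Category.assoc, prod.lift_snd]⟩

theorem CardGenerated.and [HasPullbacks C] [HasBinaryProducts C] (hκ : Cardinal.aleph0 ≤ κ)
    {A B : C} {ρ σ : ∀ D : C, (D ⟶ A) → (D ⟶ B) → Prop}
    (hρ : CardGenerated κ ρ) (hσ : CardGenerated κ σ) :
    CardGenerated κ fun D f g => ρ D f g ∧ σ D f g := by
  obtain ⟨ι, hι, S, p, q, hS⟩ := hρ
  obtain ⟨ι', hι', S', p', q', hS'⟩ := hσ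
  refine ⟨ι × ι', hasCardinalLT_prod hκ hι hι',
    fun i => pullback (prod.lift (p i.1) (q i.1)) (prod.lift (p' i.2) (q' i.2)),
    fun i => pullback.fst _ _ ≫ p i.1, fun i => pullback.fst _ _ ≫ q i.1, fun D f g => ⟨?_, ?_⟩⟩
  · rintro ⟨h₁, h₂⟩
    obtain ⟨i, r, rfl, rfl⟩ := (hS _ _ _).1 h₁
    obtain ⟨i', r', h₃, h₄⟩ := (hS' _ _ _).1 h₂
    exact ⟨(i, i'), pullback.lift r r' (by ext <;> simp [h₃, h₄]),
      pullback.lift_fst_assoc _ _ _ _, pullback.lift_fst_assoc _ _ _ _⟩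
  · rintro ⟨⟨i, i'⟩, r, rfl, rfl⟩
    have h := pullback.condition (f := prod.lift (p i) (q i)) (g := prod.lift (p' i') (q' i'))
    have h₁ := congrArg (· ≫ prod.fst) h
    have h₂ := congrArg (· ≫ prod.snd) h
    simp only [Category.assoc, prod.lift_fst, prod.lift_snd] at h₁ h₂
    exact ⟨(hS _ _ _).2 ⟨i, r ≫ pullback.fst _ _, by simp, by simp⟩,
      (hS' _ _ _).2 ⟨i', r ≫ pullback.snd _ _, by simp [h₁], by simp [h₂]⟩⟩

end CardGenerated

section LimitClosure

variable {C : Type u} [Category.{v} C] {J : Type v} [SmallCategory J] {F : J ⥤ Cᵒᵖ ⥤ Type v}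
  {c : Cone F}

theorem existsUnique_section_of_isLimit (hc : IsLimit c) {A : C}
    (x : ∀ j, (F.obj j).obj (Opposite.op A))
    (hx : ∀ {j j' : J} (u : j ⟶ j'), (F.map u).app _ (x j) = x j') :
    ∃! y : c.pt.obj (Opposite.op A), ∀ j, (c.π.app j).app _ y = x j :=
  (Types.isLimit_iff _).1
    ⟨isLimitOfPreserves ((evaluation Cᵒᵖ (Type v)).obj (Opposite.op A)) hc⟩ x fun u => hx u

theorem section_ext_of_isLimit (hc : IsLimit c) {A : C} {x y : c.pt.obj (Opposite.op A)}
    (h : ∀ j, (c.π.app j).app _ x = (c.π.app j).app _ y) : x = y := by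
  refine (existsUnique_section_of_isLimit hc (fun j => (c.π.app j).app _ y) fun {j j'} u => ?_).unique
    h fun _ => rfl
  rw [← c.w u]
  rfl

theorem cone_app_naturality {j j' : J} (u : j ⟶ j') {A : C} (x : c.pt.obj (Opposite.op A)) :
    (F.map u).app _ ((c.π.app j).app _ x) = (c.π.app j').app _ x := by
  rw [← c.w u]
  rfl

theorem cone_app_presheafRes {A B : C} (f : A ⟶ B) (x : c.pt.obj (Opposite.op B)) (j : J) :
    (c.π.app j).app _ (presheafRes c.pt f x) = presheafRes (F.obj j) f ((c.π.app j).app _ x) :=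
  app_presheafRes (c.π.app j) f x

theorem CardSeparated.of_isLimit [HasFiniteLimits C] [HasProductsOfShape J C] {κ : Cardinal.{v}}
    (hpi : ∀ ι : J → Type v, (∀ j, HasCardinalLT (ι j) κ) → HasCardinalLT (∀ j, ι j) κ)
    (hc : IsLimit c) (hF : ∀ j, CardSeparated κ (F.obj j)) : CardSeparated κ c.pt := by
  intro A B a b
  convert CardGenerated.iInter
    (fun j => hF j A B ((c.π.app j).app _ a) ((c.π.app j).app _ b)) hpi using 4 with D f g
  simp only [← cone_app_presheafRes]
  exact ⟨fun h j => by rw [h], section_ext_of_isLimit hc⟩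

theorem CardCovered.of_isLimit [HasFiniteLimits C] [HasProductsOfShape J C]
    [HasProductsOfShape (Arrow J) C] {κ : Cardinal.{v}} (hκ : κ.IsRegular)
    (hpi : ∀ ι : J → Type v, (∀ j, HasCardinalLT (ι j) κ) → HasCardinalLT (∀ j, ι j) κ)
    (hpi' : ∀ ι : Arrow J → Type v, (∀ j, HasCardinalLT (ι j) κ) → HasCardinalLT (∀ j, ι j) κ)
    (hc : IsLimit c) (hF : ∀ j, CardCovered κ (F.obj j)) (hF' : ∀ j, CardSeparated κ (F.obj j)) :
    CardCovered κ c.pt := by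
  have : Fact κ.IsRegular := ⟨hκ⟩
  choose ι hι G g hG using hF
  let z (φ : ∀ j, ι j) (j : J) : (F.obj j).obj (Opposite.op (∏ᶜ fun j => G j (φ j))) :=
    presheafRes _ (Pi.π _ j) (g j (φ j))
  have hz (φ : ∀ j, ι j) : CardGenerated κ (A := ∏ᶜ fun j => G j (φ j))
      (B := ∏ᶜ fun j => G j (φ j)) fun D s t => s = t ∧ ∀ u : Arrow J,
        presheafRes _ s ((F.map u.hom).app _ (z φ u.left)) = presheafRes _ t (z φ u.right) :=
    (cardGenerated_diagonal hκ.aleph0_le _).and hκ.aleph0_le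
      (CardGenerated.iInter (fun u : Arrow J => hF' u.right _ _ _ _) hpi')
  choose ι' hι' S p q hS using hz
  have hpq (φ) (i : ι' φ) := (hS φ (S φ i) (p φ i) (q φ i)).2 ⟨i, 𝟙 _, by simp, by simp⟩
  choose y hy _ using fun t : Σ φ, ι' φ => existsUnique_section_of_isLimit hc
    (fun j => presheafRes _ (p t.1 t.2) (z t.1 j)) (fun {j j'} u => by
      rw [app_presheafRes]
      exact ((hpq t.1 t.2).2 (Arrow.mk u)).trans (by rw [← (hpq t.1 t.2).1]; rfl))
  refine ⟨Σ φ, ι' φ, hasCardinalLT_sigma _ _ (hpi _ hι) hι', fun t => S t.1 t.2, y, fun D x => ?_⟩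
  choose φ r hr using fun j => hG j D ((c.π.app j).app _ x)
  have hr' (j) : presheafRes _ (Pi.lift r) (z φ j) = (c.π.app j).app _ x := by
    rw [← presheafRes_comp, Pi.lift_π, hr]
  obtain ⟨i, t, ht, -⟩ := (hS φ D (Pi.lift r) (Pi.lift r)).1 ⟨rfl, fun u => by
    rw [← app_presheafRes, hr', hr', cone_app_naturality]⟩
  refine ⟨⟨φ, i⟩, t, section_ext_of_isLimit hc fun j => ?_⟩
  rw [cone_app_presheafRes, hy, ← presheafRes_comp, ht, hr']

theorem SiftedAt.of_isLimit [HasFiniteLimits C] [HasProductsOfShape J C]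
    [HasProductsOfShape (Arrow J) C] {I : Type} (hc : IsLimit c)
    (hF : ∀ j, SiftedAt I (F.obj j)) : SiftedAt I c.pt := by
  constructor
  · intro A x
    choose K z f hf using fun j => (hF j).1 A fun i => (c.π.app j).app _ (x i)
    let Z (j : J) : (F.obj j).obj (Opposite.op (∏ᶜ K)) := presheafRes _ (Pi.π K j) (z j)
    have hZ (i j) : presheafRes _ (Pi.lift fun j => f j i) (Z j) = (c.π.app j).app _ (x i) := by
      rw [← presheafRes_comp, Pi.lift_π, hf]
    choose S s s' t hs ht using fun u : Arrow J => (hF u.right).2 A (∏ᶜ K) (∏ᶜ K)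
      ((F.map u.hom).app _ (Z u.left)) (Z u.right) (fun i => Pi.lift fun j => f j i)
      (fun i => Pi.lift fun j => f j i) fun i => by
        rw [← app_presheafRes, hZ, hZ, cone_app_naturality]
    obtain ⟨W, w, π, hπ, hW⟩ := exists_widePullback (∏ᶜ K) (fun u => equalizer (s u) (s' u))
      fun u => equalizer.ι _ _ ≫ s u
    obtain ⟨y, hy, -⟩ := existsUnique_section_of_isLimit hc (fun j => presheafRes _ w (Z j))
      fun {j j'} u => by
        have h := hs (Arrow.mk u)
        dsimp only [Arrow.mk_left, Arrow.mk_right, Arrow.mk_hom] at h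
        have h₁ := hπ (Arrow.mk u)
        have h₂ := h₁
        rw [equalizer.condition] at h₂
        rw [app_presheafRes]
        conv_lhs => rw [← h₁]
        conv_rhs => rw [← h₂]
        simp only [presheafRes_comp]
        exact congrArg _ (congrArg _ h)
    choose r hr _ using fun i => hW (A i) (Pi.lift fun j => f j i)
      (fun u => equalizer.lift (t u i) ((ht u i).1.trans (ht u i).2.symm)) fun u => by
        rw [equalizer.lift_ι_assoc, (ht u i).1]
    refine ⟨W, y, r, fun i => section_ext_of_isLimit hc fun j => ?_⟩
    rw [cone_app_presheafRes, hy, ← presheafRes_comp, hr, hZ]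
  · intro A K K' z z' f f' hff
    choose S s s' t hs ht using fun j => (hF j).2 A K K' ((c.π.app j).app _ z)
      ((c.π.app j).app _ z') f f' fun i => by
        rw [← cone_app_presheafRes, ← cone_app_presheafRes, hff]
    obtain ⟨W, w, π, hπ, hW⟩ := exists_widePullback (K ⨯ K') S fun j => prod.lift (s j) (s' j)
    choose r hr _ using fun i => hW (A i) (prod.lift (f i) (f' i)) (fun j => t j i) fun j => by
      ext <;> simp [ht]
    refine ⟨W, w ≫ prod.fst, w ≫ prod.snd, r, section_ext_of_isLimit hc fun j => ?_, fun i => ?_⟩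
    · rw [cone_app_presheafRes, cone_app_presheafRes, ← hπ j]
      simp only [Category.assoc, prod.lift_fst, prod.lift_snd]
      rw [presheafRes_comp, presheafRes_comp, hs]
    · rw [← Category.assoc, hr, ← Category.assoc, hr, prod.lift_fst, prod.lift_snd]
      exact ⟨rfl, rfl⟩

theorem CardSifted.of_isLimit {lam κ : Cardinal.{v}} (hlam : lam.IsRegular) (hκ : κ.IsRegular)
    (hll : CardLL lam κ) (huncount : Cardinal.aleph0 < κ)
    (hlims : ∀ (J : Type v) [SmallCategory J], IsCardSmallCat J lam → HasLimitsOfShape J C)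
    (hJ : IsCardSmallCat J lam) (hc : IsLimit c) (hF : ∀ j, CardSifted κ (F.obj j)) :
    CardSifted κ c.pt := by
  have := hasFiniteLimits_of_hasCardSmallLimits hlam.aleph0_le hlims
  have := hasProductsOfShape_of_hasCardSmallLimits hlims hJ.1
  have := hasProductsOfShape_of_hasCardSmallLimits hlims hJ.2
  have hpi := hll.hasCardinalLT_pi hκ huncount hJ.1
  have hpi' := hll.hasCardinalLT_pi hκ huncount hJ.2
  refine ⟨.of_isLimit hκ hpi hpi' hc (fun j => (hF j).covered) fun j => (hF j).separated,
    .of_isLimit hpi hc fun j => (hF j).separated, ?_, .of_isLimit hc fun j => (hF j).sifted⟩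
  obtain ⟨K, z, -⟩ := (SiftedAt.of_isLimit hc fun j =>
    (hF j).sifted.pempty (hF j).nonempty).1 PEmpty.elim fun i => i.elim
  exact ⟨K, ⟨z⟩⟩

end LimitClosure

section ColimitOfTypes

variable {K : Type v} [SmallCategory K]

theorem eq_of_isColimit_of_map_eq {H : K ⥤ Type v} {c : Cocone H} (hc : IsColimit c) {α : Type w}
    (φ : ∀ k, H.obj k → α) (hφ : ∀ {k k'} (u : k ⟶ k') (x : H.obj k), φ k' (H.map u x) = φ k x)
    {k k' : K} {x : H.obj k} {x' : H.obj k'} (h : c.ι.app k x = c.ι.app k' x') :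
    φ k x = φ k' x' := by
  let ψ (t : Σ k, H.obj k) : α := φ t.1 t.2
  let d : Cocone H :=
    { pt := Quotient (Setoid.ker ψ)
      ι :=
        { app := fun k => ↾fun x => Quotient.mk (Setoid.ker ψ) ⟨k, x⟩
          naturality := fun k k' u => by
            ext x
            exact Quotient.sound (hφ u x) } }
  have hd (k) (x : H.obj k) : hc.desc d (c.ι.app k x) = Quotient.mk (Setoid.ker ψ) ⟨k, x⟩ := by
    rw [← types_comp_apply, hc.fac]
    rfl
  have := congrArg (hc.desc d) h
  rw [hd, hd] at this
  exact Quotient.exact this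

variable [IsSifted K]

theorem exists_cospan_of_isSifted (k l : K) : ∃ m : K, Nonempty (k ⟶ m) ∧ Nonempty (l ⟶ m) := by
  have : IsConnected (StructuredArrow (k, l) (Functor.diag K)) := Functor.Final.out _
  obtain ⟨a⟩ := this.is_nonempty
  exact ⟨a.right, ⟨a.hom.1⟩, ⟨a.hom.2⟩⟩

theorem eq_of_cospans_of_isSifted {H₁ H₂ : K ⥤ Type v} {α : Type w}
    (φ : ∀ k, H₁.obj k → H₂.obj k → α)
    (hφ : ∀ {k k'} (u : k ⟶ k') (x : H₁.obj k) (y : H₂.obj k),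
      φ k' (H₁.map u x) (H₂.map u y) = φ k x y)
    {k l m m' : K} (x : H₁.obj k) (y : H₂.obj l) (f : k ⟶ m) (g : l ⟶ m) (f' : k ⟶ m')
    (g' : l ⟶ m') :
    φ m (H₁.map f x) (H₂.map g y) = φ m' (H₁.map f' x) (H₂.map g' y) := by
  have : IsConnected (StructuredArrow (k, l) (Functor.diag K)) := Functor.Final.out _
  refine constant_of_preserves_morphisms
    (fun a : StructuredArrow (k, l) (Functor.diag K) =>
      φ a.right (H₁.map a.hom.1 x) (H₂.map a.hom.2 y)) (fun a b u => ?_)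
    (StructuredArrow.mk (Y := m) (T := Functor.diag K) (Prod.mkHom f g))
    (StructuredArrow.mk (Y := m') (T := Functor.diag K) (Prod.mkHom f' g'))
  have h := StructuredArrow.w u
  have h₁ : a.hom.1 ≫ u.right = b.hom.1 := congrArg Prod.fst h
  have h₂ : a.hom.2 ≫ u.right = b.hom.2 := congrArg Prod.snd h
  rw [← h₁, ← h₂, Functor.map_comp_apply, Functor.map_comp_apply]
  exact (hφ _ _ _).symm

theorem eq_of_isColimit_prod_of_isSifted {H₁ H₂ : K ⥤ Type v} {c₁ : Cocone H₁} {c₂ : Cocone H₂}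
    (hc₁ : IsColimit c₁) (hc₂ : IsColimit c₂) {α : Type w}
    (φ : ∀ k, H₁.obj k → H₂.obj k → α)
    (hφ : ∀ {k k'} (u : k ⟶ k') (x : H₁.obj k) (y : H₂.obj k),
      φ k' (H₁.map u x) (H₂.map u y) = φ k x y)
    {k k' : K} {x : H₁.obj k} {x' : H₁.obj k'} {y : H₂.obj k} {y' : H₂.obj k'}
    (hx : c₁.ι.app k x = c₁.ι.app k' x') (hy : c₂.ι.app k y = c₂.ι.app k' y') :
    φ k x y = φ k' x' y' := by
  choose m f g using fun k l : K => exists_cospan_of_isSifted k l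
  let f (k l) := (f k l).some
  let g (k l) := (g k l).some
  have h {k l m m' : K} (x : H₁.obj k) (y : H₂.obj l) (f : k ⟶ m) (g : l ⟶ m) (f' : k ⟶ m')
      (g' : l ⟶ m') := eq_of_cospans_of_isSifted φ hφ x y f g f' g'
  have hdiag {k} (x : H₁.obj k) (y : H₂.obj k) :
      φ k x y = φ _ (H₁.map (f k k) x) (H₂.map (g k k) y) := by
    simpa using h x y (𝟙 k) (𝟙 k) (f k k) (g k k)
  have h₁ := eq_of_isColimit_of_map_eq hc₁
    (fun l x => φ _ (H₁.map (f l k) x) (H₂.map (g l k) y)) (fun {l l'} u x => by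
      rw [← Functor.map_comp_apply]
      exact h _ _ _ _ _ _) hx
  have h₂ := eq_of_isColimit_of_map_eq hc₂
    (fun l y => φ _ (H₁.map (f k' l) x') (H₂.map (g k' l) y)) (fun {l l'} u x => by
      rw [← Functor.map_comp_apply]
      exact h _ _ _ _ _ _) hy
  rw [hdiag, hdiag x']
  exact h₁.trans h₂

end ColimitOfTypes

section SpanLinked

variable {C : Type u} [Category.{v} C] {I : Type} {A : I → C} {K K' K'' : C}

/-- Two cocones of sections of `P` under the same family are joined by a span. -/
def SpanLinked (P : Cᵒᵖ ⥤ Type v) (z : P.obj (Opposite.op K)) (z' : P.obj (Opposite.op K'))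
    (f : ∀ i, A i ⟶ K) (f' : ∀ i, A i ⟶ K') : Prop :=
  ∃ (S : C) (s : S ⟶ K) (s' : S ⟶ K') (t : ∀ i, A i ⟶ S),
    presheafRes P s z = presheafRes P s' z' ∧ ∀ i, t i ≫ s = f i ∧ t i ≫ s' = f' i

variable {P Q : Cᵒᵖ ⥤ Type v} {z : P.obj (Opposite.op K)} {z' : P.obj (Opposite.op K')}
  {z'' : P.obj (Opposite.op K'')} {f : ∀ i, A i ⟶ K} {f' : ∀ i, A i ⟶ K'} {f'' : ∀ i, A i ⟶ K''}

theorem SpanLinked.symm (h : SpanLinked P z z' f f') : SpanLinked P z' z f' f := by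
  obtain ⟨S, s, s', t, hs, ht⟩ := h
  exact ⟨S, s', s, t, hs.symm, fun i => (ht i).symm⟩

theorem SpanLinked.trans [HasPullbacks C] (h : SpanLinked P z z' f f')
    (h' : SpanLinked P z' z'' f' f'') : SpanLinked P z z'' f f'' := by
  obtain ⟨S, s, s', t, hs, ht⟩ := h
  obtain ⟨S', r, r', t', hr, ht'⟩ := h'
  refine ⟨pullback s' r, pullback.fst _ _ ≫ s, pullback.snd _ _ ≫ r',
    fun i => pullback.lift (t i) (t' i) ((ht i).2.trans (ht' i).1.symm), ?_, fun i => ?_⟩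
  · rw [presheafRes_comp, hs, presheafRes_comp, ← hr, ← presheafRes_comp, ← presheafRes_comp,
      pullback.condition]
  · rw [pullback.lift_fst_assoc, pullback.lift_snd_assoc]
    exact ⟨(ht i).1, (ht' i).2⟩

theorem SpanLinked.map (φ : P ⟶ Q) (h : SpanLinked P z z' f f') :
    SpanLinked Q (φ.app _ z) (φ.app _ z') f f' := by
  obtain ⟨S, s, s', t, hs, ht⟩ := h
  exact ⟨S, s, s', t, by rw [← app_presheafRes, ← app_presheafRes, hs], ht⟩

end SpanLinked

section ColimitClosure

variable {C : Type u} [Category.{v} C] {K : Type v} [SmallCategory K] {F : K ⥤ Cᵒᵖ ⥤ Type v}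

/-- A section of one of the presheaves in a diagram. -/
structure DiagramSection (F : K ⥤ Cᵒᵖ ⥤ Type v) where
  /-- the index of the presheaf -/
  index : K
  /-- the object over which the section lives -/
  obj : C
  /-- the section -/
  sec : (F.obj index).obj (Opposite.op obj)

/-- Restrictions of two sections in a diagram are identified by a morphism of the diagram. -/
def DiagramSection.Step (v w : DiagramSection F) (D : C) (s : D ⟶ v.obj) (t : D ⟶ w.obj) : Prop :=
  (∃ u : v.index ⟶ w.index,
    presheafRes _ s ((F.map u).app _ v.sec) = presheafRes _ t w.sec) ∨
  ∃ u : w.index ⟶ v.index, presheafRes _ s v.sec = presheafRes _ t ((F.map u).app _ w.sec)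

/-- Restrictions of two sections in a diagram are identified by a zigzag in the diagram passing
through restrictions of the sections in the family `g`. -/
def DiagramSection.Zigzag {N : Type v} (g : N → DiagramSection F) (v : DiagramSection F) :
    ℕ → ∀ (w : DiagramSection F) (D : C), (D ⟶ v.obj) → (D ⟶ w.obj) → Prop
  | 0 => fun w => v.Step w
  | n + 1 => fun w D s t =>
      ∃ (i : N) (r : D ⟶ (g i).obj), DiagramSection.Zigzag g v n (g i) D s r ∧ (g i).Step w D r t

theorem DiagramSection.cardGenerated_step {κ : Cardinal.{v}} (hκ : κ.IsRegular)
    (hK : IsCardSmallCat K κ) (hF : ∀ k, CardSeparated κ (F.obj k)) (v w : DiagramSection F) :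
    CardGenerated κ (v.Step w) := by
  have hhom (k l : K) : HasCardinalLT (k ⟶ l) κ :=
    HasCardinalLT.of_injective hK.2 (fun u : k ⟶ l => Arrow.mk u) (Arrow.mk_injective k l)
  exact (CardGenerated.iUnion hκ (hhom _ _) fun u => hF _ _ _ _ _).or hκ
    (CardGenerated.iUnion hκ (hhom _ _) fun u => hF _ _ _ _ _)

theorem DiagramSection.cardGenerated_zigzag [HasPullbacks C] {κ : Cardinal.{v}}
    (hκ : κ.IsRegular) (hK : IsCardSmallCat K κ) (hF : ∀ k, CardSeparated κ (F.obj k))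
    {N : Type v} (hN : HasCardinalLT N κ) (g : N → DiagramSection F) (v : DiagramSection F) (n : ℕ)
    (w : DiagramSection F) : CardGenerated κ (Zigzag g v n w) := by
  induction n generalizing w with
  | zero => exact cardGenerated_step hκ hK hF v w
  | succ n ih =>
    exact CardGenerated.iUnion hκ hN fun i =>
      (ih (g i)).comp hκ.aleph0_le (cardGenerated_step hκ hK hF _ _)

variable {c : Cocone F}

theorem cocone_app_presheafRes {A B : C} {k : K} (f : A ⟶ B)
    (x : (F.obj k).obj (Opposite.op B)) :
    (c.ι.app k).app _ (presheafRes (F.obj k) f x) = presheafRes c.pt f ((c.ι.app k).app _ x) :=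
  app_presheafRes (c.ι.app k) f x

theorem cocone_app_naturality {k k' : K} (u : k ⟶ k') {A : C}
    (x : (F.obj k).obj (Opposite.op A)) :
    (c.ι.app k').app _ ((F.map u).app _ x) = (c.ι.app k).app _ x := by
  rw [← c.w u]
  rfl

theorem exists_section_of_isColimit (hc : IsColimit c) {A : C} (x : c.pt.obj (Opposite.op A)) :
    ∃ (k : K) (y : (F.obj k).obj (Opposite.op A)), (c.ι.app k).app _ y = x :=
  Types.jointly_surjective_of_isColimit
    (isColimitOfPreserves ((evaluation Cᵒᵖ (Type v)).obj (Opposite.op A)) hc) x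

theorem DiagramSection.Step.eq {v w : DiagramSection F} {D : C} {s : D ⟶ v.obj} {t : D ⟶ w.obj}
    (h : v.Step w D s t) :
    presheafRes c.pt s ((c.ι.app _).app _ v.sec) =
      presheafRes c.pt t ((c.ι.app _).app _ w.sec) := by
  obtain ⟨u, h⟩ | ⟨u, h⟩ := h
  · rw [← cocone_app_naturality u v.sec, ← cocone_app_presheafRes, h, cocone_app_presheafRes]
  · rw [← cocone_app_naturality u w.sec, ← cocone_app_presheafRes, h, cocone_app_presheafRes]

theorem DiagramSection.Zigzag.eq {N : Type v} {g : N → DiagramSection F} {v : DiagramSection F}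
    {n : ℕ} {w : DiagramSection F} {D : C} {s : D ⟶ v.obj} {t : D ⟶ w.obj}
    (h : Zigzag g v n w D s t) :
    presheafRes c.pt s ((c.ι.app _).app _ v.sec) =
      presheafRes c.pt t ((c.ι.app _).app _ w.sec) := by
  induction n generalizing w with
  | zero => exact Step.eq h
  | succ n ih =>
    obtain ⟨i, r, h₁, h₂⟩ := h
    exact (ih h₁).trans (Step.eq h₂)

theorem DiagramSection.exists_zigzag (hc : IsColimit c) {ι : K → Type v} {G : ∀ k, ι k → C}
    {g : ∀ k i, (F.obj k).obj (Opposite.op (G k i))}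
    (hg : ∀ (k : K) (D : C) (x : (F.obj k).obj (Opposite.op D)),
      ∃ (i : ι k) (r : D ⟶ G k i), presheafRes _ r (g k i) = x)
    {v w : DiagramSection F} {D : C} {s : D ⟶ v.obj} {t : D ⟶ w.obj}
    (h : presheafRes c.pt s ((c.ι.app _).app _ v.sec) =
      presheafRes c.pt t ((c.ι.app _).app _ w.sec)) :
    ∃ n, Zigzag (fun i : Σ k, ι k => ⟨i.1, G i.1 i.2, g i.1 i.2⟩) v n w D s t := by
  let φ (k : K) (x : (F.obj k).obj (Opposite.op D)) : Prop :=
    ∀ (E : C) (b : (F.obj k).obj (Opposite.op E)) (t : D ⟶ E), presheafRes _ t b = x →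
      ∃ n, Zigzag (fun i : Σ k, ι k => ⟨i.1, G i.1 i.2, g i.1 i.2⟩) v n ⟨k, E, b⟩ D s t
  have key := eq_of_isColimit_of_map_eq
    (isColimitOfPreserves ((evaluation Cᵒᵖ (Type v)).obj (Opposite.op D)) hc) φ
    (fun {k k'} u x => propext ⟨fun H E b t ht => by
        obtain ⟨i, r, hr⟩ := hg k' D ((F.map u).app _ x)
        obtain ⟨n, hn⟩ := H _ _ _ hr
        refine ⟨n + 1, ⟨k', i⟩, r, hn, Or.inr ⟨u, ?_⟩⟩
        rw [← app_presheafRes, ht, hr], fun H E b t ht => by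
        obtain ⟨i, r, hr⟩ := hg k D x
        obtain ⟨n, hn⟩ := H _ _ _ hr
        refine ⟨n + 1, ⟨k, i⟩, r, hn, Or.inl ⟨u, ?_⟩⟩
        rw [← app_presheafRes, hr]
        exact ht.symm⟩)
    (x := presheafRes _ s v.sec) (x' := presheafRes _ t w.sec) (by
      have h' := h
      rw [← cocone_app_presheafRes, ← cocone_app_presheafRes] at h'
      exact h')
  refine key.mp (fun E b t ht => ⟨0, Or.inl ⟨𝟙 _, ?_⟩⟩) _ _ _ rfl
  rw [← app_presheafRes]
  simpa using ht.symm

theorem CardCovered.of_isColimit {κ : Cardinal.{v}} (hκ : κ.IsRegular) (hK : IsCardSmallCat K κ)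
    (hc : IsColimit c) (hF : ∀ k, CardCovered κ (F.obj k)) : CardCovered κ c.pt := by
  have : Fact κ.IsRegular := ⟨hκ⟩
  choose ι hι G g hg using hF
  refine ⟨Σ k, ι k, hasCardinalLT_sigma _ _ hK.1 hι, fun i => G i.1 i.2,
    fun i => (c.ι.app i.1).app _ (g i.1 i.2), fun D x => ?_⟩
  obtain ⟨k, y, rfl⟩ := exists_section_of_isColimit hc x
  obtain ⟨i, r, rfl⟩ := hg k D y
  exact ⟨⟨k, i⟩, r, (cocone_app_presheafRes _ _).symm⟩

theorem CardSeparated.of_isColimit [HasPullbacks C] {κ : Cardinal.{v}} (hκ : κ.IsRegular)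
    (huncount : Cardinal.aleph0 < κ) (hK : IsCardSmallCat K κ) (hc : IsColimit c)
    (hF : ∀ k, CardCovered κ (F.obj k)) (hF' : ∀ k, CardSeparated κ (F.obj k)) :
    CardSeparated κ c.pt := by
  have : Fact κ.IsRegular := ⟨hκ⟩
  choose ι hι G g hg using hF
  intro A B a b
  obtain ⟨k, a, rfl⟩ := exists_section_of_isColimit hc a
  obtain ⟨l, b, rfl⟩ := exists_section_of_isColimit hc b
  have h := CardGenerated.iUnion hκ (X := ULift.{v} ℕ)
    (by rwa [hasCardinalLT_iff_cardinal_mk_lt, Cardinal.mk_uLift, Cardinal.mk_nat,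
      Cardinal.lift_aleph0])
    fun n => DiagramSection.cardGenerated_zigzag hκ hK hF' (hasCardinalLT_sigma _ _ hK.1 hι)
      (fun i : Σ k, ι k => ⟨i.1, G i.1 i.2, g i.1 i.2⟩) ⟨k, A, a⟩ n.down ⟨l, B, b⟩
  convert h using 4 with D s t
  constructor
  · intro h
    obtain ⟨n, hn⟩ := DiagramSection.exists_zigzag hc hg (v := ⟨k, A, a⟩) (w := ⟨l, B, b⟩) h
    exact ⟨⟨n⟩, hn⟩
  · rintro ⟨n, hn⟩
    exact hn.eq

theorem SiftedAt.of_isColimit [IsSifted K] [HasPullbacks C] (hc : IsColimit c)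
    (hF : ∀ k, SiftedAt Bool (F.obj k)) : SiftedAt Bool c.pt := by
  constructor
  · intro A x
    choose k y hy using fun i => exists_section_of_isColimit hc (x i)
    obtain ⟨m, ⟨u⟩, ⟨u'⟩⟩ := exists_cospan_of_isSifted (k false) (k true)
    let w (i : Bool) : k i ⟶ m := Bool.rec u u' i
    obtain ⟨E, z, f, hf⟩ := (hF m).1 A fun i => (F.map (w i)).app _ (y i)
    refine ⟨E, (c.ι.app m).app _ z, f, fun i => ?_⟩
    rw [← cocone_app_presheafRes, hf, cocone_app_naturality, hy]
  · intro A E E' z z' f f' hff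
    obtain ⟨k, z, rfl⟩ := exists_section_of_isColimit hc z
    obtain ⟨k', z', rfl⟩ := exists_section_of_isColimit hc z'
    let R (s t : Σ k, (F.obj k).obj (Opposite.op (A false)) × (F.obj k).obj (Opposite.op (A true))) :
        Prop :=
      ∀ (K K' : C) (z : (F.obj s.1).obj (Opposite.op K)) (z' : (F.obj t.1).obj (Opposite.op K'))
        (f : ∀ i, A i ⟶ K) (f' : ∀ i, A i ⟶ K'),
        presheafRes _ (f false) z = s.2.1 → presheafRes _ (f true) z = s.2.2 →
        presheafRes _ (f' false) z' = t.2.1 → presheafRes _ (f' true) z' = t.2.2 →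
        SpanLinked c.pt ((c.ι.app s.1).app _ z) ((c.ι.app t.1).app _ z') f f'
    have hR {k k' : K} (u : k ⟶ k') (x : (F.obj k).obj (Opposite.op (A false)))
        (y : (F.obj k).obj (Opposite.op (A true))) :
        R ⟨k, x, y⟩ ⟨k', (F.map u).app _ x, (F.map u).app _ y⟩ := by
      intro K K' z z' f f' h₁ h₂ h₃ h₄
      have h : SpanLinked (F.obj k') ((F.map u).app _ z) z' f f' := (hF k').2 _ _ _ _ _ _ _ (by
        rintro (_ | _)
        · rw [← app_presheafRes, h₁, h₃]
        · rw [← app_presheafRes, h₂, h₄])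
      have h' := h.map (c.ι.app k')
      rw [cocone_app_naturality] at h'
      exact h'
    have hsymm {s t} (h : R s t) : R t s := fun K K' z z' f f' h₁ h₂ h₃ h₄ =>
      (h K' K z' z f' f h₃ h₄ h₁ h₂).symm
    have htrans {s t r} (h : R s t) (h' : R t r) : R s r := by
      intro K K' z z' f f' h₁ h₂ h₃ h₄
      obtain ⟨L, y, g, hg⟩ := (hF t.1).1 A fun i => Bool.rec t.2.1 t.2.2 i
      exact (h _ _ _ _ _ _ h₁ h₂ (hg false) (hg true)).trans
        (h' _ _ _ _ _ _ (hg false) (hg true) h₃ h₄)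
    let S : Setoid (Σ k, (F.obj k).obj (Opposite.op (A false)) ×
        (F.obj k).obj (Opposite.op (A true))) :=
      ⟨R, fun s => by simpa using hR (𝟙 s.1) s.2.1 s.2.2, hsymm, htrans⟩
    have key := eq_of_isColimit_prod_of_isSifted
      (isColimitOfPreserves ((evaluation Cᵒᵖ (Type v)).obj (Opposite.op (A false))) hc)
      (isColimitOfPreserves ((evaluation Cᵒᵖ (Type v)).obj (Opposite.op (A true))) hc)
      (fun k x y => Quotient.mk S ⟨k, x, y⟩) (fun u x y => (Quotient.sound (hR u x y)).symm)
      (x := presheafRes _ (f false) z) (x' := presheafRes _ (f' false) z')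
      (y := presheafRes _ (f true) z) (y' := presheafRes _ (f' true) z')
      (by have h := hff false; rw [← cocone_app_presheafRes, ← cocone_app_presheafRes] at h; exact h)
      (by have h := hff true; rw [← cocone_app_presheafRes, ← cocone_app_presheafRes] at h; exact h)
    exact Quotient.exact key E E' z z' f f' rfl rfl rfl rfl

theorem CardSifted.of_isColimit [IsSifted K] [HasPullbacks C] {κ : Cardinal.{v}}
    (hκ : κ.IsRegular) (huncount : Cardinal.aleph0 < κ) (hK : IsCardSmallCat K κ)
    (hc : IsColimit c) (hF : ∀ k, CardSifted κ (F.obj k)) : CardSifted κ c.pt where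
  covered := .of_isColimit hκ hK hc fun k => (hF k).covered
  separated := .of_isColimit hκ huncount hK hc (fun k => (hF k).covered) fun k => (hF k).separated
  nonempty := by
    obtain ⟨k⟩ := IsSifted.nonempty (C := K)
    obtain ⟨A, ⟨a⟩⟩ := (hF k).nonempty
    exact ⟨A, ⟨(c.ι.app k).app _ a⟩⟩
  sifted := .of_isColimit hc fun k => (hF k).sifted

end ColimitClosure

theorem sindClosed_setOf_cardSifted {C : Type u} [Category.{v} C] [HasPullbacks C]
    {κ : Cardinal.{v}} (hκ : κ.IsRegular) (huncount : Cardinal.aleph0 < κ) :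
    SindClosed (C := C) κ {P | CardSifted κ P} :=
  ⟨fun X => cardSifted_yoneda hκ.aleph0_le X, fun _ _ h ⟨e⟩ => h.of_iso e,
    fun _ _ _ hK _ _ hc hF => CardSifted.of_isColimit hκ huncount hK hc hF⟩

/-- For regular cardinals `λ ≪ κ` with `κ` uncountable and a category `C` with
`λ`-small limits, `Sind_κ(C)` is closed in `[Cᵒᵖ, Set]` under `λ`-small
limits. -/
theorem sindCardinal_closed_under_cardSmall_limits
    (lam κ : Cardinal.{v}) (hlam : lam.IsRegular) (hκ : κ.IsRegular)
    (hll : CardLL lam κ) (huncount : Cardinal.aleph0 < κ)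
    {C : Type u} [Category.{v} C]
    (hlims : ∀ (J : Type v) [SmallCategory J], IsCardSmallCat J lam →
      HasLimitsOfShape J C)
    (J : Type v) [SmallCategory J] (hJ : IsCardSmallCat J lam)
    (F : J ⥤ (Cᵒᵖ ⥤ Type v)) (c : Cone F) (hc : IsLimit c)
    (hF : ∀ j, ∀ T : Set (Cᵒᵖ ⥤ Type v), SindClosed κ T → F.obj j ∈ T) :
    ∀ T : Set (Cᵒᵖ ⥤ Type v), SindClosed κ T → c.pt ∈ T := by
  have := hasFiniteLimits_of_hasCardSmallLimits hlam.aleph0_le hlims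
  exact fun T hT => (CardSifted.of_isLimit hlam hκ hll huncount hlims hJ hc fun j =>
    hF j _ (sindClosed_setOf_cardSifted hκ huncount)).mem_of_sindClosed hκ huncount hT
end
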